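/- arXiv:1706.03134 — 3 statements merged into one kernel-verified Lean document; each statement's English description precedes it below -/
import Mathlib

section
/- Given ε > 0, there exists A > 0 such that for every a > A the global minimizer v_{ε,a} of E is unique and radially equivariant, i.e. v(x) = v_rad(|x|) x/|x| for some scalar function v_rad; equivalently v(gx) = g v(x) for all g ∈ O(2). -/
open MeasureTheory Filter Real Set
open scoped Topology ENNReal

noncomputable section

/-- We identify the plane with the Euclidean space `ℝ²`. -/
abbrev E2 : Type := EuclideanSpace ℝ (Fin 2)

/-- The standard basis vectors of `ℝ²`. -/
def e2basis (i : Fin 2) : E2 := EuclideanSpace.single i 1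

/-- Rotation of a vector by `π/2` (multiplication by `i` in complex notation). -/
def perp (e : E2) : E2 := EuclideanSpace.single 0 (-(e 1)) + EuclideanSpace.single 1 (e 0)

/-- The unit vector `e^{iθ}`. -/
def uvec (θ : ℝ) : E2 := EuclideanSpace.single 0 (Real.cos θ) + EuclideanSpace.single 1 (Real.sin θ)

/-- The Laplacian of a map `u : ℝ² → ℝ²`. -/
def lap (u : E2 → E2) (x : E2) : E2 :=
  ∑ i : Fin 2, fderiv ℝ (fun y => fderiv ℝ u y (e2basis i)) x (e2basis i)

/-- `|∇u|²`, the squared Hilbert-Schmidt norm of the full gradient of `u : ℝ² → ℝ²`. -/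
def gradSq (u : E2 → E2) (x : E2) : ℝ := ∑ i : Fin 2, ‖fderiv ℝ u x (e2basis i)‖ ^ 2

/-- `∑_j ∇u_j · ∇ψ_j`, the Hilbert-Schmidt inner product of the gradients. -/
def gradInner (u ψ : E2 → E2) (x : E2) : ℝ :=
  ∑ i : Fin 2, (inner ℝ (fderiv ℝ u x (e2basis i)) (fderiv ℝ ψ x (e2basis i)) : ℝ)

/-- Membership in `H¹(ℝ²,ℝ²)`: `u ∈ L²` together with its gradient. -/
def MemH1 (u : E2 → E2) : Prop :=
  Differentiable ℝ u ∧ MemLp u 2 (volume : Measure E2) ∧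
    MemLp (fun x => fderiv ℝ u x) 2 (volume : Measure E2)

/-- The Ginzburg–Landau energy
`E(u) = ∫ (1/2)|∇u|² − (1/(2ε²))μ|u|² + (1/(4ε²))|u|⁴ − (a/ε) f·u`. -/
def energy (ε a : ℝ) (μ : E2 → ℝ) (f : E2 → E2) (u : E2 → E2) : ℝ :=
  ∫ x : E2, ((1/2) * gradSq u x - (1/(2*ε^2)) * μ x * ‖u x‖^2
    + (1/(4*ε^2)) * ‖u x‖^4 - (a/ε) * (inner ℝ (f x) (u x) : ℝ))

/-- `v` is a global minimizer of `E` over `H¹(ℝ²,ℝ²)`. -/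
def IsMinimizer (ε a : ℝ) (μ : E2 → ℝ) (f : E2 → E2) (v : E2 → E2) : Prop :=
  MemH1 v ∧ ∀ u : E2 → E2, MemH1 u → energy ε a μ f v ≤ energy ε a μ f u

/-- `u` is a smooth classical solution of the Euler–Lagrange equation
`ε²Δu + μu − |u|²u + εa f = 0` on `ℝ²`. -/
def IsSolution (ε a : ℝ) (μ : E2 → ℝ) (f : E2 → E2) (u : E2 → E2) : Prop :=
  ContDiff ℝ (⊤ : ℕ∞) u ∧ ∀ x : E2, ε^2 • lap u x + μ x • u x - ‖u x‖^2 • u x + (ε*a) • f x = 0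

/-- Hypotheses on the radial coefficient `μ`. -/
structure MuHyp (μ : E2 → ℝ) (μrad : ℝ → ℝ) (ρ : ℝ) : Prop where
  smooth : ContDiff ℝ (⊤ : ℕ∞) μ
  smooth_rad : ContDiff ℝ (⊤ : ℕ∞) μrad
  even_rad : ∀ r : ℝ, μrad (-r) = μrad r
  radial : ∀ x : E2, μ x = μrad ‖x‖
  bdd : ∃ C : ℝ, ∀ x : E2, |μ x| ≤ C
  deriv_neg : ∀ r : ℝ, 0 < r → deriv μrad r < 0
  rho_pos : 0 < ρ
  rho_root : μrad ρ = 0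
  rho_unique : ∀ r : ℝ, 0 < r → μrad r = 0 → r = ρ

/-- Hypotheses on the radial vector field `f`. -/
structure FHyp (f : E2 → E2) (frad : ℝ → ℝ) : Prop where
  smooth : ContDiff ℝ (⊤ : ℕ∞) f
  smooth_rad : ContDiff ℝ (⊤ : ℕ∞) frad
  odd_rad : ∀ r : ℝ, frad (-r) = -frad r
  radial : ∀ x : E2, x ≠ 0 → f x = (frad ‖x‖ / ‖x‖) • x
  integrable : Integrable f (volume : Measure E2)
  bdd : ∃ C : ℝ, ∀ x : E2, ‖f x‖ ≤ C
  pos_rad : ∀ r : ℝ, 0 < r → 0 < frad r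

/-- Convergence in `C²_loc(ℝ²,ℝ²)` of a sequence of maps. -/
def TendstoC2LocSeq (F : ℕ → E2 → E2) (g : E2 → E2) : Prop :=
  TendstoLocallyUniformly F g atTop ∧
  TendstoLocallyUniformly (fun n x => fderiv ℝ (F n) x) (fun x => fderiv ℝ g x) atTop ∧
  TendstoLocallyUniformly (fun n x => fderiv ℝ (fderiv ℝ (F n)) x)
    (fun x => fderiv ℝ (fderiv ℝ g) x) atTop

/-- `l` is a limit point (as `ε → 0`) of the set of zeros of the family `v ε`. -/
def IsZeroLimitPoint (v : ℝ → E2 → E2) (l : E2) : Prop :=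
  ∃ (εs : ℕ → ℝ) (xs : ℕ → E2), (∀ n, 0 < εs n) ∧ Tendsto εs atTop (𝓝 (0:ℝ)) ∧
    (∀ n, v (εs n) (xs n) = 0) ∧ Tendsto xs atTop (𝓝 l)

def gpsi (k r : ℝ) : ℝ := r * Real.exp (k * r) / √(2 * (1 + k * r))

def gchi (k r : ℝ) : ℝ := Real.exp (-(k * r)) / √(2 * (1 + k * r)) / r

def glp (k r : ℝ) : ℝ := 1 / r + k - k / (2 * (1 + k * r))

def glm (k r : ℝ) : ℝ := 1 / r + k + k / (2 * (1 + k * r))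

def gkap (k r : ℝ) : ℝ :=
  k * (6 + 21 * (k * r) + 16 * (k * r) ^ 2 + 4 * (k * r) ^ 3) / (4 * r * (1 + k * r) ^ 2)

lemma gsqrt_deriv {k r : ℝ} (hk : 0 < k) (hr : 0 < r) :
    HasDerivAt (fun r => √(2 * (1 + k * r))) (k / √(2 * (1 + k * r))) r := by
  have h1 : HasDerivAt (fun r : ℝ => 2 * (1 + k * r)) (2 * k) r := by
    have := (((hasDerivAt_id r).const_mul k).const_add 1).const_mul 2
    simpa using this
  have hpos : 0 < 2 * (1 + k * r) := by positivity
  convert h1.sqrt hpos.ne' using 1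
  field_simp

lemma gpsi_deriv {k r : ℝ} (hk : 0 < k) (hr : 0 < r) :
    HasDerivAt (gpsi k) (glp k r * gpsi k r) r := by
  have h1 : HasDerivAt (fun r : ℝ => Real.exp (k * r)) (Real.exp (k * r) * k) r := by
    have := ((hasDerivAt_id r).const_mul k).exp
    simpa using this
  have h2 := ((hasDerivAt_id r).mul h1).div (gsqrt_deriv hk hr) (by positivity)
  have hpos : 0 < 1 + k * r := by positivity
  have hs : √(2 * (1 + k * r)) ^ 2 = 2 * (1 + k * r) := Real.sq_sqrt (by positivity)
  have hsp : 0 < √(2 * (1 + k * r)) := by positivity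
  refine HasDerivAt.congr_deriv (h2 : HasDerivAt _ _ r) ?_
  simp only [glp, gpsi, id]
  set S := √(2 * (1 + k * r))
  have e : 1 + k * r = S ^ 2 / 2 := by linarith
  rw [e]
  field_simp
  simp only [Pi.mul_apply, id]
  ring

lemma gchi_deriv {k r : ℝ} (hk : 0 < k) (hr : 0 < r) :
    HasDerivAt (gchi k) (-(glm k r) * gchi k r) r := by
  have h1 : HasDerivAt (fun r : ℝ => Real.exp (-(k * r))) (Real.exp (-(k * r)) * (-k)) r := by
    have := ((hasDerivAt_id r).const_mul k).neg.exp
    simpa using this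
  have h2 := (h1.div (gsqrt_deriv hk hr) (by positivity)).div (hasDerivAt_id r) hr.ne'
  have hpos : 0 < 1 + k * r := by positivity
  have hs : √(2 * (1 + k * r)) ^ 2 = 2 * (1 + k * r) := Real.sq_sqrt (by positivity)
  have hsp : 0 < √(2 * (1 + k * r)) := by positivity
  refine HasDerivAt.congr_deriv (h2 : HasDerivAt _ _ r) ?_
  simp only [glm, gchi, id, Pi.div_apply]
  set S := √(2 * (1 + k * r))
  have e : 1 + k * r = S ^ 2 / 2 := by linarith
  rw [e]
  field_simp
  ring

lemma gaux_deriv {k r : ℝ} (hk : 0 < k) (hr : 0 < r) :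
    HasDerivAt (fun r : ℝ => k / (2 * (1 + k * r))) (-(k ^ 2 / (2 * (1 + k * r) ^ 2))) r := by
  have h1 : HasDerivAt (fun r : ℝ => 2 * (1 + k * r)) (2 * k) r := by
    have := (((hasDerivAt_id r).const_mul k).const_add 1).const_mul 2
    simpa using this
  have hpos : 0 < 1 + k * r := by positivity
  refine HasDerivAt.congr_deriv ((hasDerivAt_const r k).div h1 (by positivity)) ?_
  field_simp
  ring

lemma glp_deriv {k r : ℝ} (hk : 0 < k) (hr : 0 < r) :
    HasDerivAt (glp k) (gkap k r + 1 / r ^ 2 - glp k r / r - glp k r ^ 2) r := by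
  have h1 : HasDerivAt (fun r : ℝ => 1 / r) (-(1 / r ^ 2)) r := by
    have := hasDerivAt_inv hr.ne'
    simpa using this
  have hpos : 0 < 1 + k * r := by positivity
  refine HasDerivAt.congr_deriv ((h1.add_const k).sub (gaux_deriv hk hr)) ?_
  simp only [glp, gkap]
  field_simp
  ring

lemma glm_deriv {k r : ℝ} (hk : 0 < k) (hr : 0 < r) :
    HasDerivAt (glm k) (glm k r ^ 2 - glm k r / r - 1 / r ^ 2 - gkap k r) r := by
  have h1 : HasDerivAt (fun r : ℝ => 1 / r) (-(1 / r ^ 2)) r := by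
    have := hasDerivAt_inv hr.ne'
    simpa using this
  have hpos : 0 < 1 + k * r := by positivity
  refine HasDerivAt.congr_deriv ((h1.add_const k).add (gaux_deriv hk hr)) ?_
  simp only [glm, gkap]
  field_simp
  ring

lemma gwronsk {k r : ℝ} (hk : 0 < k) (hr : 0 < r) :
    r * gpsi k r * gchi k r * (glp k r + glm k r) = 1 := by
  have hpos : 0 < 1 + k * r := by positivity
  have hs : √(2 * (1 + k * r)) ^ 2 = 2 * (1 + k * r) := Real.sq_sqrt (by positivity)
  have hsp : 0 < √(2 * (1 + k * r)) := by positivity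
  simp only [glp, glm, gpsi, gchi]
  have he : Real.exp (-(k * r)) = (Real.exp (k * r))⁻¹ := Real.exp_neg _
  have hep := Real.exp_pos (k * r)
  rw [he]
  set S := √(2 * (1 + k * r))
  have e : 1 + k * r = S ^ 2 / 2 := by linarith
  rw [e]
  field_simp
  nlinarith

lemma gpsi_pos {k r : ℝ} (hk : 0 < k) (hr : 0 < r) : 0 < gpsi k r := by
  unfold gpsi; positivity

lemma gchi_pos {k r : ℝ} (hk : 0 < k) (hr : 0 < r) : 0 < gchi k r := by
  unfold gchi; positivity

lemma gkap_ge {k r : ℝ} (hk : 0 < k) (hr : 0 < r) : k ^ 2 ≤ gkap k r := by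
  unfold gkap
  rw [le_div_iff₀ (by positivity)]
  have : 0 < k * r := by positivity
  nlinarith [mul_pos hk this, mul_pos (mul_pos hk this) this,
    mul_pos (mul_pos (mul_pos hk this) this) this]

lemma gkap_le {k r : ℝ} (hk : 0 < k) (hr : 0 < r) : gkap k r ≤ 6 * k / r + 6 * k ^ 2 := by
  have : 6 * k / r + 6 * k ^ 2 = 6 * k * (1 + k * r) / r := by field_simp
  rw [this]
  unfold gkap
  rw [div_le_div_iff₀ (by positivity) (by positivity)]
  have h : 0 < k * r := by positivity
  have : 0 ≤ k * r * (6 * (1 + k * r) * (4 * (1 + k * r) ^ 2) - (6 + 21 * (k * r) + 16 * (k * r) ^ 2 + 4 * (k * r) ^ 3)) := by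
    apply mul_nonneg h.le
    nlinarith [mul_pos h h, mul_pos (mul_pos h h) h]
  nlinarith [this]

lemma glp_nonneg {k r : ℝ} (hk : 0 < k) (hr : 0 < r) : 0 ≤ glp k r := by
  unfold glp
  have : k / (2 * (1 + k * r)) ≤ k := by
    rw [div_le_iff₀ (by positivity)]
    nlinarith [mul_pos hk hr, mul_pos hk (mul_pos hk hr)]
  have : 0 < 1 / r := by positivity
  linarith

lemma glp_le {k r : ℝ} (hk : 0 < k) (hr : 0 < r) : glp k r ≤ (1 + 2 * k) * (1 + 1 / r) := by
  unfold glp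
  have : 0 < k / (2 * (1 + k * r)) := by positivity
  have : 0 < 1 / r := by positivity
  nlinarith [mul_pos hk this]

lemma glm_le {k r : ℝ} (hk : 0 < k) (hr : 0 < r) : glm k r ≤ (1 + 2 * k) * (1 + 1 / r) := by
  unfold glm
  have : k / (2 * (1 + k * r)) ≤ k := by
    rw [div_le_iff₀ (by positivity)]
    nlinarith [mul_pos hk hr, mul_pos hk (mul_pos hk hr)]
  have : 0 < 1 / r := by positivity
  nlinarith [mul_pos hk this]

lemma glm_nonneg {k r : ℝ} (hk : 0 < k) (hr : 0 < r) : 0 ≤ glm k r := by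
  unfold glm; positivity

lemma gpsi_le {k r : ℝ} (hk : 0 < k) (hr : 0 ≤ r) : gpsi k r ≤ r * Real.exp (k * r) := by
  unfold gpsi
  apply div_le_self (by positivity)
  rw [Real.one_le_sqrt]
  nlinarith [mul_nonneg hk.le hr]

lemma gchi_le {k r : ℝ} (hk : 0 < k) (hr : 0 < r) : gchi k r * r ≤ Real.exp (-(k * r)) := by
  unfold gchi
  rw [div_mul_cancel₀ _ hr.ne']
  apply div_le_self (by positivity)
  rw [Real.one_le_sqrt]
  nlinarith [mul_nonneg hk.le hr.le]



def gGreen (k : ℝ) (h : ℝ → ℝ) (r : ℝ) : ℝ :=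
  gchi k r * (∫ s in (0:ℝ)..r, gpsi k s * h s * s) + gpsi k r * ∫ s in Ioi r, gchi k s * h s * s

/-- admissible right-hand sides -/
structure GAdm (h : ℝ → ℝ) (C : ℝ) : Prop where
  meas : AEStronglyMeasurable h (volume.restrict (Ioi 0))
  nonneg : ∀ s, 0 < s → 0 ≤ h s
  le : ∀ s, 0 < s → h s ≤ C

lemma gpsi_contOn {k : ℝ} (hk : 0 < k) : ContinuousOn (gpsi k) (Ioi 0) :=
  fun _ hr => (gpsi_deriv hk hr).continuousAt.continuousWithinAt

lemma gchi_contOn {k : ℝ} (hk : 0 < k) : ContinuousOn (gchi k) (Ioi 0) :=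
  fun _ hr => (gchi_deriv hk hr).continuousAt.continuousWithinAt

lemma gmeas_psi {k : ℝ} (hk : 0 < k) {h : ℝ → ℝ} {C : ℝ} (hh : GAdm h C) :
    AEStronglyMeasurable (fun s => gpsi k s * h s * s) (volume.restrict (Ioi 0)) :=
  (((gpsi_contOn hk).aestronglyMeasurable measurableSet_Ioi).mul hh.meas).mul
    continuous_id.aestronglyMeasurable

lemma gmeas_chi {k : ℝ} (hk : 0 < k) {h : ℝ → ℝ} {C : ℝ} (hh : GAdm h C) :
    AEStronglyMeasurable (fun s => gchi k s * h s * s) (volume.restrict (Ioi 0)) :=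
  (((gchi_contOn hk).aestronglyMeasurable measurableSet_Ioi).mul hh.meas).mul
    continuous_id.aestronglyMeasurable

lemma gpsi_bound {k : ℝ} (hk : 0 < k) {h : ℝ → ℝ} {C : ℝ} (hh : GAdm h C) {s r : ℝ}
    (hs : 0 < s) (hsr : s ≤ r) :
    ‖gpsi k s * h s * s‖ ≤ (r * Real.exp (k * r)) * C * r := by
  have h1 := gpsi_pos hk hs
  have h2 := hh.nonneg s hs
  have h3 := hh.le s hs
  have h4 := gpsi_le hk hs.le
  rw [Real.norm_of_nonneg (by positivity)]
  have h5 : s * Real.exp (k * s) ≤ r * Real.exp (k * r) := by gcongr; linarith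
  have hC : 0 ≤ C := h2.trans h3
  have hr : 0 < r := by linarith
  gcongr
  exact h4.trans h5

lemma gchi_bound {k : ℝ} (hk : 0 < k) {h : ℝ → ℝ} {C : ℝ} (hh : GAdm h C) {s : ℝ}
    (hs : 0 < s) :
    ‖gchi k s * h s * s‖ ≤ C * Real.exp (-k * s) := by
  have h1 := gchi_pos hk hs
  have h2 := hh.nonneg s hs
  have h3 := hh.le s hs
  have h4 := gchi_le hk hs
  have hC : 0 ≤ C := h2.trans h3
  rw [Real.norm_of_nonneg (by positivity)]
  calc gchi k s * h s * s = h s * (gchi k s * s) := by ring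
    _ ≤ C * Real.exp (-(k * s)) := by gcongr
    _ = _ := by ring_nf

lemma gint_psi {k : ℝ} (hk : 0 < k) {h : ℝ → ℝ} {C : ℝ} (hh : GAdm h C) {r : ℝ} (hr : 0 ≤ r) :
    IntervalIntegrable (fun s => gpsi k s * h s * s) volume 0 r := by
  rw [intervalIntegrable_iff_integrableOn_Ioc_of_le hr]
  refine Integrable.mono' (g := fun _ => (r * Real.exp (k * r)) * C * r)
    (integrableOn_const (by simp)) ?_ ?_
  · exact (gmeas_psi hk hh).mono_measure (Measure.restrict_mono Ioc_subset_Ioi_self le_rfl)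
  · refine (ae_restrict_mem measurableSet_Ioc).mono fun s hs => gpsi_bound hk hh hs.1 hs.2

lemma gint_chi0 {k : ℝ} (hk : 0 < k) {h : ℝ → ℝ} {C : ℝ} (hh : GAdm h C) :
    IntegrableOn (fun s => gchi k s * h s * s) (Ioi 0) := by
  refine Integrable.mono' ((exp_neg_integrableOn_Ioi 0 hk).const_mul C) (gmeas_chi hk hh) ?_
  exact (ae_restrict_mem measurableSet_Ioi).mono fun s hs => gchi_bound hk hh hs

lemma gint_chi {k : ℝ} (hk : 0 < k) {h : ℝ → ℝ} {C : ℝ} (hh : GAdm h C) {r : ℝ} (hr : 0 ≤ r) :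
    IntegrableOn (fun s => gchi k s * h s * s) (Ioi r) :=
  (gint_chi0 hk hh).mono_set (Ioi_subset_Ioi hr)

lemma gGreen_nonneg {k : ℝ} (hk : 0 < k) {h : ℝ → ℝ} {C : ℝ} (hh : GAdm h C) {r : ℝ} (hr : 0 < r) :
    0 ≤ gGreen k h r := by
  have h1 : 0 ≤ ∫ s in (0:ℝ)..r, gpsi k s * h s * s := by
    rw [intervalIntegral.integral_of_le hr.le]
    refine setIntegral_nonneg measurableSet_Ioc fun s hs => ?_
    have := gpsi_pos hk hs.1
    have := hh.nonneg s hs.1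
    have := hs.1
    positivity
  have h2 : 0 ≤ ∫ s in Ioi r, gchi k s * h s * s := by
    refine setIntegral_nonneg measurableSet_Ioi fun s hs => ?_
    have hs0 : 0 < s := hr.trans hs
    have := gchi_pos hk hs0
    have := hh.nonneg s hs0
    positivity
  have := gpsi_pos hk hr
  have := gchi_pos hk hr
  unfold gGreen
  positivity

lemma gGreen_mono {k : ℝ} (hk : 0 < k) {h h' : ℝ → ℝ} {C C' : ℝ} (hh : GAdm h C) (hh' : GAdm h' C')
    (hle : ∀ s, 0 < s → h s ≤ h' s) {r : ℝ} (hr : 0 < r) :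
    gGreen k h r ≤ gGreen k h' r := by
  have h1 : (∫ s in (0:ℝ)..r, gpsi k s * h s * s) ≤ ∫ s in (0:ℝ)..r, gpsi k s * h' s * s := by
    rw [intervalIntegral.integral_of_le hr.le, intervalIntegral.integral_of_le hr.le]
    refine setIntegral_mono_on ((gint_psi hk hh hr.le).1) ((gint_psi hk hh' hr.le).1)
      measurableSet_Ioc fun s hs => ?_
    have := gpsi_pos hk hs.1
    have := hle s hs.1
    have := hs.1
    gcongr
  have h2 : (∫ s in Ioi r, gchi k s * h s * s) ≤ ∫ s in Ioi r, gchi k s * h' s * s := by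
    refine setIntegral_mono_on (gint_chi hk hh hr.le) (gint_chi hk hh' hr.le)
      measurableSet_Ioi fun s hs => ?_
    have hs0 : 0 < s := hr.trans hs
    have := gchi_pos hk hs0
    have := hle s hs0
    gcongr
  have := gpsi_pos hk hr
  have := gchi_pos hk hr
  unfold gGreen
  gcongr

/-- pass to the limit -/
lemma gGreen_tendsto {k : ℝ} (hk : 0 < k) {h : ℕ → ℝ → ℝ} {h' : ℝ → ℝ} {C : ℝ}
    (hh : ∀ n, GAdm (h n) C)
    (hlim : ∀ s, 0 < s → Tendsto (fun n => h n s) atTop (𝓝 (h' s))) {r : ℝ} (hr : 0 < r) :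
    Tendsto (fun n => gGreen k (h n) r) atTop (𝓝 (gGreen k h' r)) := by
  unfold gGreen
  refine Tendsto.add (Tendsto.const_mul _ ?_) (Tendsto.const_mul _ ?_)
  · simp only [intervalIntegral.integral_of_le hr.le]
    refine tendsto_integral_of_dominated_convergence (fun _ => (r * Real.exp (k * r)) * C * r)
      (fun n => (gint_psi hk (hh n) hr.le).1.aestronglyMeasurable) (integrableOn_const (by simp)) ?_ ?_
    · intro n
      exact (ae_restrict_mem measurableSet_Ioc).mono fun s hs => gpsi_bound hk (hh n) hs.1 hs.2
    · exact (ae_restrict_mem measurableSet_Ioc).mono fun s hs =>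
        ((hlim s hs.1).const_mul _).mul_const _
  · refine tendsto_integral_of_dominated_convergence (fun s => C * Real.exp (-k * s))
      (fun n => (gint_chi hk (hh n) hr.le).aestronglyMeasurable)
      ((exp_neg_integrableOn_Ioi r hk).const_mul C) ?_ ?_
    · intro n
      exact (ae_restrict_mem measurableSet_Ioi).mono fun s hs =>
        gchi_bound hk (hh n) (hr.trans hs)
    · exact (ae_restrict_mem measurableSet_Ioi).mono fun s hs =>
        ((hlim s (hr.trans hs)).const_mul _).mul_const _

lemma gtail_eq {k : ℝ} (hk : 0 < k) {h : ℝ → ℝ} {C : ℝ} (hh : GAdm h C) {r : ℝ} (hr : 0 ≤ r) :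
    (∫ s in Ioi r, gchi k s * h s * s) = (∫ s in Ioi (0:ℝ), gchi k s * h s * s)
      - ∫ s in (0:ℝ)..r, gchi k s * h s * s := by
  have := intervalIntegral.integral_interval_add_Ioi (gint_chi0 hk hh) (gint_chi hk hh hr)
  linarith

lemma gint_chi_int {k : ℝ} (hk : 0 < k) {h : ℝ → ℝ} {C : ℝ} (hh : GAdm h C) {r : ℝ} (hr : 0 ≤ r) :
    IntervalIntegrable (fun s => gchi k s * h s * s) volume 0 r := by
  rw [intervalIntegrable_iff_integrableOn_Ioc_of_le hr]
  exact (gint_chi0 hk hh).mono_set Ioc_subset_Ioi_self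

lemma gGreen_cont {k : ℝ} (hk : 0 < k) {h : ℝ → ℝ} {C : ℝ} (hh : GAdm h C) :
    ContinuousOn (gGreen k h) (Ioi 0) := by
  intro r hr
  have hr : 0 < r := hr
  have hR : (0:ℝ) ≤ r + 1 := by linarith
  have hnb : Icc 0 (r + 1) ∈ 𝓝 r := Icc_mem_nhds hr (by linarith)
  have c1 : ContinuousAt (fun r => ∫ s in (0:ℝ)..r, gpsi k s * h s * s) r := by
    have := intervalIntegral.continuousOn_primitive_interval'
      (gint_psi hk hh hR) (left_mem_uIcc)
    rw [uIcc_of_le hR] at this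
    exact this.continuousAt hnb
  have c2 : ContinuousAt (fun r => ∫ s in (0:ℝ)..r, gchi k s * h s * s) r := by
    have := intervalIntegral.continuousOn_primitive_interval'
      (gint_chi_int hk hh hR) (left_mem_uIcc)
    rw [uIcc_of_le hR] at this
    exact this.continuousAt hnb
  have c3 : ContinuousAt (fun r => ∫ s in Ioi r, gchi k s * h s * s) r := by
    refine ContinuousAt.congr (continuousAt_const.sub c2) ?_ (f := fun r =>
      (∫ s in Ioi (0:ℝ), gchi k s * h s * s) - ∫ s in (0:ℝ)..r, gchi k s * h s * s)
    filter_upwards [hnb] with t ht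
    exact (gtail_eq hk hh ht.1).symm
  exact (((gchi_deriv hk hr).continuousAt.mul c1).add
    ((gpsi_deriv hk hr).continuousAt.mul c3)).continuousWithinAt

def gGreen1 (k : ℝ) (h : ℝ → ℝ) (r : ℝ) : ℝ :=
  -(glm k r) * gchi k r * (∫ s in (0:ℝ)..r, gpsi k s * h s * s)
    + glp k r * gpsi k r * ∫ s in Ioi r, gchi k s * h s * s

lemma gGreen_prim {k : ℝ} (hk : 0 < k) {h : ℝ → ℝ} {C : ℝ} (hh : GAdm h C)
    (hc : ContinuousOn h (Ioi 0)) {r : ℝ} (hr : 0 < r) :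
    HasDerivAt (fun r => ∫ s in (0:ℝ)..r, gpsi k s * h s * s) (gpsi k r * h r * r) r ∧
    HasDerivAt (fun r => ∫ s in Ioi r, gchi k s * h s * s) (-(gchi k r * h r * r)) r := by
  have hm1 : ContinuousOn (fun s => gpsi k s * h s * s) (Ioi 0) :=
    ((gpsi_contOn hk).mul hc).mul continuousOn_id
  have hm2 : ContinuousOn (fun s => gchi k s * h s * s) (Ioi 0) :=
    ((gchi_contOn hk).mul hc).mul continuousOn_id
  have hn : Ioi (0:ℝ) ∈ 𝓝 r := Ioi_mem_nhds hr
  constructor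
  · exact intervalIntegral.integral_hasDerivAt_right (gint_psi hk hh hr.le)
      (hm1.stronglyMeasurableAtFilter isOpen_Ioi r hr) (hm1.continuousAt hn)
  · have := intervalIntegral.integral_hasDerivAt_right (gint_chi_int hk hh hr.le)
      (hm2.stronglyMeasurableAtFilter isOpen_Ioi r hr) (hm2.continuousAt hn)
    refine HasDerivAt.congr_of_eventuallyEq
      (this.const_sub (∫ s in Ioi (0:ℝ), gchi k s * h s * s)) ?_
    filter_upwards [hn] with t ht
    exact gtail_eq hk hh (le_of_lt ht)

lemma gGreen_deriv {k : ℝ} (hk : 0 < k) {h : ℝ → ℝ} {C : ℝ} (hh : GAdm h C)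
    (hc : ContinuousOn h (Ioi 0)) {r : ℝ} (hr : 0 < r) :
    HasDerivAt (gGreen k h) (gGreen1 k h r) r := by
  obtain ⟨d1, d2⟩ := gGreen_prim hk hh hc hr
  refine (((gchi_deriv hk hr).mul d1).add ((gpsi_deriv hk hr).mul d2)).congr_deriv ?_
  unfold gGreen1
  ring

lemma gGreen_deriv2 {k : ℝ} (hk : 0 < k) {h : ℝ → ℝ} {C : ℝ} (hh : GAdm h C)
    (hc : ContinuousOn h (Ioi 0)) {r : ℝ} (hr : 0 < r) :
    HasDerivAt (gGreen1 k h)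
      (-(gGreen1 k h r) / r + gGreen k h r / r ^ 2 + gkap k r * gGreen k h r - h r) r := by
  obtain ⟨d1, d2⟩ := gGreen_prim hk hh hc hr
  refine (((((glm_deriv hk hr).neg).mul (gchi_deriv hk hr)).mul d1).add
    (((glp_deriv hk hr).mul (gpsi_deriv hk hr)).mul d2)).congr_deriv ?_
  have hw := gwronsk hk hr
  unfold gGreen1 gGreen
  simp only [Pi.mul_apply, Pi.neg_apply]
  generalize (∫ s in (0:ℝ)..r, gpsi k s * h s * s) = I1
  generalize (∫ s in Ioi r, gchi k s * h s * s) = I2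
  linear_combination (-h r) * hw

lemma gGreen1_le {k : ℝ} (hk : 0 < k) {h : ℝ → ℝ} {C : ℝ} (hh : GAdm h C) {r : ℝ} (hr : 0 < r) :
    |gGreen1 k h r| ≤ (1 + 2 * k) * (1 + 1 / r) * gGreen k h r := by
  have h1 : 0 ≤ ∫ s in (0:ℝ)..r, gpsi k s * h s * s := by
    rw [intervalIntegral.integral_of_le hr.le]
    refine setIntegral_nonneg measurableSet_Ioc fun s hs => ?_
    have := gpsi_pos hk hs.1
    have := hh.nonneg s hs.1
    have := hs.1
    positivity
  have h2 : 0 ≤ ∫ s in Ioi r, gchi k s * h s * s := by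
    refine setIntegral_nonneg measurableSet_Ioi fun s hs => ?_
    have hs0 : 0 < s := hr.trans hs
    have := gchi_pos hk hs0
    have := hh.nonneg s hs0
    positivity
  have p1 := gpsi_pos hk hr
  have p2 := gchi_pos hk hr
  unfold gGreen gGreen1
  generalize (∫ s in (0:ℝ)..r, gpsi k s * h s * s) = I1 at *
  generalize (∫ s in Ioi r, gchi k s * h s * s) = I2 at *
  have a1 : 0 ≤ gchi k r * I1 := by positivity
  have a2 : 0 ≤ gpsi k r * I2 := by positivity
  have b1 := mul_le_mul_of_nonneg_right (glm_le hk hr) a1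
  have b2 := mul_le_mul_of_nonneg_right (glp_le hk hr) a2
  have b3 := mul_nonneg (glm_nonneg hk hr) a1
  have b4 := mul_nonneg (glp_nonneg hk hr) a2
  rw [abs_le]
  constructor <;> nlinarith


def gbar (B l r : ℝ) : ℝ := B * r / (r + l)
def gbar1 (B l r : ℝ) : ℝ := B * l / (r + l) ^ 2
def gLbar (B l r : ℝ) : ℝ := B * (2 * l / (r + l) ^ 3 + 1 / (r + l) ^ 2)

lemma gbar_deriv {B l r : ℝ} (hl : 0 < l) (hr : 0 < r) :
    HasDerivAt (gbar B l) (gbar1 B l r) r := by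
  have h1 := (((hasDerivAt_id r).const_mul B).div ((hasDerivAt_id r).add_const l)
    (by simp; positivity))
  refine (h1 : HasDerivAt (gbar B l) _ r).congr_deriv ?_
  simp only [gbar1, id]
  field_simp
  ring

lemma gbar1_deriv {B l r : ℝ} (hl : 0 < l) (hr : 0 < r) :
    HasDerivAt (gbar1 B l) (-(gbar1 B l r) / r + gbar B l r / r ^ 2 - gLbar B l r) r := by
  have h1 := ((hasDerivAt_const r (B * l)).div (((hasDerivAt_id r).add_const l).pow 2)
    (by simp; positivity))
  refine (h1 : HasDerivAt (gbar1 B l) _ r).congr_deriv ?_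
  simp only [gbar1, gbar, gLbar, id, Pi.pow_apply]
  have : r + l ≠ 0 := by positivity
  field_simp
  ring

lemma gbar_le {B l r : ℝ} (hB : 0 ≤ B) (hl : 0 < l) (hr : 0 ≤ r) : gbar B l r ≤ B := by
  unfold gbar
  rw [div_le_iff₀ (by positivity)]
  nlinarith [mul_nonneg hB hl.le]

lemma gbar_le' {B l r : ℝ} (hB : 0 ≤ B) (hl : 0 < l) (hr : 0 ≤ r) : gbar B l r ≤ B / l * r := by
  unfold gbar
  rw [div_le_iff₀ (by positivity)]
  have : B / l * r * (r + l) = B * r + B * r ^ 2 / l := by field_simp; ring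
  rw [this]
  have : 0 ≤ B * r ^ 2 / l := by positivity
  linarith

lemma gbar_nonneg {B l r : ℝ} (hB : 0 ≤ B) (hl : 0 < l) (hr : 0 ≤ r) : 0 ≤ gbar B l r := by
  unfold gbar; positivity

lemma gLbar_nonneg {B l r : ℝ} (hB : 0 ≤ B) (hl : 0 < l) (hr : 0 ≤ r) : 0 ≤ gLbar B l r := by
  unfold gLbar; positivity

lemma gLbar_le {B l r : ℝ} (hB : 0 ≤ B) (hl : 0 < l) (hr : 0 ≤ r) :
    gLbar B l r ≤ B * (2 * l / l ^ 3 + 1 / l ^ 2) := by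
  unfold gLbar; gcongr <;> linarith

lemma gkap_pos {k r : ℝ} (hk : 0 < k) (hr : 0 < r) : 0 < gkap k r :=
  lt_of_lt_of_le (by positivity) (gkap_ge hk hr)

lemma gkap_contOn {k : ℝ} (hk : 0 < k) : ContinuousOn (gkap k) (Ioi 0) := by
  unfold gkap
  apply ContinuousOn.div (by fun_prop) (by fun_prop)
  intro r hr
  have hr : 0 < r := hr
  positivity

lemma ghbar_adm {B l k : ℝ} (hB : 0 ≤ B) (hl : 0 < l) (hk : 0 < k) :
    GAdm (fun s => gkap k s * gbar B l s + gLbar B l s)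
      (6 * k * (B / l) + 6 * k ^ 2 * B + B * (2 * l / l ^ 3 + 1 / l ^ 2)) := by
  refine ⟨?_, ?_, ?_⟩
  · refine ContinuousOn.aestronglyMeasurable ?_ measurableSet_Ioi
    refine ((gkap_contOn hk).mul fun r hr =>
      (gbar_deriv hl hr).continuousAt.continuousWithinAt).add ?_
    unfold gLbar
    apply ContinuousOn.mul (by fun_prop)
    have hne : ∀ r ∈ Ioi (0:ℝ), r + l ≠ 0 := fun r hr => by
      have hr : 0 < r := hr
      positivity
    apply ContinuousOn.add
    · exact ContinuousOn.div (by fun_prop) (by fun_prop) fun r hr => pow_ne_zero _ (hne r hr)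
    · exact ContinuousOn.div (by fun_prop) (by fun_prop) fun r hr => pow_ne_zero _ (hne r hr)
  · intro s hs
    have := gkap_pos hk hs
    have := gbar_nonneg hB hl hs.le
    have := gLbar_nonneg hB hl hs.le
    positivity
  · intro s hs
    have h1 := gLbar_le hB hl hs.le
    have h2 : gkap k s * gbar B l s ≤ (6 * k / s + 6 * k ^ 2) * gbar B l s := by
      have := gkap_le hk hs
      have := gbar_nonneg hB hl hs.le
      gcongr
    have h3 : 6 * k / s * gbar B l s ≤ 6 * k * (B / l) := by
      have := gbar_le' hB hl hs.le
      calc 6 * k / s * gbar B l s ≤ 6 * k / s * (B / l * s) := by gcongr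
        _ = _ := by field_simp
    have h4 : 6 * k ^ 2 * gbar B l s ≤ 6 * k ^ 2 * B := by
      have := gbar_le hB hl hs.le
      gcongr
    nlinarith

lemma gGreen_bar {B l k : ℝ} (hB : 0 ≤ B) (hl : 0 < l) (hk : 0 < k) {r : ℝ} (hr : 0 < r) :
    gGreen k (fun s => gkap k s * gbar B l s + gLbar B l s) r = gbar B l r := by
  have hadm := ghbar_adm hB hl hk
  -- first integral
  have e1 : (∫ s in (0:ℝ)..r, gpsi k s * (gkap k s * gbar B l s + gLbar B l s) * s)
      = gpsi k r * r * (glp k r * gbar B l r - gbar1 B l r) := by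
    have hF := intervalIntegral.integral_eq_sub_of_hasDerivAt_of_le hr.le
      (f := fun s => gpsi k s * ((1 + k * s - k * s / (2 * (1 + k * s))) * gbar B l s
        - s * gbar1 B l s))
      (f' := fun s => gpsi k s * (gkap k s * gbar B l s + gLbar B l s) * s) ?_ ?_
      (gint_psi hk hadm hr.le)
    · rw [hF]
      have z : gpsi k 0 = 0 := by simp [gpsi]
      rw [z]
      simp only [glp]
      field_simp
      ring
    · have hne : ∀ s ∈ Icc (0:ℝ) r, s + l ≠ 0 := fun s hs => by
        have := hs.1
        positivity
      have hne2 : ∀ s ∈ Icc (0:ℝ) r, (2 * (1 + k * s)) ≠ 0 := fun s hs => by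
        have := hs.1
        positivity
      refine ContinuousOn.mul ?_ (ContinuousOn.sub (ContinuousOn.mul ?_ ?_) ?_)
      · unfold gpsi
        refine ContinuousOn.div (by fun_prop) (by fun_prop) fun s hs => ?_
        have := hs.1
        positivity
      · refine ContinuousOn.sub (by fun_prop) (ContinuousOn.div (by fun_prop) (by fun_prop) hne2)
      · unfold gbar
        exact ContinuousOn.div (by fun_prop) (by fun_prop) hne
      · unfold gbar1
        exact ContinuousOn.mul (by fun_prop) (ContinuousOn.div (by fun_prop) (by fun_prop)
          fun s hs => pow_ne_zero _ (hne s hs))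
    · intro s hs
      have hs : 0 < s := hs.1
      have hd := ((gpsi_deriv hk hs).mul (hasDerivAt_id s)).mul
        (((glp_deriv hk hs).mul (gbar_deriv (B := B) hl hs)).sub (gbar1_deriv (B := B) hl hs))
      refine HasDerivAt.congr_of_eventuallyEq (hd.congr_deriv ?_) ?_
      · simp only [Pi.mul_apply, Pi.sub_apply, id]
        field_simp
        ring
      · filter_upwards [Ioi_mem_nhds hs] with t ht
        have ht : 0 < t := ht
        simp only [Pi.mul_apply, Pi.sub_apply, id, glp]
        field_simp
  have e2 : (∫ s in Ioi r, gchi k s * (gkap k s * gbar B l s + gLbar B l s) * s)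
      = gchi k r * r * (glm k r * gbar B l r + gbar1 B l r) := by
    have hF := integral_Ioi_of_hasDerivAt_of_tendsto (a := r) (m := 0)
      (f := fun s => -(gchi k s * s * (glm k s * gbar B l s + gbar1 B l s)))
      (f' := fun s => gchi k s * (gkap k s * gbar B l s + gLbar B l s) * s) ?_ ?_
      (gint_chi hk hadm hr.le) ?_
    · rw [hF]
      ring
    · exact ((((gchi_deriv hk hr).continuousAt.mul continuousAt_id).mul
        (((glm_deriv hk hr).continuousAt.mul (gbar_deriv hl hr).continuousAt).add
        (gbar1_deriv hl hr).continuousAt)).neg).continuousWithinAt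
    · intro s hs
      have hs : 0 < s := hr.trans hs
      have hd := (((gchi_deriv hk hs).mul (hasDerivAt_id s)).mul
        (((glm_deriv hk hs).mul (gbar_deriv (B := B) hl hs)).add
          (gbar1_deriv (B := B) hl hs))).neg
      refine hd.congr_deriv ?_
      simp only [Pi.mul_apply, Pi.add_apply, id]
      field_simp
      ring
    · have hlim : Tendsto (fun s : ℝ => ((1 + 2 * k) * 2 * B + B * l / l ^ 2)
          * Real.exp (-(k * s))) atTop (𝓝 0) := by
        rw [show (0:ℝ) = ((1 + 2 * k) * 2 * B + B * l / l ^ 2) * 0 by simp]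
        refine Tendsto.const_mul _ ?_
        exact Real.tendsto_exp_neg_atTop_nhds_zero.comp (tendsto_id.const_mul_atTop hk)
      refine squeeze_zero_norm' ?_ hlim
      filter_upwards [eventually_ge_atTop 1] with s hs
      have hs0 : 0 < s := by linarith
      have a1 := gchi_pos hk hs0
      have a2 := gchi_le hk hs0
      have a3 := glm_nonneg hk hs0
      have a4 : glm k s ≤ (1 + 2 * k) * 2 := by
        refine (glm_le hk hs0).trans ?_
        have : 1 / s ≤ 1 := by rw [div_le_one hs0]; exact hs
        gcongr
        linarith
      have a5 := gbar_nonneg hB hl hs0.le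
      have a6 := gbar_le hB hl hs0.le
      have a7 : 0 ≤ gbar1 B l s := by unfold gbar1; positivity
      have a8 : gbar1 B l s ≤ B * l / l ^ 2 := by
        unfold gbar1
        gcongr
        linarith
      rw [norm_neg, Real.norm_of_nonneg (by positivity), mul_comm]
      gcongr
  unfold gGreen
  rw [e1, e2]
  linear_combination gbar B l r * gwronsk hk hr

theorem ode_exists (m g : ℝ → ℝ) (G C Cg : ℝ) (hG : 0 < G)
    (hm : ContinuousOn m (Ioi 0)) (hg : ContinuousOn g (Ioi 0))
    (hmC : ∀ r, 0 < r → |m r| ≤ C) (hg0 : ∀ r, 0 < r → 0 ≤ g r) (hgC : ∀ r, 0 < r → g r ≤ Cg) :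
    ∃ (V V1 : ℝ → ℝ) (B K : ℝ), ∀ r, 0 < r →
      0 ≤ V r ∧ V r ≤ B ∧ V r ≤ B * r ∧ |V1 r| ≤ K * (1 + 1 / r) * V r ∧
      HasDerivAt V (V1 r) r ∧
      HasDerivAt V1 (-(V1 r) / r + V r / r ^ 2 + (G * V r ^ 3 - m r * V r - g r)) r := by
  have hC : 0 ≤ C := (abs_nonneg _).trans (hmC 1 one_pos)
  have hCg : 0 ≤ Cg := (hg0 1 one_pos).trans (hgC 1 one_pos)
  obtain ⟨t, ht⟩ : ∃ t, t = 1 + (C + Cg) / G := ⟨_, rfl⟩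
  have ht1 : 1 ≤ t := by rw [ht]; have : 0 ≤ (C + Cg) / G := by positivity
                         linarith
  have htG : C + Cg ≤ G * t := by
    rw [ht, mul_add, mul_div_cancel₀ _ hG.ne']; linarith
  obtain ⟨B, hBt⟩ : ∃ B, B = 2 * t := ⟨_, rfl⟩
  have hB : 0 ≤ B := by linarith
  obtain ⟨l, hl'⟩ : ∃ l, l = 1 / (2 * (1 + C + Cg)) := ⟨_, rfl⟩
  have hl : 0 < l := by rw [hl']; positivity
  obtain ⟨k, hk'⟩ : ∃ k, k = 1 + C + 3 * G * B ^ 2 := ⟨_, rfl⟩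
  have hk1 : 1 ≤ k := by rw [hk']; have : 0 ≤ 3 * G * B ^ 2 := by positivity
                         linarith
  have hk : 0 < k := by linarith
  -- supersolution property
  have hsuper : ∀ r, 0 < r → m r * gbar B l r - G * gbar B l r ^ 3 + g r ≤ gLbar B l r := by
    intro r hr
    have y0 := gbar_nonneg hB hl hr.le
    have yB := gbar_le hB hl hr.le
    have hL0 := gLbar_nonneg hB hl hr.le
    have hmr := (abs_le.1 (hmC r hr)).2
    have hgr := hgC r hr
    have hmy : m r * gbar B l r ≤ C * gbar B l r := by gcongr
    rcases le_total l r with h | h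
    · have hy : t ≤ gbar B l r := by
        unfold gbar
        rw [le_div_iff₀ (by positivity), hBt]
        nlinarith
      have h1 : (C + Cg) ≤ G * gbar B l r ^ 2 := by
        have : t ≤ gbar B l r ^ 2 := by nlinarith
        calc C + Cg ≤ G * t := htG
          _ ≤ _ := by gcongr
      have h2 : (C + Cg) * gbar B l r ≤ G * gbar B l r ^ 2 * gbar B l r := by gcongr
      have h3 : Cg ≤ Cg * gbar B l r := le_mul_of_one_le_right hCg (by linarith)
      nlinarith
    · have h1 : B * (1 / (4 * l ^ 2)) ≤ gLbar B l r := by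
        unfold gLbar
        have a1 : 0 ≤ 2 * l / (r + l) ^ 3 := by positivity
        have a2 : 1 / (4 * l ^ 2) ≤ 1 / (r + l) ^ 2 := by
          apply one_div_le_one_div_of_le (by positivity)
          nlinarith
        gcongr
        linarith
      have h2 : 1 / (4 * l ^ 2) = (1 + C + Cg) ^ 2 := by
        rw [hl']; field_simp; norm_num
      rw [h2] at h1
      have h3 : B * (C + Cg) ≤ B * (1 + C + Cg) ^ 2 := by
        gcongr
        nlinarith
      have h4 : C * gbar B l r ≤ C * B := by gcongr
      have h5 : Cg ≤ B * Cg := le_mul_of_one_le_left hCg (by linarith)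
      have h6 : 0 ≤ G * gbar B l r ^ 3 := by positivity
      nlinarith
  -- the nonlinearity
  let H : ℝ → ℝ → ℝ := fun r v => (gkap k r + m r) * v - G * v ^ 3 + g r
  have Hmono : ∀ r, 0 < r → ∀ v w, 0 ≤ v → v ≤ w → w ≤ B → H r v ≤ H r w := by
    intro r hr v w hv hvw hwB
    have h1 := gkap_ge hk hr
    have h2 := (abs_le.1 (hmC r hr)).1
    have h3 : w ^ 2 + w * v + v ^ 2 ≤ 3 * B ^ 2 := by nlinarith
    have h4 : G * (w ^ 2 + w * v + v ^ 2) ≤ G * (3 * B ^ 2) := by gcongr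
    have h5 : k ≤ k ^ 2 := by nlinarith
    have h6 : 0 ≤ (w - v) * (gkap k r + m r - G * (w ^ 2 + w * v + v ^ 2)) := by
      apply mul_nonneg (by linarith)
      nlinarith
    simp only [H]
    nlinarith
  have Hbar : ∀ r, 0 < r → H r (gbar B l r) ≤ gkap k r * gbar B l r + gLbar B l r := by
    intro r hr
    have := hsuper r hr
    simp only [H]
    nlinarith
  have hbar := ghbar_adm hB hl hk
  obtain ⟨Cb, hCb⟩ : ∃ Cb, Cb = 6 * k * (B / l) + 6 * k ^ 2 * B + B * (2 * l / l ^ 3 + 1 / l ^ 2) :=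
    ⟨_, rfl⟩
  rw [← hCb] at hbar
  have Hadm : ∀ v : ℝ → ℝ, AEStronglyMeasurable v (volume.restrict (Ioi 0)) →
      (∀ r, 0 < r → 0 ≤ v r ∧ v r ≤ gbar B l r) → GAdm (fun r => H r (v r)) Cb := by
    intro v hv hvb
    refine ⟨?_, ?_, ?_⟩
    · exact ((((gkap_contOn hk).add hm).aestronglyMeasurable measurableSet_Ioi).mul hv).sub
        (AEStronglyMeasurable.const_mul (hv.pow 3) G) |>.add (hg.aestronglyMeasurable measurableSet_Ioi)
    · intro r hr
      have := Hmono r hr 0 (v r) le_rfl (hvb r hr).1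
        ((hvb r hr).2.trans (gbar_le hB hl hr.le))
      have h0 : H r 0 = g r := by simp [H]
      exact (hg0 r hr).trans (h0 ▸ this)
    · intro r hr
      exact ((Hmono r hr _ _ (hvb r hr).1 (hvb r hr).2 (gbar_le hB hl hr.le)).trans
        (Hbar r hr)).trans (hbar.le r hr)
  let W : ℕ → ℝ → ℝ := fun n => Nat.rec (fun _ => 0) (fun _ v => gGreen k (fun r => H r (v r))) n
  have W0 : ∀ r, W 0 r = 0 := fun r => rfl
  have WS : ∀ n, W (n + 1) = gGreen k (fun r => H r (W n r)) := fun n => rfl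
  have Winv : ∀ n, ContinuousOn (W n) (Ioi 0) ∧ ∀ r, 0 < r → 0 ≤ W n r ∧ W n r ≤ gbar B l r := by
    intro n
    induction n with
    | zero =>
      refine ⟨continuousOn_const, fun r hr => ⟨le_rfl, gbar_nonneg hB hl hr.le⟩⟩
    | succ n ih =>
      have ha := Hadm (W n) (ih.1.aestronglyMeasurable measurableSet_Ioi) ih.2
      rw [WS]
      refine ⟨gGreen_cont hk ha, fun r hr => ⟨gGreen_nonneg hk ha hr, ?_⟩⟩
      rw [← gGreen_bar hB hl hk hr]
      refine gGreen_mono hk ha hbar (fun s hs => ?_) hr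
      exact (Hmono s hs _ _ (ih.2 s hs).1 (ih.2 s hs).2 (gbar_le hB hl hs.le)).trans (Hbar s hs)
  have Wadm : ∀ n, GAdm (fun r => H r (W n r)) Cb := fun n =>
    Hadm (W n) ((Winv n).1.aestronglyMeasurable measurableSet_Ioi) (Winv n).2
  have Wmono1 : ∀ n, ∀ r, 0 < r → W n r ≤ W (n + 1) r := by
    intro n
    induction n with
    | zero => exact fun r hr => ((Winv 1).2 r hr).1
    | succ n ih =>
      intro r hr
      rw [WS n, WS (n + 1)]
      refine gGreen_mono hk (Wadm n) (Wadm (n + 1)) (fun s hs => ?_) hr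
      exact Hmono s hs _ _ ((Winv n).2 s hs).1 (ih s hs)
        (((Winv (n + 1)).2 s hs).2.trans (gbar_le hB hl hs.le))
  have Wlim : ∀ r, 0 < r → Tendsto (fun n => W n r) atTop (𝓝 (⨆ n, W n r)) := by
    intro r hr
    refine tendsto_atTop_ciSup (monotone_nat_of_le_succ fun n => Wmono1 n r hr) ?_
    exact ⟨gbar B l r, by rintro _ ⟨n, rfl⟩; exact ((Winv n).2 r hr).2⟩
  obtain ⟨V, hV⟩ : ∃ V : ℝ → ℝ, V = fun r => ⨆ n, W n r := ⟨_, rfl⟩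
  have Wlim' : ∀ r, 0 < r → Tendsto (fun n => W n r) atTop (𝓝 (V r)) := by rw [hV]; exact Wlim
  have Vb : ∀ r, 0 < r → 0 ≤ V r ∧ V r ≤ gbar B l r := fun r hr =>
    ⟨ge_of_tendsto' (Wlim' r hr) fun n => ((Winv n).2 r hr).1,
      le_of_tendsto' (Wlim' r hr) fun n => ((Winv n).2 r hr).2⟩
  have Vmeas : AEStronglyMeasurable V (volume.restrict (Ioi 0)) :=
    aestronglyMeasurable_of_tendsto_ae atTop
      (fun n => (Winv n).1.aestronglyMeasurable measurableSet_Ioi)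
      ((ae_restrict_mem measurableSet_Ioi).mono fun r hr => Wlim' r hr)
  have Vadm := Hadm V Vmeas Vb
  have Veq : ∀ r, 0 < r → V r = gGreen k (fun r => H r (V r)) r := by
    intro r hr
    refine tendsto_nhds_unique ((tendsto_add_atTop_iff_nat 1).2 (Wlim' r hr)) ?_
    simp only [WS]
    refine gGreen_tendsto hk Wadm (fun s hs => ?_) hr
    simp only [H]
    exact (((Wlim' s hs).const_mul _).sub (((Wlim' s hs).pow 3).const_mul _)).add_const _
  have Vcont : ContinuousOn V (Ioi 0) := (gGreen_cont hk Vadm).congr fun r hr => Veq r hr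
  have hHc : ContinuousOn (fun r => H r (V r)) (Ioi 0) :=
    ((((gkap_contOn hk).add hm).mul Vcont).sub ((Vcont.pow 3).const_smul G)).add hg
  refine ⟨V, gGreen1 k (fun r => H r (V r)), max B (B / l), 1 + 2 * k, fun r hr => ?_⟩
  have hbl : gbar B l r ≤ max B (B / l) * r :=
    (gbar_le' hB hl hr.le).trans (by gcongr; exact le_max_right _ _)
  refine ⟨(Vb r hr).1, ((Vb r hr).2.trans (gbar_le hB hl hr.le)).trans (le_max_left _ _),
    (Vb r hr).2.trans hbl, ?_, ?_, ?_⟩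
  · rw [Veq r hr]
    exact gGreen1_le hk Vadm hr
  · refine (gGreen_deriv hk Vadm hHc hr).congr_of_eventuallyEq ?_
    filter_upwards [Ioi_mem_nhds hr] with s hs using Veq s hs
  · refine (gGreen_deriv2 hk Vadm hHc hr).congr_deriv ?_
    rw [← Veq r hr]
    simp only [H]
    ring


structure ODESol (m g V V1 : ℝ → ℝ) (G B K : ℝ) : Prop where
  nonneg : ∀ r, 0 < r → 0 ≤ V r
  leB : ∀ r, 0 < r → V r ≤ B
  leBr : ∀ r, 0 < r → V r ≤ B * r
  d_le : ∀ r, 0 < r → |V1 r| ≤ K * (1 + 1 / r) * V r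
  der : ∀ r, 0 < r → HasDerivAt V (V1 r) r
  der2 : ∀ r, 0 < r →
    HasDerivAt V1 (-(V1 r) / r + V r / r ^ 2 + (G * V r ^ 3 - m r * V r - g r)) r

lemma second_deriv_nonpos {f f1 : ℝ → ℝ} {x c : ℝ} (hmax : IsLocalMax f x)
    (h1 : ∀ᶠ y in 𝓝 x, HasDerivAt f (f1 y) y) (h2 : HasDerivAt f1 c x) : c ≤ 0 := by
  by_contra hc
  push Not at hc
  have e1 : deriv f =ᶠ[𝓝 x] f1 := h1.mono fun y hy => hy.deriv
  have e2 : deriv (deriv f) x = c := by rw [e1.deriv_eq]; exact h2.deriv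
  have e3 : deriv f x = 0 := hmax.deriv_eq_zero
  have hmin : IsLocalMin f x := isLocalMin_of_deriv_deriv_pos (by rw [e2]; exact hc) e3
    h1.self_of_nhds.continuousAt
  have e4 : f =ᶠ[𝓝 x] fun _ => f x := by
    filter_upwards [hmax, hmin] with y h1 h2 using le_antisymm h1 h2
  have e5 : deriv f =ᶠ[𝓝 x] deriv (fun _ => f x) := e4.deriv
  have e6 : deriv (deriv f) x = 0 := by
    rw [e5.deriv_eq]; simp
  linarith

lemma ode_lower {m g V V1 : ℝ → ℝ} {G B K C : ℝ} (S : ODESol m g V V1 G B K) (hG : 0 < G)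
    (hmC : ∀ r, 0 < r → |m r| ≤ C) {α β lam : ℝ} (hα : 0 < α) (hαβ : α < β)
    (hφ : ∀ r ∈ Icc α β, 2 * lam - lam * (α + β - 2 * r) / r + lam * ((r - α) * (β - r)) / r ^ 2
      + C * (lam * ((r - α) * (β - r))) + G * (lam * ((r - α) * (β - r))) ^ 3 < g r) :
    ∀ r ∈ Icc α β, lam * ((r - α) * (β - r)) ≤ V r := by
  have hpos : ∀ r ∈ Icc α β, 0 < r := fun r hr => lt_of_lt_of_le hα hr.1
  have hD : ∀ r, 0 < r → HasDerivAt (fun r => lam * ((r - α) * (β - r)) - V r)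
      (lam * (α + β - 2 * r) - V1 r) r := by
    intro r hr
    have := ((((hasDerivAt_id r).sub_const α).mul ((hasDerivAt_id r).const_sub β)).const_mul
      lam).sub (S.der r hr)
    refine this.congr_deriv ?_
    simp only [id]
    ring
  obtain ⟨x, hx, hxmax⟩ := isCompact_Icc.exists_isMaxOn (nonempty_Icc.2 hαβ.le)
    (f := fun r => lam * ((r - α) * (β - r)) - V r)
    (fun r hr => (hD r (hpos r hr)).continuousAt.continuousWithinAt)
  have key : lam * ((x - α) * (β - x)) - V x ≤ 0 := by
    by_contra hc
    push Not at hc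
    have hx0 := hpos x hx
    have hV0 := S.nonneg x hx0
    have hxα : x ≠ α := by rintro rfl; simp at hc; linarith
    have hxβ : x ≠ β := by rintro rfl; simp at hc; linarith
    have hx' : x ∈ Ioo α β := ⟨lt_of_le_of_ne hx.1 hxα.symm, lt_of_le_of_ne hx.2 hxβ⟩
    have hloc : IsLocalMax (fun r => lam * ((r - α) * (β - r)) - V r) x :=
      hxmax.isLocalMax (Icc_mem_nhds hx'.1 hx'.2)
    have hd0 : lam * (α + β - 2 * x) - V1 x = 0 := hloc.hasDerivAt_eq_zero (hD x hx0)
    have hd2 : HasDerivAt (fun r => lam * (α + β - 2 * r) - V1 r)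
        (-2 * lam - (-(V1 x) / x + V x / x ^ 2 + (G * V x ^ 3 - m x * V x - g x))) x := by
      have := (((hasDerivAt_id x).const_mul 2).const_sub (α + β)).const_mul lam |>.sub
        (S.der2 x hx0)
      refine this.congr_deriv ?_
      ring
    have hle := second_deriv_nonpos hloc
      ((Ioi_mem_nhds hx0 : Ioi 0 ∈ 𝓝 x) |> fun h => Filter.mem_of_superset h fun y hy => hD y hy) hd2
    have hφx := hφ x hx
    set φ := lam * ((x - α) * (β - x)) with hφd
    have hm := (abs_le.1 (hmC x hx0)).1
    have h1 : -(m x) * V x ≤ C * φ := by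
      have hC : 0 ≤ C := (abs_nonneg _).trans (hmC 1 one_pos)
      nlinarith
    have h2 : G * V x ^ 3 ≤ G * φ ^ 3 := by gcongr; linarith
    have h3 : V x / x ^ 2 ≤ φ / x ^ 2 := by gcongr; linarith
    have h4 : V1 x = lam * (α + β - 2 * x) := by linarith
    rw [h4, neg_div] at hle
    linarith
  intro r hr
  have : lam * ((r - α) * (β - r)) - V r ≤ lam * ((x - α) * (β - x)) - V x := hxmax hr
  linarith

lemma ode_integrable {m g V V1 : ℝ → ℝ} {G B K c R0 : ℝ} (S : ODESol m g V V1 G B K) (hG : 0 < G)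
    (hm : ContinuousOn m (Ioi 0)) (hg : ContinuousOn g (Ioi 0))
    (hg0 : ∀ r, 0 < r → 0 ≤ g r) (hR0 : 0 < R0) (hc : 0 < c) (hmc : ∀ r, R0 ≤ r → m r ≤ -c)
    (hgi : IntegrableOn (fun r => r * g r) (Ioi 0)) :
    IntegrableOn (fun r => r * V r) (Ioi 0) := by
  have Vc : ContinuousOn V (Ioi 0) := fun r hr => (S.der r hr).continuousAt.continuousWithinAt
  have hsub : ∀ {a b : ℝ}, 0 < a → Icc a b ⊆ Ioi 0 := fun ha r hr => lt_of_lt_of_le ha hr.1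
  have hP : ∀ r, 0 < r → HasDerivAt (fun r => r * V1 r)
      (V r / r + r * (G * V r ^ 3 - m r * V r - g r)) r := by
    intro r hr
    refine ((hasDerivAt_id r).mul (S.der2 r hr)).congr_deriv ?_
    simp only [id]
    field_simp
    ring
  have hseq : ∀ n : ℕ, ∃ R, R0 ≤ R ∧ (n : ℝ) ≤ R ∧ R * V1 R ≤ 1 := by
    intro n
    by_contra hcon
    push Not at hcon
    set T := max R0 n
    have hT : 0 < T := lt_of_lt_of_le hR0 (le_max_left _ _)
    have hmono : MonotoneOn (fun r => V r - Real.log r) (Ici T) := by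
      refine monotoneOn_of_hasDerivWithinAt_nonneg (convex_Ici T)
        (f' := fun r => V1 r - r⁻¹) ?_ ?_ ?_
      · intro r hr
        have hr : 0 < r := lt_of_lt_of_le hT hr
        exact ((S.der r hr).continuousAt.sub
          (Real.hasDerivAt_log hr.ne').continuousAt).continuousWithinAt
      · intro r hr
        rw [interior_Ici] at hr
        have hr : 0 < r := hT.trans hr
        exact ((S.der r hr).sub (Real.hasDerivAt_log hr.ne')).hasDerivWithinAt
      · intro r hr
        rw [interior_Ici] at hr
        have hr0 : 0 < r := hT.trans hr
        have := hcon r ((le_max_left _ _).trans (le_of_lt hr)) ((le_max_right _ _).trans (le_of_lt hr))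
        rw [sub_nonneg, inv_le_iff_one_le_mul₀' hr0]
        exact this.le
    have hB0 : 0 ≤ B := (S.nonneg T hT).trans (S.leB T hT)
    have hle : T ≤ T * Real.exp (B + 1) :=
      le_mul_of_one_le_right hT.le (Real.one_le_exp (by linarith))
    have h1 := hmono (Set.mem_Ici.2 le_rfl) (Set.mem_Ici.2 hle) hle
    beta_reduce at h1
    rw [Real.log_mul hT.ne' (Real.exp_pos _).ne', Real.log_exp] at h1
    have h2 := S.leB (T * Real.exp (B + 1)) (by positivity)
    have h3 := S.nonneg T hT
    linarith
  choose b hb1 hb2 hb3 using hseq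
  have hbt : Tendsto b atTop atTop := tendsto_atTop_mono hb2 tendsto_natCast_atTop_atTop
  have hcV : ContinuousOn (fun r => r * V r) (Ioi 0) := continuousOn_id.mul Vc
  have hcP : ContinuousOn (fun r => V r / r + r * (G * V r ^ 3 - m r * V r - g r)) (Ioi 0) := by
    refine (Vc.div continuousOn_id fun r hr => ne_of_gt hr).add (continuousOn_id.mul ?_)
    exact (((Vc.pow 3).const_smul G).sub (hm.mul Vc)).sub hg
  have hcG : ContinuousOn (fun r => r * g r) (Ioi 0) := continuousOn_id.mul hg
  have hfar : IntegrableOn (fun r => r * V r) (Ioi R0) := by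
    refine integrableOn_Ioi_of_intervalIntegral_norm_bounded
      ((1 - R0 * V1 R0 + ∫ r in Ioi 0, r * g r) / c) R0 (b := b) (l := atTop) ?_ hbt ?_
    · intro n
      exact ((hcV.mono (hsub hR0)).integrableOn_Icc).mono_set Ioc_subset_Icc_self
    · refine Eventually.of_forall fun n => ?_
      have hle := hb1 n
      have hu : uIcc R0 (b n) ⊆ Ioi 0 := by rw [uIcc_of_le hle]; exact hsub hR0
      have iV : IntervalIntegrable (fun r => ‖r * V r‖) volume R0 (b n) :=
        (hcV.mono hu).norm.intervalIntegrable
      have iP := (hcP.mono hu).intervalIntegrable (μ := volume)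
      have iG := (hcG.mono hu).intervalIntegrable (μ := volume)
      have hF := intervalIntegral.integral_eq_sub_of_hasDerivAt (a := R0) (b := b n)
        (f := fun r => r * V1 r) (fun r hr => hP r (hu hr)) iP
      have hG1 : ∫ r in R0..b n, r * g r ≤ ∫ r in Ioi 0, r * g r := by
        rw [intervalIntegral.integral_of_le hle]
        refine setIntegral_mono_set hgi ?_ ?_
        · refine (ae_restrict_mem measurableSet_Ioi).mono fun r hr => ?_
          exact mul_nonneg (le_of_lt hr) (hg0 r hr)
        · exact (Ioc_subset_Ioi_self.trans (Ioi_subset_Ioi hR0.le)).eventuallyLE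
      have hmain : c * ∫ r in R0..b n, ‖r * V r‖ ≤
          (∫ r in R0..b n, (V r / r + r * (G * V r ^ 3 - m r * V r - g r)))
            + ∫ r in R0..b n, r * g r := by
        rw [← intervalIntegral.integral_const_mul, ← intervalIntegral.integral_add iP iG]
        refine intervalIntegral.integral_mono_on hle (iV.const_mul c) (iP.add iG) fun r hr => ?_
        have hr0 : 0 < r := hsub hR0 hr
        have v0 := S.nonneg r hr0
        rw [Real.norm_of_nonneg (by positivity)]
        have h1 : 0 ≤ V r / r := by positivity
        have h2 : 0 ≤ r * (G * V r ^ 3) := by positivity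
        have h3 : 0 ≤ (r * V r) * (-c - m r) :=
          mul_nonneg (by positivity) (by have := hmc r hr.1; linarith)
        nlinarith
      rw [hF] at hmain
      rw [le_div_iff₀ hc]
      have := hb3 n
      linarith
  have hnear : IntegrableOn (fun r => r * V r) (Ioc 0 R0) := by
    refine Integrable.mono' (g := fun _ => R0 * B) (integrableOn_const (by simp)) ?_ ?_
    · exact (hcV.mono Ioc_subset_Ioi_self).aestronglyMeasurable measurableSet_Ioc
    · refine (ae_restrict_mem measurableSet_Ioc).mono fun r hr => ?_
      have v0 := S.nonneg r hr.1
      have v1 := S.leB r hr.1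
      have := hr.1
      have := hr.2
      rw [Real.norm_of_nonneg (by positivity)]
      gcongr
  have := hnear.union hfar
  rwa [Ioc_union_Ioi_eq_Ioi hR0.le] at this

lemma nonneg_of_deriv0 {f f1 : ℝ → ℝ} {r : ℝ} (hr : 0 < r)
    (hd : ∀ s ∈ Ioc 0 r, HasDerivAt f (f1 s) s) (h0 : ∀ s ∈ Ioc 0 r, 0 ≤ f1 s)
    (hl : Tendsto f (𝓝[>] 0) (𝓝 0)) : 0 ≤ f r := by
  have hmono : MonotoneOn f (Ioc 0 r) := by
    refine monotoneOn_of_hasDerivWithinAt_nonneg (convex_Ioc 0 r) (f' := f1) ?_ ?_ ?_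
    · exact fun s hs => (hd s hs).continuousAt.continuousWithinAt
    · exact fun s hs => (hd s (interior_subset hs)).hasDerivWithinAt
    · exact fun s hs => h0 s (interior_subset hs)
  refine le_of_tendsto hl ?_
  filter_upwards [Ioc_mem_nhdsGT hr] with s hs
  exact hmono hs ⟨hr, le_rfl⟩ hs.2

lemma ode_zero {m g V V1 : ℝ → ℝ} {G B K C Cg1 : ℝ} (S : ODESol m g V V1 G B K) (hG : 0 < G)
    (hmC : ∀ r, 0 < r → |m r| ≤ C) (hg0 : ∀ r, 0 < r → 0 ≤ g r)
    (hg1 : ∀ r, 0 < r → r ≤ 1 → g r ≤ Cg1 * r) :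
    ∃ Cb q0, 0 ≤ Cb ∧ ∀ r, 0 < r → r ≤ 1 →
      |r * V1 r - V r| ≤ Cb * r ^ 3 ∧ |V r / r - q0| ≤ Cb * r ^ 2 := by
  have hC : 0 ≤ C := (abs_nonneg _).trans (hmC 1 one_pos)
  have hB0 : 0 ≤ B := (S.nonneg 1 one_pos).trans (S.leB 1 one_pos)
  have hCg1 : 0 ≤ Cg1 := by
    have := (hg0 1 one_pos).trans (hg1 1 one_pos le_rfl)
    linarith
  set M := G * (B ^ 2 * B) + C * B + Cg1 with hM
  have hM0 : 0 ≤ M := by positivity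
  have hrhs : ∀ r, 0 < r → r ≤ 1 → |G * V r ^ 3 - m r * V r - g r| ≤ M * r := by
    intro r hr hr1
    have v0 := S.nonneg r hr
    have v1 := S.leB r hr
    have v2 := S.leBr r hr
    have a1 : |G * V r ^ 3| ≤ G * (B ^ 2 * B) * r := by
      rw [abs_of_nonneg (by positivity)]
      have : V r ^ 3 ≤ B ^ 2 * (B * r) := by
        calc V r ^ 3 = V r ^ 2 * V r := by ring
          _ ≤ _ := by gcongr
      calc G * V r ^ 3 ≤ G * (B ^ 2 * (B * r)) := by gcongr
        _ = _ := by ring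
    have a2 : |m r * V r| ≤ C * B * r := by
      rw [abs_mul, abs_of_nonneg v0, mul_assoc]
      exact mul_le_mul (hmC r hr) v2 v0 hC
    have a3 : |g r| ≤ Cg1 * r := by rw [abs_of_nonneg (hg0 r hr)]; exact hg1 r hr hr1
    calc _ ≤ |G * V r ^ 3 - m r * V r| + |g r| := abs_sub _ _
      _ ≤ |G * V r ^ 3| + |m r * V r| + |g r| := by gcongr; exact abs_sub _ _
      _ ≤ _ := by rw [hM]; linarith
  have hZd : ∀ r, 0 < r → HasDerivAt (fun r => r * (r * V1 r - V r))
      (r ^ 2 * (G * V r ^ 3 - m r * V r - g r)) r := by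
    intro r hr
    refine ((hasDerivAt_id r).mul (((hasDerivAt_id r).mul (S.der2 r hr)).sub
      (S.der r hr))).congr_deriv ?_
    simp only [id, Pi.sub_apply, Pi.mul_apply]
    field_simp
    ring
  have hK : 0 ≤ K * (1 + 1) * V 1 := by
    have := (abs_nonneg _).trans (S.d_le 1 one_pos)
    simpa using this
  have hid : Tendsto (fun r : ℝ => r) (𝓝[>] 0) (𝓝 0) := tendsto_nhdsWithin_of_tendsto_nhds tendsto_id
  have hZ0 : Tendsto (fun r => r * (r * V1 r - V r)) (𝓝[>] 0) (𝓝 0) := by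
    have hb : Tendsto (fun r : ℝ => (2 * |K| * B + B) * r) (𝓝[>] 0) (𝓝 0) := by
      simpa using hid.const_mul (2 * |K| * B + B)
    refine squeeze_zero_norm' ?_ hb
    filter_upwards [Ioc_mem_nhdsGT one_pos] with r hr
    have hr0 := hr.1
    have hr1 := hr.2
    have v0 := S.nonneg r hr0
    have v1 := S.leB r hr0
    have a1 : |r * V1 r| ≤ 2 * |K| * B := by
      rw [abs_mul, abs_of_pos hr0]
      calc r * |V1 r| ≤ r * (K * (1 + 1 / r) * V r) := by gcongr; exact S.d_le r hr0
        _ = K * ((r + 1) * V r) := by field_simp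
        _ ≤ |K| * ((1 + 1) * B) := by
          gcongr
          exact le_abs_self K
        _ = _ := by ring
    rw [norm_mul, Real.norm_of_nonneg hr0.le, mul_comm]
    gcongr
    calc |r * V1 r - V r| ≤ |r * V1 r| + |V r| := abs_sub _ _
      _ ≤ _ := by rw [abs_of_nonneg v0]; linarith
  have hp4 : Tendsto (fun r : ℝ => M * r ^ 4) (𝓝[>] 0) (𝓝 0) := by
    simpa using (hid.pow 4).const_mul M
  have hZ : ∀ r, 0 < r → r ≤ 1 → |r * V1 r - V r| ≤ M * r ^ 3 := by
    intro r hr hr1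
    have h1 := nonneg_of_deriv0 (f := fun r => M * r ^ 4 - r * (r * V1 r - V r))
      (f1 := fun r => M * (4 * r ^ 3) - r ^ 2 * (G * V r ^ 3 - m r * V r - g r)) hr ?_ ?_ ?_
    have h2 := nonneg_of_deriv0 (f := fun r => M * r ^ 4 + r * (r * V1 r - V r))
      (f1 := fun r => M * (4 * r ^ 3) + r ^ 2 * (G * V r ^ 3 - m r * V r - g r)) hr ?_ ?_ ?_
    · rw [abs_le]
      constructor
      · by_contra hh
        push Not at hh
        have := mul_lt_mul_of_pos_left hh hr
        nlinarith
      · by_contra hh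
        push Not at hh
        have := mul_lt_mul_of_pos_left hh hr
        nlinarith
    · intro s hs
      have := ((hasDerivAt_pow 4 s).const_mul M).add (hZd s hs.1)
      refine this.congr_deriv (by norm_num)
    · intro s hs
      have hs0 := hs.1
      have h := (abs_le.1 (hrhs s hs.1 (hs.2.trans hr1))).1
      have := mul_le_mul_of_nonneg_left h (sq_nonneg s)
      have : 0 ≤ M * s ^ 3 := by positivity
      nlinarith
    · simpa using hp4.add hZ0
    · intro s hs
      have := ((hasDerivAt_pow 4 s).const_mul M).sub (hZd s hs.1)
      refine this.congr_deriv (by norm_num)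
    · intro s hs
      have hs0 := hs.1
      have h := (abs_le.1 (hrhs s hs.1 (hs.2.trans hr1))).2
      have := mul_le_mul_of_nonneg_left h (sq_nonneg s)
      have : 0 ≤ M * s ^ 3 := by positivity
      nlinarith
    · simpa using hp4.sub hZ0
  -- limit of V / r
  have hqd : ∀ r, 0 < r → HasDerivAt (fun r => V r / r) ((r * V1 r - V r) / r ^ 2) r := by
    intro r hr
    refine ((S.der r hr).div (hasDerivAt_id r) hr.ne').congr_deriv ?_
    simp only [id]
    ring
  have hqb : ∀ r, 0 < r → r ≤ 1 → |(r * V1 r - V r) / r ^ 2| ≤ M * r := by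
    intro r hr hr1
    rw [abs_div, abs_of_pos (by positivity : 0 < r ^ 2), div_le_iff₀ (by positivity)]
    have := hZ r hr hr1
    nlinarith
  have hpd : ∀ s : ℝ, HasDerivAt (fun r => M * r ^ 2) (M * (2 * s)) s := by
    intro s
    exact ((hasDerivAt_pow 2 s).const_mul M).congr_deriv (by norm_num)
  have hmono : MonotoneOn (fun r => V r / r + M * r ^ 2) (Ioo 0 1) := by
    refine monotoneOn_of_hasDerivWithinAt_nonneg (convex_Ioo 0 1)
      (f' := fun r => (r * V1 r - V r) / r ^ 2 + M * (2 * r)) ?_ ?_ ?_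
    · exact fun s hs => ((hqd s hs.1).add (hpd s)).continuousAt.continuousWithinAt
    · exact fun s hs => ((hqd s (interior_subset hs).1).add (hpd s)).hasDerivWithinAt
    · intro s hs
      have hs := interior_subset hs
      have := (abs_le.1 (hqb s hs.1 hs.2.le)).1
      have : 0 ≤ M * s := mul_nonneg hM0 hs.1.le
      linarith
  obtain ⟨q0, hq0⟩ : ∃ q0, Tendsto (fun r => V r / r + M * r ^ 2) (𝓝[>] 0) (𝓝 q0) := by
    refine ⟨_, MonotoneOn.tendsto_nhdsWithin_Ioo_right (by simp) hmono ⟨0, ?_⟩⟩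
    rintro _ ⟨r, hr, rfl⟩
    have := S.nonneg r hr.1
    have := hr.1
    simp only
    positivity
  have hp2 : Tendsto (fun r : ℝ => M * r ^ 2) (𝓝[>] 0) (𝓝 0) := by
    simpa using (hid.pow 2).const_mul M
  have hq : Tendsto (fun r => V r / r) (𝓝[>] 0) (𝓝 q0) := by
    simpa using hq0.sub hp2
  refine ⟨M, q0, hM0, fun r hr hr1 => ⟨hZ r hr hr1, ?_⟩⟩
  have h1 := nonneg_of_deriv0 (f := fun r => M * r ^ 2 - (V r / r - q0))
    (f1 := fun r => M * (2 * r) - (r * V1 r - V r) / r ^ 2) hr ?_ ?_ ?_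
  have h2 := nonneg_of_deriv0 (f := fun r => M * r ^ 2 + (V r / r - q0))
    (f1 := fun r => M * (2 * r) + (r * V1 r - V r) / r ^ 2) hr ?_ ?_ ?_
  · rw [abs_le]
    constructor <;> linarith
  · exact fun s hs => (hpd s).add ((hqd s hs.1).sub_const q0)
  · intro s hs
    have := (abs_le.1 (hqb s hs.1 (hs.2.trans hr1))).1
    have : 0 ≤ M * s := mul_nonneg hM0 hs.1.le
    linarith
  · simpa using hp2.add (hq.sub_const q0)
  · exact fun s hs => (hpd s).sub ((hqd s hs.1).sub_const q0)
  · intro s hs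
    have := (abs_le.1 (hqb s hs.1 (hs.2.trans hr1))).2
    have : 0 ≤ M * s := mul_nonneg hM0 hs.1.le
    linarith
  · simpa using hp2.sub (hq.sub_const q0)


lemma hasFDerivAt_nrm {x : E2} (hx : x ≠ 0) :
    HasFDerivAt (fun y : E2 => ‖y‖) (‖x‖⁻¹ • innerSL ℝ x) x := by
  have h := (hasStrictFDerivAt_norm_sq x).hasFDerivAt.sqrt (by simpa using hx)
  simp only [Real.sqrt_sq (norm_nonneg _)] at h
  refine h.congr_fderiv ?_
  ext y
  simp
  ring

lemma hasFDerivAt_radial {φ : ℝ → ℝ} {c : ℝ} {x : E2} (hx : x ≠ 0) (hφ : HasDerivAt φ c ‖x‖) :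
    HasFDerivAt (fun y : E2 => φ ‖y‖) ((c / ‖x‖) • innerSL ℝ x) x := by
  refine (hφ.comp_hasFDerivAt x (hasFDerivAt_nrm hx)).congr_fderiv ?_
  rw [smul_smul, div_eq_mul_inv]

lemma inner_integrable {F G : E2 → E2} (hF : MemLp F 2 (volume : Measure E2))
    (hG : MemLp G 2 (volume : Measure E2)) :
    Integrable (fun x => (inner ℝ (F x) (G x) : ℝ)) (volume : Measure E2) := by
  have h := hF.norm.integrable_mul hG.norm
  refine h.mono' (hF.1.inner hG.1) (Eventually.of_forall fun x => ?_)
  exact norm_inner_le_norm _ _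

lemma MemH1.dLp {w : E2 → E2} (hw : MemH1 w) (e : E2) :
    MemLp (fun x => fderiv ℝ w x e) 2 (volume : Measure E2) :=
  (ContinuousLinearMap.apply ℝ E2 e).comp_memLp' hw.2.2

lemma weak_form {v w : E2 → E2} (hv : MemH1 v) (hw : MemH1 w)
    (hd : ∀ i, Differentiable ℝ (fun x => fderiv ℝ v x (e2basis i)))
    (hdd : ∀ i, MemLp (fun x => fderiv ℝ (fun y => fderiv ℝ v y (e2basis i)) x (e2basis i)) 2
      (volume : Measure E2)) :
    Integrable (gradInner v w) ∧ Integrable (fun x => (inner ℝ (lap v x) (w x) : ℝ)) ∧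
    ∫ x, gradInner v w x = - ∫ x, (inner ℝ (lap v x) (w x) : ℝ) := by
  have i1 : ∀ i, Integrable (fun x => (inner ℝ (fderiv ℝ v x (e2basis i))
      (fderiv ℝ w x (e2basis i)) : ℝ)) (volume : Measure E2) := fun i =>
    inner_integrable (hv.dLp _) (hw.dLp _)
  have i2 : ∀ i, Integrable (fun x => (inner ℝ (fderiv ℝ (fun y => fderiv ℝ v y (e2basis i)) x
      (e2basis i)) (w x) : ℝ)) (volume : Measure E2) := fun i =>
    inner_integrable (hdd i) hw.2.1
  have i3 : ∀ i, Integrable (fun x => (inner ℝ (fderiv ℝ v x (e2basis i))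
      (w x) : ℝ)) (volume : Measure E2) := fun i =>
    inner_integrable (hv.dLp _) hw.2.1
  have hp : ∀ i, ∫ x, (inner ℝ (fderiv ℝ v x (e2basis i)) (fderiv ℝ w x (e2basis i)) : ℝ) =
      - ∫ x, (inner ℝ (fderiv ℝ (fun y => fderiv ℝ v y (e2basis i)) x (e2basis i)) (w x) : ℝ) := by
    intro i
    exact integral_bilinear_fderiv_right_eq_neg_left_of_integrable (B := innerSL ℝ)
      (f := fun x => fderiv ℝ v x (e2basis i)) (g := w) (v := e2basis i) (μ := volume)
      (i2 i) (i1 i) (i3 i) (fun x _ => hd i x) (fun x _ => hw.1 x)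
  refine ⟨integrable_finsetSum _ fun i _ => i1 i, ?_, ?_⟩
  · simp only [lap, sum_inner]
    exact integrable_finsetSum _ fun i _ => i2 i
  · simp only [lap, sum_inner, gradInner]
    rw [integral_finsetSum _ fun i _ => i1 i, integral_finsetSum _ fun i _ => i2 i,
      ← Finset.sum_neg_distrib]
    exact Finset.sum_congr rfl fun i _ => hp i

lemma memLp_two_of_le {F : Type*} [NormedAddCommGroup F] {h : E2 → F} {T : ℝ → ℝ} {M : ℝ}
    (hT : IntegrableOn (fun r => r * T r) (Ioi 0)) (hTM : ∀ r, 0 < r → T r ≤ M)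
    (hm : AEStronglyMeasurable h (volume : Measure E2)) (hh : ∀ x, x ≠ 0 → ‖h x‖ ≤ T ‖x‖) :
    MemLp h 2 (volume : Measure E2) := by
  have hi : Integrable (fun x : E2 => T ‖x‖) := by
    rw [integrable_fun_norm_addHaar]
    simpa using hT
  rw [memLp_two_iff_integrable_sq_norm hm]
  refine (hi.const_mul M).mono' (hm.norm.pow 2) ?_
  have : ∀ᵐ x : E2, x ≠ 0 := by simp [ae_iff]
  filter_upwards [this] with x hx
  have h1 := hh x hx
  have h2 := hTM ‖x‖ (norm_pos_iff.2 hx)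
  have h3 := norm_nonneg (h x)
  rw [Real.norm_of_nonneg (by positivity)]
  nlinarith


lemma hasFDerivAt_zero_of_sq {F : E2 → E2} {L : E2 →L[ℝ] E2} {C : ℝ}
    (h : ∀ y, ‖y‖ ≤ 1 → ‖F y - F 0 - L y‖ ≤ C * ‖y‖ ^ 2) : HasFDerivAt F L 0 := by
  have h1 : (fun y => F y - F 0 - L y) =O[𝓝 0] fun y => ‖y - 0‖ ^ 2 := by
    refine Asymptotics.IsBigO.of_bound C ?_
    filter_upwards [Metric.closedBall_mem_nhds (0 : E2) one_pos] with y hy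
    have := h y (by simpa using hy)
    simpa using this
  have h2 := (h1.hasFDerivAt one_lt_two).add (L.hasFDerivAt.add (hasFDerivAt_const (F 0) 0))
  have e : (fun y => F y - F 0 - L y + (L y + F 0)) = F := by ext1 y; abel
  have h3 : HasFDerivAt F (0 + (L + 0)) 0 := by
    rw [← e]; exact h2
  simpa using h3

structure Prof (q b b1 : ℝ → ℝ) (Cb : ℝ) : Prop where
  dq : ∀ r, 0 < r → HasDerivAt q (b r * r) r
  db : ∀ r, 0 < r → HasDerivAt b (b1 r) r
  bb : ∀ r, 0 < r → r ≤ 1 → |b r| ≤ Cb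
  bq : ∀ r, 0 < r → r ≤ 1 → |q r - q 0| ≤ Cb * r ^ 2

/-- the radial field -/
def fld (q : ℝ → ℝ) (x : E2) : E2 := q ‖x‖ • x

lemma fld_hasFDerivAt {q b b1 : ℝ → ℝ} {Cb : ℝ} (P : Prof q b b1 Cb) (x : E2) :
    HasFDerivAt (fld q) (q ‖x‖ • ContinuousLinearMap.id ℝ E2 +
      b ‖x‖ • (innerSL ℝ x).smulRight x) x := by
  by_cases hx : x = 0
  · subst hx
    refine hasFDerivAt_zero_of_sq (C := Cb) fun y hy => ?_
    by_cases hy0 : y = 0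
    · subst hy0; simp [fld]
    have hn := norm_pos_iff.2 hy0
    have e : fld q y - fld q 0 - (q ‖(0:E2)‖ • ContinuousLinearMap.id ℝ E2 +
        b ‖(0:E2)‖ • (innerSL ℝ (0:E2)).smulRight (0:E2)) y = (q ‖y‖ - q 0) • y := by
      simp [fld, sub_smul]
    rw [e, norm_smul, Real.norm_eq_abs]
    have h1 := P.bq _ hn hy
    have : 0 ≤ Cb * ‖y‖ ^ 2 := (abs_nonneg _).trans h1
    nlinarith [abs_nonneg (q ‖y‖ - q 0)]
  · have hn := norm_pos_iff.2 hx
    refine ((hasFDerivAt_radial hx (P.dq _ hn)).smul (hasFDerivAt_id x)).congr_fderiv ?_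
    ext1 y
    simp
    rw [mul_div_cancel_right₀ _ hn.ne', smul_smul]

lemma fld_fderiv {q b b1 : ℝ → ℝ} {Cb : ℝ} (P : Prof q b b1 Cb) (x : E2) (i : Fin 2) :
    fderiv ℝ (fld q) x (e2basis i) = q ‖x‖ • e2basis i + (b ‖x‖ * x i) • x := by
  rw [(fld_hasFDerivAt P x).fderiv]
  simp [e2basis, EuclideanSpace.inner_single_right, smul_smul]

lemma fld_hasFDerivAt2 {q b b1 : ℝ → ℝ} {Cb : ℝ} (P : Prof q b b1 Cb) (i : Fin 2) {x : E2}
    (hx : x ≠ 0) :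
    ∃ L : E2 →L[ℝ] E2, HasFDerivAt (fun x : E2 => fderiv ℝ (fld q) x (e2basis i)) L x ∧
      L (e2basis i) = (2 * b ‖x‖ * x i) • e2basis i +
        (b1 ‖x‖ / ‖x‖ * x i ^ 2 + b ‖x‖) • x := by
  have hn := norm_pos_iff.2 hx
  have hc : HasFDerivAt (fun y : E2 => y i) (EuclideanSpace.proj i : E2 →L[ℝ] ℝ) x :=
    (EuclideanSpace.proj i : E2 →L[ℝ] ℝ).hasFDerivAt
  simp only [fld_fderiv P]
  refine ⟨_, ((hasFDerivAt_radial hx (P.dq _ hn)).smul_const (e2basis i)).add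
    (((hasFDerivAt_radial hx (P.db _ hn)).mul hc).smul (hasFDerivAt_id x)), ?_⟩
  rw [mul_div_cancel_right₀ _ hn.ne']
  simp [e2basis, EuclideanSpace.inner_single_right, add_smul, smul_smul]
  module

lemma fld_hasFDerivAt2_zero {q b b1 : ℝ → ℝ} {Cb : ℝ} (P : Prof q b b1 Cb) (i : Fin 2) :
    HasFDerivAt (fun x : E2 => fderiv ℝ (fld q) x (e2basis i))
      (0 : E2 →L[ℝ] E2) 0 := by
  simp only [fld_fderiv P]
  refine hasFDerivAt_zero_of_sq (C := 2 * Cb) fun y hy => ?_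
  by_cases hy0 : y = 0
  · subst hy0; simp
  have hn := norm_pos_iff.2 hy0
  have e : q ‖y‖ • e2basis i + (b ‖y‖ * y i) • y - (q ‖(0:E2)‖ • e2basis i +
      (b ‖(0:E2)‖ * (0:E2) i) • (0:E2)) - (0 : E2 →L[ℝ] E2) y =
      (q ‖y‖ - q 0) • e2basis i + (b ‖y‖ * y i) • y := by
    simp [sub_smul]; abel
  rw [e]
  refine (norm_add_le _ _).trans ?_
  rw [norm_smul, norm_smul, norm_mul, Real.norm_eq_abs, Real.norm_eq_abs]
  have h0 : ‖e2basis i‖ = 1 := by simp [e2basis]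
  have h1 := P.bq _ hn hy
  have h2 := P.bb _ hn hy
  have hCb : 0 ≤ Cb := (abs_nonneg _).trans h2
  have h3 : ‖y i‖ ≤ ‖y‖ := PiLp.norm_apply_le y i
  have h4 : |b ‖y‖| * ‖y i‖ * ‖y‖ ≤ Cb * ‖y‖ * ‖y‖ := by gcongr
  rw [h0]
  nlinarith

lemma fld_diff2 {q b b1 : ℝ → ℝ} {Cb : ℝ} (P : Prof q b b1 Cb) (i : Fin 2) :
    Differentiable ℝ (fun x : E2 => fderiv ℝ (fld q) x (e2basis i)) := by
  intro x
  by_cases hx : x = 0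
  · subst hx; exact (fld_hasFDerivAt2_zero P i).differentiableAt
  · obtain ⟨L, hL, -⟩ := fld_hasFDerivAt2 P i hx
    exact hL.differentiableAt

lemma fld_fderiv2 {q b b1 : ℝ → ℝ} {Cb : ℝ} (P : Prof q b b1 Cb) (i : Fin 2) {x : E2}
    (hx : x ≠ 0) :
    fderiv ℝ (fun x : E2 => fderiv ℝ (fld q) x (e2basis i)) x (e2basis i) =
      (2 * b ‖x‖ * x i) • e2basis i + (b1 ‖x‖ / ‖x‖ * x i ^ 2 + b ‖x‖) • x := by
  obtain ⟨L, hL, h⟩ := fld_hasFDerivAt2 P i hx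
  rw [hL.fderiv, h]

lemma fld_lap {q b b1 : ℝ → ℝ} {Cb : ℝ} (P : Prof q b b1 Cb) {x : E2}
    (hx : x ≠ 0) : lap (fld q) x = (4 * b ‖x‖ + ‖x‖ * b1 ‖x‖) • x := by
  have hn := norm_pos_iff.2 hx
  have hsq : x 0 ^ 2 + x 1 ^ 2 = ‖x‖ ^ 2 := by
    rw [EuclideanSpace.norm_sq_eq]; simp
  have hb : x 0 • e2basis 0 + x 1 • e2basis 1 = x := by
    ext j; fin_cases j <;> simp [e2basis]
  simp only [lap, fld_fderiv2 P _ hx, Fin.sum_univ_two]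
  have e : b1 ‖x‖ / ‖x‖ * x 0 ^ 2 + b1 ‖x‖ / ‖x‖ * x 1 ^ 2 = ‖x‖ * b1 ‖x‖ := by
    rw [← mul_add, hsq]; field_simp
  have e2 : (2 * b ‖x‖ * x 0) • e2basis 0 + (2 * b ‖x‖ * x 1) • e2basis 1
      = (2 * b ‖x‖) • x := by
    have := congrArg (fun z => (2 * b ‖x‖) • z) hb
    beta_reduce at this
    rw [← this]
    module
  rw [← e]
  calc _ = ((2 * b ‖x‖ * x 0) • e2basis 0 + (2 * b ‖x‖ * x 1) • e2basis 1) +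
      (b1 ‖x‖ / ‖x‖ * x 0 ^ 2 + b1 ‖x‖ / ‖x‖ * x 1 ^ 2 + 2 * b ‖x‖) • x := by module
    _ = _ := by rw [e2]; module

lemma fld_bounds {q b b1 : ℝ → ℝ} {Cb : ℝ} (P : Prof q b b1 Cb) {x : E2} (hx : x ≠ 0) :
    ‖fderiv ℝ (fld q) x‖ ≤ |q ‖x‖| + |b ‖x‖| * ‖x‖ ^ 2 ∧
    ∀ i, ‖fderiv ℝ (fun x : E2 => fderiv ℝ (fld q) x (e2basis i)) x (e2basis i)‖ ≤
      3 * (|b ‖x‖| * ‖x‖) + |b1 ‖x‖| * ‖x‖ ^ 2 := by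
  have hn := norm_pos_iff.2 hx
  constructor
  · rw [(fld_hasFDerivAt P x).fderiv]
    refine (norm_add_le _ _).trans ?_
    rw [norm_smul, norm_smul, Real.norm_eq_abs, Real.norm_eq_abs,
      ContinuousLinearMap.norm_smulRight_apply, innerSL_apply_norm]
    have := ContinuousLinearMap.norm_id_le (𝕜 := ℝ) (E := E2)
    nlinarith [abs_nonneg (q ‖x‖)]
  · intro i
    rw [fld_fderiv2 P i hx]
    refine (norm_add_le _ _).trans ?_
    have h0 : ‖e2basis i‖ = 1 := by simp [e2basis]
    have h3 : |x i| ≤ ‖x‖ := PiLp.norm_apply_le x i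
    have h4 : x i ^ 2 ≤ ‖x‖ ^ 2 := by rw [← sq_abs (x i)]; gcongr
    rw [norm_smul, norm_smul, h0, Real.norm_eq_abs, Real.norm_eq_abs]
    have a1 : |2 * b ‖x‖ * x i| ≤ 2 * (|b ‖x‖| * ‖x‖) := by
      rw [abs_mul, abs_mul, abs_two, mul_assoc]; gcongr
    have a2 : |b1 ‖x‖ / ‖x‖ * x i ^ 2 + b ‖x‖| ≤ |b1 ‖x‖| * ‖x‖ + |b ‖x‖| := by
      refine (abs_add_le _ _).trans ?_
      rw [abs_mul, abs_div, abs_of_nonneg (sq_nonneg (x i)), abs_of_pos hn]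
      have : |b1 ‖x‖| / ‖x‖ * x i ^ 2 ≤ |b1 ‖x‖| / ‖x‖ * ‖x‖ ^ 2 := by gcongr
      have e : |b1 ‖x‖| / ‖x‖ * ‖x‖ ^ 2 = |b1 ‖x‖| * ‖x‖ := by field_simp
      linarith
    have a3 := mul_le_mul_of_nonneg_right a2 hn.le
    nlinarith


lemma field_main {m g V V1 : ℝ → ℝ} {G B K C Cg Cg1 : ℝ} (S : ODESol m g V V1 G B K) (hG : 0 < G)
    (hmC : ∀ r, 0 < r → |m r| ≤ C) (hg0 : ∀ r, 0 < r → 0 ≤ g r) (hgC : ∀ r, 0 < r → g r ≤ Cg)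
    (hg1 : ∀ r, 0 < r → r ≤ 1 → g r ≤ Cg1 * r)
    (hVi : IntegrableOn (fun r => r * V r) (Ioi 0))
    (hgi : IntegrableOn (fun r => r * g r) (Ioi 0)) :
    ∃ q : ℝ → ℝ, (∀ r, 0 < r → q r = V r / r) ∧ MemH1 (fld q) ∧
      (∀ i, Differentiable ℝ (fun x => fderiv ℝ (fld q) x (e2basis i))) ∧
      (∀ i, MemLp (fun x => fderiv ℝ (fun y => fderiv ℝ (fld q) y (e2basis i)) x (e2basis i)) 2
        (volume : Measure E2)) ∧
      ∀ x : E2, x ≠ 0 → lap (fld q) x =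
        ((G * V ‖x‖ ^ 3 - m ‖x‖ * V ‖x‖ - g ‖x‖) / ‖x‖) • x := by
  obtain ⟨Cb, q0, hCb, hz⟩ := ode_zero S hG hmC hg0 hg1
  have hC : 0 ≤ C := (abs_nonneg _).trans (hmC 1 one_pos)
  have hB0 : 0 ≤ B := (S.nonneg 1 one_pos).trans (S.leB 1 one_pos)
  set q : ℝ → ℝ := fun r => if r ≤ 0 then q0 else V r / r with hqd
  set b : ℝ → ℝ := fun r => (r * V1 r - V r) / r ^ 3 with hbd
  set b1 : ℝ → ℝ := fun r => (G * V r ^ 3 - m r * V r - g r) / r ^ 2 - 4 * b r / r with hb1d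
  have hq : ∀ r, 0 < r → q r = V r / r := fun r hr => by simp [hqd, not_le.2 hr]
  have P : Prof q b b1 Cb := by
    constructor
    · intro r hr
      have h1 : HasDerivAt (fun r => V r / r) (b r * r) r := by
        refine ((S.der r hr).div (hasDerivAt_id r) hr.ne').congr_deriv ?_
        simp only [id, hbd]
        field_simp
      refine h1.congr_of_eventuallyEq ?_
      filter_upwards [Ioi_mem_nhds hr] with s hs using hq s hs
    · intro r hr
      refine ((((hasDerivAt_id r).mul (S.der2 r hr)).sub (S.der r hr)).div
        (hasDerivAt_pow 3 r) (by positivity)).congr_deriv ?_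
      simp only [id, hb1d, hbd, Pi.sub_apply, Pi.mul_apply]
      field_simp
      push_cast
      ring
    · intro r hr hr1
      have := (hz r hr hr1).1
      rw [hbd]
      beta_reduce
      rw [abs_div, abs_of_pos (by positivity : 0 < r ^ 3), div_le_iff₀ (by positivity)]
      exact this
    · intro r hr hr1
      have := (hz r hr hr1).2
      rw [hq r hr]
      simpa [hqd] using this
  set K1 : ℝ := 2 * |K| + 1 with hK1
  have hK10 : 0 ≤ K1 := by positivity
  set D : ℝ → ℝ := (Iic (1:ℝ)).indicator fun _ => (1:ℝ) with hD
  have hD0 : ∀ r, 0 ≤ D r := fun r => indicator_nonneg (fun _ _ => zero_le_one) r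
  have hD1 : ∀ r, D r ≤ 1 := fun r => indicator_le_self' (fun _ _ => zero_le_one) r
  have hDs : ∀ r, r ≤ 1 → D r = 1 := fun r hr => by simp [hD, hr]
  set M : ℝ := B + 7 * Cb + 7 * K1 + G * B ^ 2 + C + 1 with hM
  have cq : ∀ r, 0 < r → |q r| ≤ B * D r + V r := by
    intro r hr
    have v0 := S.nonneg r hr
    rw [hq r hr, abs_of_nonneg (by positivity)]
    by_cases h1 : r ≤ 1
    · rw [hDs r h1]
      have := S.leBr r hr
      rw [div_le_iff₀ hr]
      nlinarith
    · push Not at h1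
      have := hD0 r
      have h2 : V r / r ≤ V r := div_le_self v0 h1.le
      nlinarith [mul_nonneg hB0 this]
  have cb : ∀ r, 0 < r → |b r| * r ^ 2 ≤ Cb * D r + K1 * V r ∧
      |b r| * r ≤ Cb * D r + K1 * V r := by
    intro r hr
    have v0 := S.nonneg r hr
    by_cases h1 : r ≤ 1
    · rw [hDs r h1]
      have h2 := P.bb r hr h1
      have h3 : |b r| * r ≤ Cb * 1 := by gcongr
      have h4 : |b r| * r ^ 2 ≤ Cb * 1 := by
        have : r ^ 2 ≤ 1 := pow_le_one₀ hr.le h1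
        gcongr
      have : 0 ≤ K1 * V r := by positivity
      constructor <;> linarith
    · push Not at h1
      have e : |b r| * r ^ 2 = |V1 r - V r / r| := by
        rw [← abs_of_pos (by positivity : 0 < r ^ 2), ← abs_mul]
        congr 1
        simp only [hbd]
        field_simp
      have h2 : |V1 r - V r / r| ≤ K1 * V r := by
        have h3 := S.d_le r hr
        have h4 : V r / r ≤ V r := div_le_self v0 h1.le
        have h5 : K * (1 + 1 / r) * V r ≤ 2 * |K| * V r := by
          have h6 : 1 / r ≤ 1 := by rw [div_le_one hr]; exact h1.le
          calc K * (1 + 1 / r) * V r ≤ |K| * (1 + 1) * V r := by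
                gcongr
                exact le_abs_self K
            _ = _ := by ring
        calc _ ≤ |V1 r| + |V r / r| := abs_sub _ _
          _ ≤ _ := by rw [abs_of_nonneg (by positivity : 0 ≤ V r / r), hK1]; linarith
      have h7 : |b r| * r ≤ |b r| * r ^ 2 := by
        gcongr
        nlinarith
      have := mul_nonneg hCb (hD0 r)
      constructor <;> linarith
  have ch : ∀ r, 0 < r → |G * V r ^ 3 - m r * V r - g r| ≤ (G * B ^ 2 + C) * V r + g r := by
    intro r hr
    have v0 := S.nonneg r hr
    have v1 := S.leB r hr
    have a1 : |G * V r ^ 3| ≤ G * B ^ 2 * V r := by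
      rw [abs_of_nonneg (by positivity)]
      calc G * V r ^ 3 = G * V r ^ 2 * V r := by ring
        _ ≤ _ := by gcongr
    have a2 : |m r * V r| ≤ C * V r := by
      rw [abs_mul, abs_of_nonneg v0]
      have := hmC r hr
      gcongr
    have a3 : |g r| = g r := abs_of_nonneg (hg0 r hr)
    calc _ ≤ |G * V r ^ 3 - m r * V r| + |g r| := abs_sub _ _
      _ ≤ |G * V r ^ 3| + |m r * V r| + |g r| := by gcongr; exact abs_sub _ _
      _ ≤ _ := by rw [a3]; linarith
  have cb1 : ∀ r, 0 < r → |b1 r| * r ^ 2 ≤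
      (G * B ^ 2 + C) * V r + g r + 4 * (Cb * D r + K1 * V r) := by
    intro r hr
    have e : |b1 r| * r ^ 2 = |(G * V r ^ 3 - m r * V r - g r) - 4 * (b r * r)| := by
      rw [← abs_of_pos (by positivity : 0 < r ^ 2), ← abs_mul]
      congr 1
      simp only [hb1d]
      field_simp
    rw [e]
    have h1 := ch r hr
    have h2 := (cb r hr).2
    have h3 : |4 * (b r * r)| = 4 * (|b r| * r) := by
      rw [abs_mul, abs_mul, abs_of_pos hr]; norm_num
    refine (abs_sub _ _).trans ?_
    rw [h3]
    linarith
  set T : ℝ → ℝ := fun r => M * (D r + V r + g r) with hT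
  have hM0 : 0 ≤ M := by positivity
  have hTi : IntegrableOn (fun r => r * T r) (Ioi 0) := by
    have hDi : IntegrableOn (fun r => r * D r) (Ioi 0) := by
      have : (fun r => r * D r) = (Iic (1:ℝ)).indicator fun r => r := by
        ext r
        by_cases h : r ∈ Iic (1:ℝ) <;> simp [hD, h]
      rw [this]
      rw [IntegrableOn, integrable_indicator_iff measurableSet_Iic, IntegrableOn,
        Measure.restrict_restrict measurableSet_Iic]
      have : Iic (1:ℝ) ∩ Ioi 0 = Ioc 0 1 := by ext r; simp [and_comm]
      rw [this]
      exact (continuous_id.integrableOn_Icc (a := (0:ℝ)) (b := 1)).mono_set Ioc_subset_Icc_self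
    have := ((hDi.add hVi).add hgi).const_mul M
    refine this.congr (Eventually.of_forall fun r => ?_)
    simp only [hT, Pi.add_apply]
    ring
  have hTM : ∀ r, 0 < r → T r ≤ M * (1 + B + Cg) := by
    intro r hr
    have := S.leB r hr
    have := hgC r hr
    have := hD1 r
    simp only [hT]
    gcongr
  have big : ∀ r, 0 < r → ∀ y, y ≤ (B + 7 * Cb) * D r + (7 * K1 + 1 + (G * B ^ 2 + C)) * V r + g r →
      y ≤ T r := by
    intro r hr y hy
    have v0 := S.nonneg r hr
    have d0 := hD0 r
    have g0 := hg0 r hr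
    have a1 : (B + 7 * Cb) * D r ≤ M * D r := by
      gcongr
      have : 0 ≤ G * B ^ 2 := by positivity
      rw [hM]; linarith
    have a2 : (7 * K1 + 1 + (G * B ^ 2 + C)) * V r ≤ M * V r := by
      gcongr
      rw [hM]; linarith
    have a3 : 1 * g r ≤ M * g r := by
      gcongr
      have : 0 ≤ G * B ^ 2 := by positivity
      rw [hM]; linarith
    simp only [hT]
    linarith
  have hdf : Differentiable ℝ (fld q) := fun x => (fld_hasFDerivAt P x).differentiableAt
  refine ⟨q, hq, ⟨hdf, ?_, ?_⟩, fld_diff2 P, fun i => ?_, ?_⟩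
  · refine memLp_two_of_le hTi hTM hdf.continuous.aestronglyMeasurable fun x hx => ?_
    have hn := norm_pos_iff.2 hx
    have v0 := S.nonneg _ hn
    apply big _ hn
    have e : ‖fld q x‖ = V ‖x‖ := by
      rw [fld, norm_smul, hq _ hn, Real.norm_of_nonneg (by positivity)]
      field_simp
    rw [e]
    have := hD0 ‖x‖
    have := hg0 _ hn
    have a1 : 0 ≤ (B + 7 * Cb) * D ‖x‖ := by positivity
    have a2 : 0 ≤ (7 * K1 + (G * B ^ 2 + C)) * V ‖x‖ := by positivity
    linarith
  · refine memLp_two_of_le hTi hTM (measurable_fderiv ℝ (fld q)).aestronglyMeasurable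
      fun x hx => ?_
    have hn := norm_pos_iff.2 hx
    have v0 := S.nonneg _ hn
    apply big _ hn
    refine (fld_bounds P hx).1.trans ?_
    have h1 := cq _ hn
    have h2 := (cb _ hn).1
    have := hD0 ‖x‖
    have := hg0 _ hn
    have a1 : 0 ≤ (6 * Cb) * D ‖x‖ := by positivity
    have a2 : 0 ≤ (6 * K1 + (G * B ^ 2 + C)) * V ‖x‖ := by positivity
    linarith
  · refine memLp_two_of_le hTi hTM
      (measurable_fderiv_apply_const ℝ _ (e2basis i)).aestronglyMeasurable fun x hx => ?_
    have hn := norm_pos_iff.2 hx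
    have v0 := S.nonneg _ hn
    apply big _ hn
    refine ((fld_bounds P hx).2 i).trans ?_
    have h1 := cb1 _ hn
    have h2 := (cb _ hn).2
    have := hD0 ‖x‖
    have a1 : 0 ≤ B * D ‖x‖ := by positivity
    linarith
  · intro x hx
    have hn := norm_pos_iff.2 hx
    rw [fld_lap P hx]
    congr 1
    simp only [hb1d]
    field_simp
    ring


lemma hardy_like {M δ : ℝ} (hM : 0 < M) (hδ : 0 < δ) (hMδ : M * δ ^ 2 ≤ 1) :
    ∃ (Y : E2 → ℝ) (L : ℝ), Continuous Y ∧ (∀ x, ‖x‖ < δ → M ≤ Y x) ∧ (∀ x, |Y x| ≤ L) ∧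
      (∀ x, 2 * δ < ‖x‖ → Y x = 0) ∧
      ∀ w, MemH1 w → Integrable (gradSq w) ∧ Integrable (fun x => Y x * ‖w x‖ ^ 2) ∧
        ∫ x, Y x * ‖w x‖ ^ 2 ≤ ∫ x, gradSq w x := by
  let χ : ContDiffBump (0 : E2) := ⟨δ, 2 * δ, hδ, by linarith⟩
  set X : Fin 2 → E2 → ℝ := fun i x => (-M * x i) * χ x with hX
  have hXs : ∀ i, ContDiff ℝ (⊤ : ℕ∞) (X i) := by
    intro i
    refine ContDiff.mul (contDiff_const.mul ?_) χ.contDiff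
    exact (EuclideanSpace.proj i : E2 →L[ℝ] ℝ).contDiff
  have hXd : ∀ i, Differentiable ℝ (X i) := fun i => (hXs i).differentiable (by simp)
  have hXc : ∀ i, HasCompactSupport (X i) := fun i => χ.hasCompactSupport.mul_left
  have hX'c : ∀ i, Continuous (fun x => fderiv ℝ (X i) x (e2basis i)) := fun i =>
    ((hXs i).continuous_fderiv (by simp)).clm_apply continuous_const
  have hX's : ∀ i, HasCompactSupport (fun x => fderiv ℝ (X i) x (e2basis i)) := fun i =>
    (hXc i).fderiv_apply ℝ (e2basis i)
  have bX : ∀ i, ∃ C, ∀ x, ‖X i x‖ ≤ C := fun i =>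
    (hXc i).exists_bound_of_continuous (hXd i).continuous
  have bX' : ∀ i, ∃ C, ∀ x, ‖fderiv ℝ (X i) x (e2basis i)‖ ≤ C := fun i =>
    (hX's i).exists_bound_of_continuous (hX'c i)
  choose C1 hC1 using bX
  choose C2 hC2 using bX'
  have hC10 : ∀ i, 0 ≤ C1 i := fun i => (norm_nonneg _).trans (hC1 i 0)
  set Y : E2 → ℝ := fun x => ∑ i, (-(fderiv ℝ (X i) x (e2basis i)) - X i x ^ 2) with hY
  have hYc : Continuous Y := continuous_finsetSum _ fun i _ =>
    ((hX'c i).neg).sub ((hXd i).continuous.pow 2)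
  have hYb : ∀ x, |Y x| ≤ ∑ i, (C2 i + C1 i ^ 2) := by
    intro x
    refine (Finset.abs_sum_le_sum_abs _ _).trans (Finset.sum_le_sum fun i _ => ?_)
    have h1 := hC1 i x
    have h2 := hC2 i x
    rw [Real.norm_eq_abs] at h1 h2
    refine (abs_sub _ _).trans ?_
    rw [abs_neg, abs_pow]
    gcongr
  refine ⟨Y, _, hYc, ?_, hYb, ?_, ?_⟩
  · intro x hx
    have e1 : ∀ i, X i =ᶠ[𝓝 x] fun y => -M * y i := by
      intro i
      have : Metric.ball (0:E2) δ ∈ 𝓝 x := Metric.isOpen_ball.mem_nhds (by simpa using hx)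
      filter_upwards [this] with y hy
      have : χ y = 1 := χ.one_of_mem_closedBall (Metric.ball_subset_closedBall hy)
      simp [hX, this]
    have e2 : ∀ i, fderiv ℝ (X i) x (e2basis i) = -M := by
      intro i
      rw [(e1 i).fderiv_eq]
      have : HasFDerivAt (fun y : E2 => -M * y i) (-M • (EuclideanSpace.proj i : E2 →L[ℝ] ℝ)) x :=
        ((EuclideanSpace.proj i : E2 →L[ℝ] ℝ).hasFDerivAt).const_mul (-M)
      rw [this.fderiv]
      simp [e2basis]
    have e3 : ∀ i, X i x = -M * x i := fun i => (e1 i).self_of_nhds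
    have hsq : x 0 ^ 2 + x 1 ^ 2 = ‖x‖ ^ 2 := by
      rw [EuclideanSpace.norm_sq_eq]; simp
    simp only [hY, e2, e3, Fin.sum_univ_two]
    have h4 : ‖x‖ ^ 2 ≤ δ ^ 2 := by gcongr
    have h5 : M ^ 2 * ‖x‖ ^ 2 ≤ M := by
      calc M ^ 2 * ‖x‖ ^ 2 ≤ M ^ 2 * δ ^ 2 := by gcongr
        _ = M * (M * δ ^ 2) := by ring
        _ ≤ M * 1 := by gcongr
        _ = M := by ring
    have h6 : M ^ 2 * x 0 ^ 2 + M ^ 2 * x 1 ^ 2 = M ^ 2 * ‖x‖ ^ 2 := by rw [← hsq]; ring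
    nlinarith
  · intro x hx
    have e1 : ∀ i, X i =ᶠ[𝓝 x] fun _ => (0:ℝ) := by
      intro i
      have : (Metric.closedBall (0:E2) (2 * δ))ᶜ ∈ 𝓝 x :=
        Metric.isClosed_closedBall.isOpen_compl.mem_nhds (by simpa using hx)
      filter_upwards [this] with y hy
      have : χ y = 0 := χ.zero_of_le_dist (by
        simp only [Set.mem_compl_iff, Metric.mem_closedBall, not_le] at hy
        exact hy.le)
      simp [hX, this]
    have e2 : ∀ i, fderiv ℝ (X i) x (e2basis i) = 0 := by
      intro i
      rw [(e1 i).fderiv_eq]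
      simp
    have e3 : ∀ i, X i x = 0 := fun i => (e1 i).self_of_nhds
    simp [hY, e2, e3]
  · intro w hw
    have iw2 : Integrable (fun x => ‖w x‖ ^ 2) (volume : Measure E2) :=
      (memLp_two_iff_integrable_sq_norm hw.2.1.1).1 hw.2.1
    have ig : Integrable (gradSq w) := integrable_finsetSum _ fun i _ =>
      (memLp_two_iff_integrable_sq_norm (hw.dLp (e2basis i)).1).1 (hw.dLp (e2basis i))
    have iY : Integrable (fun x => Y x * ‖w x‖ ^ 2) :=
      iw2.bdd_mul hYc.aestronglyMeasurable (Eventually.of_forall hYb)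
    have iin : ∀ i, Integrable (fun x => (inner ℝ (w x) (fderiv ℝ w x (e2basis i)) : ℝ))
      (volume : Measure E2) := fun i => inner_integrable hw.2.1 (hw.dLp _)
    have dsq : ∀ i x, fderiv ℝ (fun y => ‖w y‖ ^ 2) x (e2basis i) =
        2 * inner ℝ (w x) (fderiv ℝ w x (e2basis i)) := by
      intro i x
      rw [((hw.1 x).hasFDerivAt.norm_sq).fderiv]
      simp
    have i1 : ∀ i, Integrable (fun x => X i x *
        fderiv ℝ (fun y => ‖w y‖ ^ 2) x (e2basis i)) (volume : Measure E2) := by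
      intro i
      simp only [dsq]
      exact ((iin i).const_mul 2).bdd_mul (hXd i).continuous.aestronglyMeasurable
        (Eventually.of_forall (hC1 i))
    have i2 : ∀ i, Integrable (fun x => fderiv ℝ (X i) x (e2basis i) * ‖w x‖ ^ 2)
        (volume : Measure E2) := fun i =>
      iw2.bdd_mul (hX'c i).aestronglyMeasurable (Eventually.of_forall (hC2 i))
    have i3 : ∀ i, Integrable (fun x => X i x * ‖w x‖ ^ 2) (volume : Measure E2) := fun i =>
      iw2.bdd_mul (hXd i).continuous.aestronglyMeasurable (Eventually.of_forall (hC1 i))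
    have i4 : ∀ i, Integrable (fun x => X i x ^ 2 * ‖w x‖ ^ 2) (volume : Measure E2) := by
      intro i
      refine iw2.bdd_mul (c := C1 i ^ 2) ((hXd i).continuous.pow 2).aestronglyMeasurable
        (Eventually.of_forall fun x => ?_)
      rw [norm_pow]
      have := hC1 i x
      gcongr
    have i5 : ∀ i, Integrable (fun x => X i x * fderiv ℝ (fun y => ‖w y‖ ^ 2) x (e2basis i)
        - X i x ^ 2 * ‖w x‖ ^ 2) (volume : Measure E2) := fun i => (i1 i).sub (i4 i)
    have i6 : ∀ i, Integrable (fun x => -(fderiv ℝ (X i) x (e2basis i) * ‖w x‖ ^ 2))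
        (volume : Measure E2) := fun i => (i2 i).neg
    have i7 : ∀ i, Integrable (fun x => -(fderiv ℝ (X i) x (e2basis i) * ‖w x‖ ^ 2)
        - X i x ^ 2 * ‖w x‖ ^ 2) (volume : Measure E2) := fun i => (i6 i).sub (i4 i)
    have hdw : Differentiable ℝ (fun y => ‖w y‖ ^ 2) := fun x =>
      ((hw.1 x).hasFDerivAt.norm_sq).differentiableAt
    have ibp : ∀ i, ∫ x, X i x * fderiv ℝ (fun y => ‖w y‖ ^ 2) x (e2basis i) =
        - ∫ x, fderiv ℝ (X i) x (e2basis i) * ‖w x‖ ^ 2 := fun i =>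
      integral_mul_fderiv_eq_neg_fderiv_mul_of_integrable (i2 i) (i1 i) (i3 i)
        (fun x _ => hXd i x) (fun x _ => hdw x)
    refine ⟨ig, iY, ?_⟩
    have eY : ∫ x, Y x * ‖w x‖ ^ 2 = ∫ x, ∑ i,
        (X i x * fderiv ℝ (fun y => ‖w y‖ ^ 2) x (e2basis i) - X i x ^ 2 * ‖w x‖ ^ 2) := by
      rw [integral_finsetSum _ fun i _ => i5 i]
      have : (fun x => Y x * ‖w x‖ ^ 2) = fun x => ∑ i,
          (-(fderiv ℝ (X i) x (e2basis i) * ‖w x‖ ^ 2) - X i x ^ 2 * ‖w x‖ ^ 2) := by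
        ext x
        rw [hY, Finset.sum_mul]
        exact Finset.sum_congr rfl fun i _ => by ring
      rw [this, integral_finsetSum _ fun i _ => i7 i]
      refine Finset.sum_congr rfl fun i _ => ?_
      rw [integral_sub (i1 i) (i4 i), integral_sub (i6 i) (i4 i), integral_neg, ibp i]
    rw [eY]
    refine integral_mono (integrable_finsetSum _ fun i _ => i5 i) ig fun x => ?_
    refine Finset.sum_le_sum fun i _ => ?_
    rw [dsq]
    have h0 : 0 ≤ ‖fderiv ℝ w x (e2basis i) - X i x • w x‖ ^ 2 := by positivity
    rw [norm_sub_sq_real, inner_smul_right, norm_smul, mul_pow, Real.norm_eq_abs, sq_abs,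
      real_inner_comm] at h0
    linarith


/-- the energy density -/
def dens (ε a : ℝ) (μ : E2 → ℝ) (f : E2 → E2) (u : E2 → E2) (x : E2) : ℝ :=
  (1/2) * gradSq u x - (1/(2*ε^2)) * μ x * ‖u x‖^2
    + (1/(4*ε^2)) * ‖u x‖^4 - (a/ε) * (inner ℝ (f x) (u x) : ℝ)

lemma MemH1.sub {u v : E2 → E2} (hu : MemH1 u) (hv : MemH1 v) : MemH1 (fun x => u x - v x) := by
  refine ⟨hu.1.sub hv.1, hu.2.1.sub hv.2.1, ?_⟩
  have : (fun x => fderiv ℝ (fun x => u x - v x) x) = fun x => fderiv ℝ u x - fderiv ℝ v x := by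
    ext1 x
    exact fderiv_fun_sub (hu.1 x) (hv.1 x)
  rw [this]
  exact hu.2.2.sub hv.2.2

lemma MemH1.sq_int {w : E2 → E2} (hw : MemH1 w) :
    Integrable (fun x => ‖w x‖ ^ 2) (volume : Measure E2) :=
  (memLp_two_iff_integrable_sq_norm hw.2.1.1).1 hw.2.1

lemma memH1_zero : MemH1 (fun _ => 0) := by
  refine ⟨differentiable_const _, MemLp.zero, ?_⟩
  simp only [fderiv_fun_const, Pi.zero_apply]
  exact MemLp.zero (ε := E2 →L[ℝ] E2)

lemma gradSq_expand {u v : E2 → E2} (hu : Differentiable ℝ u) (hv : Differentiable ℝ v) (x : E2) :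
    gradSq u x = gradSq v x + 2 * gradInner v (fun x => u x - v x) x
      + gradSq (fun x => u x - v x) x := by
  simp only [gradSq, gradInner, Finset.mul_sum, ← Finset.sum_add_distrib]
  refine Finset.sum_congr rfl fun i _ => ?_
  rw [fderiv_fun_sub (hu x) (hv x)]
  have e : fderiv ℝ u x (e2basis i) = fderiv ℝ v x (e2basis i)
      + (fderiv ℝ u x - fderiv ℝ v x) (e2basis i) := by simp
  conv_lhs => rw [e, norm_add_sq_real]

lemma energy_strict {ε a : ℝ} (hε : 0 < ε) {μ : E2 → ℝ} {f v : E2 → E2} {Y : E2 → ℝ} {C B : ℝ}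
    (hμc : Continuous μ) (hμC : ∀ x, |μ x| ≤ C) (hf2 : MemLp f 2 (volume : Measure E2))
    (hv : MemH1 v) (hvB : ∀ x, ‖v x‖ ≤ B)
    (hd : ∀ i, Differentiable ℝ (fun x => fderiv ℝ v x (e2basis i)))
    (hdd : ∀ i, MemLp (fun x => fderiv ℝ (fun y => fderiv ℝ v y (e2basis i)) x (e2basis i)) 2
      (volume : Measure E2))
    (hlap : ∀ x, x ≠ 0 → lap v x = ((‖v x‖ ^ 2 - μ x) / ε ^ 2) • v x - (a / ε) • f x)
    (hY : ∀ w, MemH1 w → Integrable (gradSq w) ∧ Integrable (fun x => Y x * ‖w x‖ ^ 2) ∧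
        ∫ x, Y x * ‖w x‖ ^ 2 ≤ ∫ x, gradSq w x)
    (hS : ∀ x, 0 < Y x + (‖v x‖ ^ 2 - μ x) / ε ^ 2) (hv0 : v ≠ fun _ => 0) :
    ∀ u, MemH1 u → u ≠ v → energy ε a μ f v < energy ε a μ f u := by
  have hvc : Continuous v := hv.1.continuous
  have hB0 : 0 ≤ B := (norm_nonneg _).trans (hvB 0)
  have iμ : ∀ {w}, MemH1 w → Integrable (fun x => μ x * ‖w x‖ ^ 2) (volume : Measure E2) :=
    fun hw => hw.sq_int.bdd_mul hμc.aestronglyMeasurable (Eventually.of_forall hμC)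
  have iv : ∀ {w}, MemH1 w → Integrable (fun x => ‖v x‖ ^ 2 * ‖w x‖ ^ 2) (volume : Measure E2) := by
    intro w hw
    refine hw.sq_int.bdd_mul (c := B ^ 2) (hvc.norm.pow 2).aestronglyMeasurable
      (Eventually.of_forall fun x => ?_)
    rw [norm_pow, norm_norm]
    have := hvB x
    gcongr
  have idv : Integrable (dens ε a μ f v) := by
    have i1 := ((hY v hv).1.const_mul (1/2))
    have i2 := ((iμ hv).const_mul (1/(2*ε^2)))
    have i3 := ((iv hv).const_mul (1/(4*ε^2)))
    have i4 := ((inner_integrable hf2 hv.2.1).const_mul (a/ε))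
    refine (((i1.sub i2).add i3).sub i4).congr (Eventually.of_forall fun x => ?_)
    simp only [dens, Pi.add_apply, Pi.sub_apply]
    ring
  have main : ∀ u, MemH1 u → u ≠ v → Integrable (dens ε a μ f u) →
      energy ε a μ f v < energy ε a μ f u := by
    intro u hu huv idu
    have hw := hu.sub hv
    set w : E2 → E2 := fun x => u x - v x with hwd
    obtain ⟨j1, j2, j3⟩ := weak_form hv hw hd hdd
    obtain ⟨k1, k2, k3⟩ := hY w hw
    have iR : Integrable (fun x => (‖v x‖ ^ 2 - μ x) / ε ^ 2 * ‖w x‖ ^ 2) (volume : Measure E2) := by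
      refine (((iv hw).sub (iμ hw)).const_mul (1 / ε ^ 2)).congr (Eventually.of_forall fun x => ?_)
      simp only [Pi.sub_apply]
      ring
    have iS : Integrable (fun x => (Y x + (‖v x‖ ^ 2 - μ x) / ε ^ 2) * ‖w x‖ ^ 2)
        (volume : Measure E2) := by
      refine (k2.add iR).congr (Eventually.of_forall fun x => ?_)
      simp only [Pi.add_apply]
      ring
    have hSpos : 0 < ∫ x, (Y x + (‖v x‖ ^ 2 - μ x) / ε ^ 2) * ‖w x‖ ^ 2 := by
      rw [integral_pos_iff_support_of_nonneg _ iS]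
      · have hsupp : (Function.support fun x => (Y x + (‖v x‖ ^ 2 - μ x) / ε ^ 2) * ‖w x‖ ^ 2)
            = Function.support w := by
          ext x
          simp [(hS x).ne']
        rw [hsupp]
        refine (hw.1.continuous.isOpen_support).measure_pos _ ?_
        rw [Function.support_nonempty_iff]
        intro h0
        apply huv
        ext1 x
        exact sub_eq_zero.1 (congrFun h0 x)
      · intro x
        have := hS x
        simp only [Pi.zero_apply]
        positivity
    have eS : ∫ x, (Y x + (‖v x‖ ^ 2 - μ x) / ε ^ 2) * ‖w x‖ ^ 2 =
        (∫ x, Y x * ‖w x‖ ^ 2) + ∫ x, (‖v x‖ ^ 2 - μ x) / ε ^ 2 * ‖w x‖ ^ 2 := by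
      rw [← integral_add k2 iR]
      congr 1
      ext x
      ring
    have j4 : Integrable (fun x => gradInner v w x + inner ℝ (lap v x) (w x))
      (volume : Measure E2) := j1.add j2
    have j5 : Integrable (fun x => (1/2) * (gradSq w x +
      (‖v x‖ ^ 2 - μ x) / ε ^ 2 * ‖w x‖ ^ 2)) (volume : Measure E2) := (k1.add iR).const_mul (1/2)
    have hle : ∫ x, ((gradInner v w x + inner ℝ (lap v x) (w x)) + (1/2) * (gradSq w x +
        (‖v x‖ ^ 2 - μ x) / ε ^ 2 * ‖w x‖ ^ 2)) ≤
        ∫ x, (dens ε a μ f u x - dens ε a μ f v x) := by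
      refine integral_mono_ae (j4.add j5) (idu.sub idv) ?_
      have : ∀ᵐ x : E2, x ≠ 0 := by simp [ae_iff]
      filter_upwards [this] with x hx
      have e1 := gradSq_expand hu.1 hv.1 x
      have e2 : u x = v x + w x := by simp [hwd]
      have e3 : ‖u x‖ ^ 2 = ‖v x‖ ^ 2 + 2 * inner ℝ (v x) (w x) + ‖w x‖ ^ 2 := by
        rw [e2, norm_add_sq_real]
      have e4 : ‖u x‖ ^ 4 = (‖v x‖ ^ 2 + 2 * inner ℝ (v x) (w x) + ‖w x‖ ^ 2) ^ 2 := by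
        rw [← e3]; ring
      have e5 : (inner ℝ (f x) (u x) : ℝ) = inner ℝ (f x) (v x) + inner ℝ (f x) (w x) := by
        rw [e2, inner_add_right]
      have e6 : (inner ℝ (lap v x) (w x) : ℝ) = (‖v x‖ ^ 2 - μ x) / ε ^ 2 * inner ℝ (v x) (w x)
          - (a / ε) * inner ℝ (f x) (w x) := by
        rw [hlap x hx, inner_sub_left, real_inner_smul_left, real_inner_smul_left]
      simp only [dens, e1, e3, e4, e5, e6]
      have hq : 0 ≤ (1/(4*ε^2)) * (2 * inner ℝ (v x) (w x) + ‖w x‖ ^ 2) ^ 2 := by positivity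
      rw [← sub_nonneg]
      refine hq.trans (le_of_eq ?_)
      field_simp
      ring
    rw [integral_sub idu idv, integral_add j4 j5,
      integral_add j1 j2, integral_const_mul, integral_add k1 iR, j3] at hle
    have e1 : energy ε a μ f u = ∫ x, dens ε a μ f u x := rfl
    have e2 : energy ε a μ f v = ∫ x, dens ε a μ f v x := rfl
    rw [e1, e2]
    linarith
  have hneg : energy ε a μ f v < 0 := by
    have h0 : energy ε a μ f (fun _ => 0) = 0 := by
      simp [energy, gradSq]
    rw [← h0]
    refine main _ memH1_zero hv0.symm ?_
    have : dens ε a μ f (fun _ => 0) = fun _ => 0 := by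
      ext x
      simp [dens, gradSq]
    rw [this]
    exact integrable_zero _ _ _
  intro u hu huv
  by_cases h : Integrable (dens ε a μ f u)
  · exact main u hu huv h
  · have e1 : energy ε a μ f u = 0 := integral_undef h
    rw [e1]
    exact hneg


set_option maxHeartbeats 2000000 in
/-- for fixed `ε > 0` there exists `A > 0` such that for all `a > A`
the global minimizer is unique and radially equivariant:
`v(x) = v_rad(|x|) x/|x|`, equivalently `v(gx) = g v(x)` for all `g ∈ O(2)`. -/
theorem statement8
    (μ : E2 → ℝ) (μrad : ℝ → ℝ) (ρ : ℝ) (f : E2 → E2) (frad : ℝ → ℝ)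
    (hμ : MuHyp μ μrad ρ) (hf : FHyp f frad)
    (ε : ℝ) (hε : 0 < ε) :
    ∃ A : ℝ, 0 < A ∧ ∀ a : ℝ, A < a →
      (∃! v : E2 → E2, IsMinimizer ε a μ f v) ∧
      (∀ v : E2 → E2, IsMinimizer ε a μ f v →
        (∃ vrad : ℝ → ℝ, ∀ x : E2, x ≠ 0 → v x = (vrad ‖x‖ / ‖x‖) • x) ∧
        (∀ g : E2 ≃ₗᵢ[ℝ] E2, ∀ x : E2, v (g x) = g (v x))) := by
  have hε2 : 0 < ε ^ 2 := by positivity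
  obtain ⟨C, hC⟩ := hμ.bdd
  obtain ⟨CF, hCF⟩ := hf.bdd
  have hC0 : 0 ≤ C := (abs_nonneg _).trans (hC 0)
  have hvec : ∀ r : ℝ, 0 ≤ r → ∃ x : E2, ‖x‖ = r := fun r hr =>
    ⟨EuclideanSpace.single 0 r, by simp [abs_of_nonneg hr]⟩
  have hmur : ∀ r, 0 ≤ r → |μrad r| ≤ C := by
    intro r hr
    obtain ⟨x, rfl⟩ := hvec r hr
    rw [← hμ.radial]
    exact hC x
  have hfn : ∀ x : E2, x ≠ 0 → ‖f x‖ = frad ‖x‖ := by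
    intro x hx
    have hn := norm_pos_iff.2 hx
    have := hf.pos_rad _ hn
    rw [hf.radial x hx, norm_smul, Real.norm_of_nonneg (by positivity)]
    field_simp
  have hfr : ∀ r, 0 < r → frad r ≤ CF := by
    intro r hr
    obtain ⟨x, rfl⟩ := hvec r hr.le
    rw [← hfn x (norm_pos_iff.1 hr)]
    exact hCF x
  have hae : ∀ᵐ x : E2, x ≠ 0 := by simp [ae_iff]
  have hfi : IntegrableOn (fun r => r * frad r) (Ioi 0) := by
    have h1 : Integrable (fun x : E2 => frad ‖x‖) := by
      refine hf.integrable.norm.congr ?_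
      filter_upwards [hae] with x hx using hfn x hx
    rw [integrable_fun_norm_addHaar] at h1
    simpa using h1
  have hf2 : MemLp f 2 (volume : Measure E2) :=
    memLp_two_of_le hfi hfr hf.smooth.continuous.aestronglyMeasurable
      fun x hx => (hfn x hx).le
  have hanti : StrictAntiOn μrad (Ici 0) := by
    refine strictAntiOn_of_deriv_neg (convex_Ici 0) hμ.smooth_rad.continuous.continuousOn ?_
    intro r hr
    rw [interior_Ici] at hr
    exact hμ.deriv_neg r hr
  have hρ := hμ.rho_pos
  have hneg : ∀ r, ρ < r → μrad r < 0 := by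
    intro r hr
    rw [← hμ.rho_root]
    exact hanti (Set.mem_Ici.2 hρ.le) (Set.mem_Ici.2 (hρ.trans hr).le) hr
  obtain ⟨Cf1, hCf1⟩ : ∃ c, ∀ r, 0 < r → r ≤ 1 → frad r ≤ c * r := by
    have hdc : Continuous (deriv frad) := hf.smooth_rad.continuous_deriv (by simp)
    obtain ⟨c, hc⟩ := (isCompact_Icc (a := (0:ℝ)) (b := 1)).exists_bound_of_continuousOn
      hdc.continuousOn
    refine ⟨c, fun r hr hr1 => ?_⟩
    have h0 : frad 0 = 0 := by
      have := hf.odd_rad 0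
      rw [neg_zero] at this
      linarith
    have := (convex_Icc (0:ℝ) 1).norm_image_sub_le_of_norm_deriv_le (f := frad) (x := 0) (y := r)
      (fun x _ => (hf.smooth_rad.differentiable (by simp)) x) hc (by simp) ⟨hr.le, hr1⟩
    rw [h0, sub_zero, sub_zero, Real.norm_of_nonneg (hf.pos_rad r hr).le,
      Real.norm_of_nonneg hr.le] at this
    exact this
  -- the weight
  set M : ℝ := C / ε ^ 2 + 1 with hM
  have hM0 : 0 < M := by positivity
  set δ : ℝ := min (1 / 2) (1 / M) with hδd
  have hδ : 0 < δ := by positivity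
  have hδ1 : δ ≤ 1 / 2 := min_le_left _ _
  have hδ2 : M * δ ≤ 1 := by
    have : δ ≤ 1 / M := min_le_right _ _
    rw [le_div_iff₀ hM0] at this
    linarith
  have hMδ : M * δ ^ 2 ≤ 1 := by nlinarith
  obtain ⟨Y, L, hYc, hY1, hY2, hY3, hY4⟩ := hardy_like hM0 hδ hMδ
  have hL : 0 ≤ L := (abs_nonneg _).trans (hY2 0)
  set n : ℝ := C + ε ^ 2 * L + 1 with hn
  have hn1 : 1 ≤ n := by
    have : 0 ≤ ε ^ 2 * L := by positivity
    rw [hn]; linarith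
  set al : ℝ := δ / 2 with hal
  set be : ℝ := ρ + 1 + 1 with hbe
  set lam : ℝ := 2 * n / δ with hlam
  have hlam0 : 0 < lam := by positivity
  have hal0 : 0 < al := by positivity
  have hab : al < be := by rw [hal, hbe]; linarith
  set Ex : ℝ → ℝ := fun r => 2 * lam - lam * (al + be - 2 * r) / r
      + lam * ((r - al) * (be - r)) / r ^ 2 + C / ε ^ 2 * (lam * ((r - al) * (be - r)))
      + (1 / ε ^ 2) * (lam * ((r - al) * (be - r))) ^ 3 with hEx
  have hExc : ContinuousOn Ex (Icc al be) := by
    have h0 : ∀ r ∈ Icc al be, r ≠ 0 := fun r hr => (hal0.trans_le hr.1).ne'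
    have h1 : ∀ r ∈ Icc al be, r ^ 2 ≠ 0 := fun r hr => pow_ne_zero 2 (h0 r hr)
    have c1 : Continuous fun r : ℝ => lam * ((r - al) * (be - r)) := by fun_prop
    have c2 : Continuous fun r : ℝ => lam * (al + be - 2 * r) := by fun_prop
    exact (((continuousOn_const.sub (c2.continuousOn.div continuousOn_id h0)).add
      (c1.continuousOn.div (continuousOn_id.pow 2) h1)).add
      (continuousOn_const.mul c1.continuousOn)).add
      (continuousOn_const.mul (c1.continuousOn.pow 3))
  obtain ⟨Q, hQ⟩ := (isCompact_Icc (a := al) (b := be)).exists_bound_of_continuousOn hExc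
  obtain ⟨x0, hx0, hmin⟩ := (isCompact_Icc (a := al) (b := be)).exists_isMinOn
    (nonempty_Icc.2 hab.le) hf.smooth_rad.continuous.continuousOn
  have hfmin : 0 < frad x0 := hf.pos_rad x0 (hal0.trans_le hx0.1)
  refine ⟨max 1 ((|Q| + 1) * ε / frad x0), by positivity, fun a ha => ?_⟩
  have ha1 : 1 < a := (le_max_left _ _).trans_lt ha
  have ha2 : (|Q| + 1) * ε / frad x0 < a := (le_max_right _ _).trans_lt ha
  have hae0 : 0 < a / ε := by positivity
  have hgQ : ∀ r ∈ Icc al be, Ex r < a / ε * frad r := by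
    intro r hr
    have h1 : Ex r ≤ Q := (le_abs_self _).trans (hQ r hr)
    have h2 : frad x0 ≤ frad r := hmin hr
    have h3 : |Q| + 1 < a / ε * frad x0 := by
      rw [div_lt_iff₀ hfmin] at ha2
      rw [div_mul_eq_mul_div, lt_div_iff₀ hε]
      exact ha2
    have h4 : a / ε * frad x0 ≤ a / ε * frad r := by gcongr
    have h5 := le_abs_self Q
    linarith
  have hG : 0 < 1 / ε ^ 2 := by positivity
  have hmC : ∀ r, 0 < r → |μrad r / ε ^ 2| ≤ C / ε ^ 2 := by
    intro r hr
    rw [abs_div, abs_of_pos hε2]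
    have := hmur r hr.le
    gcongr
  have hmcont : ContinuousOn (fun r => μrad r / ε ^ 2) (Ioi 0) :=
    (hμ.smooth_rad.continuous.div_const _).continuousOn
  have hgcont : ContinuousOn (fun r => a / ε * frad r) (Ioi 0) :=
    (hf.smooth_rad.continuous.const_mul (a / ε)).continuousOn
  have hg0 : ∀ r, 0 < r → 0 ≤ a / ε * frad r := by
    intro r hr
    have := hf.pos_rad r hr
    positivity
  have hgC : ∀ r, 0 < r → a / ε * frad r ≤ a / ε * CF := by
    intro r hr
    have := hfr r hr
    gcongr
  have hg1 : ∀ r, 0 < r → r ≤ 1 → a / ε * frad r ≤ (a / ε * Cf1) * r := by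
    intro r hr hr1
    have := hCf1 r hr hr1
    rw [mul_assoc]
    gcongr
  have hgi : IntegrableOn (fun r => r * (a / ε * frad r)) (Ioi 0) := by
    refine (hfi.const_mul (a / ε)).congr (Eventually.of_forall fun r => ?_)
    ring
  obtain ⟨V, V1, B, K, hV⟩ := ode_exists (fun r => μrad r / ε ^ 2) (fun r => a / ε * frad r)
    (1 / ε ^ 2) (C / ε ^ 2) (a / ε * CF) hG hmcont hgcont hmC hg0 hgC
  have S : ODESol (fun r => μrad r / ε ^ 2) (fun r => a / ε * frad r) V V1 (1 / ε ^ 2) B K :=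
    ⟨fun r hr => (hV r hr).1, fun r hr => (hV r hr).2.1, fun r hr => (hV r hr).2.2.1,
      fun r hr => (hV r hr).2.2.2.1, fun r hr => (hV r hr).2.2.2.2.1,
      fun r hr => (hV r hr).2.2.2.2.2⟩
  have hB0 : 0 ≤ B := (S.nonneg 1 one_pos).trans (S.leB 1 one_pos)
  have hVi : IntegrableOn (fun r => r * V r) (Ioi 0) := by
    have hR := hneg (ρ + 1) (by linarith)
    refine ode_integrable (c := -(μrad (ρ + 1)) / ε ^ 2) (R0 := ρ + 1) S hG hmcont hgcont hg0
      (by linarith) (div_pos (by linarith) hε2) ?_ hgi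
    intro r hr
    rw [← neg_div, neg_neg]
    have : μrad r ≤ μrad (ρ + 1) :=
      hanti.antitoneOn (Set.mem_Ici.2 (by linarith)) (Set.mem_Ici.2 (by linarith)) hr
    gcongr
  obtain ⟨q, hq, hvH, hd, hdd, hlap⟩ := field_main S hG hmC hg0 hgC hg1 hVi hgi
  have hlow := ode_lower (lam := lam) S hG hmC hal0 hab hgQ
  have hVn : ∀ r, δ ≤ r → r ≤ ρ + 1 → n ≤ V r := by
    intro r h1 h2
    have h3 := hlow r ⟨by rw [hal]; linarith, by rw [hbe]; linarith⟩
    have h4 : al * 1 ≤ (r - al) * (be - r) := by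
      have a1 : al ≤ r - al := by rw [hal]; linarith
      have a2 : 1 ≤ be - r := by rw [hbe]; linarith
      gcongr
      linarith
    have h5 : lam * (al * 1) = n := by rw [hlam, hal]; field_simp
    have h6 : lam * (al * 1) ≤ lam * ((r - al) * (be - r)) := by gcongr
    linarith
  have hnv : ∀ x : E2, x ≠ 0 → ‖fld q x‖ = V ‖x‖ := by
    intro x hx
    have hxn := norm_pos_iff.2 hx
    have v0 := S.nonneg _ hxn
    rw [fld, norm_smul, hq _ hxn, Real.norm_of_nonneg (by positivity)]
    field_simp
  have hvB : ∀ x, ‖fld q x‖ ≤ B := by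
    intro x
    by_cases hx : x = 0
    · simp [hx, fld, hB0]
    · rw [hnv x hx]
      exact S.leB _ (norm_pos_iff.2 hx)
  have hlap2 : ∀ x, x ≠ 0 → lap (fld q) x =
      ((‖fld q x‖ ^ 2 - μ x) / ε ^ 2) • fld q x - (a / ε) • f x := by
    intro x hx
    have hxn := norm_pos_iff.2 hx
    rw [hlap x hx, hnv x hx, hf.radial x hx, hμ.radial x, fld, hq _ hxn, smul_smul, smul_smul,
      ← sub_smul]
    congr 1
    field_simp
  have hS : ∀ x, 0 < Y x + (‖fld q x‖ ^ 2 - μ x) / ε ^ 2 := by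
    intro x
    have hμx := abs_le.1 (hC x)
    rcases lt_or_ge ‖x‖ δ with h1 | h1
    · have h2 := hY1 x h1
      have h3 : -(C / ε ^ 2) ≤ (‖fld q x‖ ^ 2 - μ x) / ε ^ 2 := by
        rw [← neg_div]
        gcongr
        nlinarith [sq_nonneg ‖fld q x‖]
      rw [hM] at h2
      linarith
    · have hx : x ≠ 0 := norm_pos_iff.1 (hδ.trans_le h1)
      rcases le_or_gt ‖x‖ (ρ + 1) with h2 | h2
      · have h3 := hVn _ h1 h2
        have h4 := (abs_le.1 (hY2 x)).1
        rw [hnv x hx]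
        have h5 : L < (V ‖x‖ ^ 2 - μ x) / ε ^ 2 := by
          rw [lt_div_iff₀ hε2]
          have : n ≤ V ‖x‖ ^ 2 := by nlinarith
          rw [hn] at this
          nlinarith
        linarith
      · have h3 : Y x = 0 := hY3 x (by linarith)
        have h4 : μ x < 0 := by rw [hμ.radial x]; exact hneg _ (by linarith)
        rw [h3, zero_add]
        refine div_pos ?_ hε2
        nlinarith [sq_nonneg ‖fld q x‖]
  have hv0 : fld q ≠ fun _ => 0 := by
    intro h
    obtain ⟨x, hx⟩ := hvec (ρ + 1) (by linarith)
    have hx0 : x ≠ 0 := norm_pos_iff.1 (by rw [hx]; linarith)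
    have h1 := hnv x hx0
    have h2 := hVn (ρ + 1) (by linarith) le_rfl
    rw [h, hx, norm_zero] at h1
    linarith
  have hstrict := energy_strict (a := a) hε hμ.smooth.continuous hC hf2 hvH hvB hd hdd hlap2 hY4
    hS hv0
  have huniq : ∀ u, IsMinimizer ε a μ f u → u = fld q := by
    intro u hu
    by_contra hne
    exact absurd (hu.2 _ hvH) (not_le.2 (hstrict u hu.1 hne))
  refine ⟨⟨fld q, ⟨hvH, fun u hu => ?_⟩, huniq⟩, ?_⟩
  · by_cases h : u = fld q
    · rw [h]
    · exact (hstrict u hu h).le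
  · intro u hu
    rw [huniq u hu]
    refine ⟨⟨fun r => r * q r, fun x hx => ?_⟩, fun g x => ?_⟩
    · have hxn := norm_pos_iff.2 hx
      rw [fld, mul_div_cancel_left₀ _ hxn.ne']
    · simp [fld]
end
end

section
/- Suppose the product εa belongs to a bounded interval, and let u_{ε,a} be smooth solutions of ε²Δu + μ(x)u − |u|²u + εa f(x) = 0 on ℝ² with u(x) → 0 as |x| → ∞. Then the functions u_{ε,a} and the maps ε∇u_{ε,a} are bounded in L^∞(ℝ²) uniformly in ε and a. -/
open MeasureTheory Filter Real Set
open scoped Topology ENNReal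

noncomputable section

lemma secondDeriv_nonneg (h h' : ℝ → ℝ) (c t₀ : ℝ) (h1 : ∀ t, HasDerivAt h (h' t) t)
    (h2 : HasDerivAt h' c t₀) (hm : IsLocalMin h t₀) : 0 ≤ c := by
  by_contra hc
  push Not at hc
  have hd : deriv h = h' := funext fun t => (h1 t).deriv
  have hz : deriv h t₀ = 0 := hm.deriv_eq_zero
  have hmax : IsLocalMax h t₀ := by
    apply isLocalMax_of_deriv_deriv_neg _ hz (h1 t₀).continuousAt
    rw [hd, h2.deriv]; exact hc
  have heq : h =ᶠ[𝓝 t₀] fun _ => h t₀ := by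
    filter_upwards [hm, hmax] with t a b using le_antisymm b a
  have h3 : deriv h =ᶠ[𝓝 t₀] deriv (fun _ => h t₀) := heq.deriv
  have h4 := h3.deriv_eq
  rw [hd, h2.deriv] at h4
  simp at h4
  exact hc.ne h4

/-- Interior gradient estimate for the Poisson equation, by comparison (Gilbarg–Trudinger 3.4). -/
lemma grad_estimate (w ws wss wt wtt : ℝ → ℝ → ℝ) (M N d : ℝ) (hd : 0 < d)
    (hc : Continuous (Function.uncurry w))
    (hs : ∀ s t, HasDerivAt (fun s => w s t) (ws s t) s)
    (hss : ∀ s t, HasDerivAt (fun s => ws s t) (wss s t) s)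
    (ht : ∀ s t, HasDerivAt (fun t => w s t) (wt s t) t)
    (htt : ∀ s t, HasDerivAt (fun t => wt s t) (wtt s t) t)
    (hM : ∀ s t, |w s t| ≤ M) (hN : ∀ s t, |wss s t + wtt s t| < N) :
    wt 0 0 ≤ 2 * M / d + N * d / 2 := by
  have hM0 : 0 ≤ M := (abs_nonneg _).trans (hM 0 0)
  have hN0 : 0 < N := (abs_nonneg _).trans_lt (hN 0 0)
  set A : ℝ := M / d ^ 2 with hA
  have hA0 : 0 ≤ A := by positivity
  have hAd : A * d ^ 2 = M := by rw [hA]; field_simp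
  set h : ℝ → ℝ → ℝ := fun s t =>
    A * (s ^ 2 + t * (2 * d - t)) + N / 2 * (t * (d - t)) - (w s t - w s (-t)) / 2 with hh
  have hhc : Continuous (Function.uncurry h) := by
    have c1 : Continuous fun p : ℝ × ℝ => w p.1 p.2 := hc
    have c2 : Continuous fun p : ℝ × ℝ => w p.1 (-p.2) :=
      hc.comp (continuous_fst.prodMk continuous_snd.neg)
    simp only [hh, Function.uncurry_def]
    fun_prop
  have h1s : ∀ s t, HasDerivAt (fun s => h s t) (A * (2 * s) - (ws s t - ws s (-t)) / 2) s := by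
    intro s t
    have := ((((hasDerivAt_pow 2 s).add_const (t * (2 * d - t))).const_mul A).add_const
      (N / 2 * (t * (d - t)))).sub (((hs s t).sub (hs s (-t))).div_const 2)
    refine this.congr_deriv ?_
    simp
  have h2s : ∀ s t, HasDerivAt (fun s => A * (2 * s) - (ws s t - ws s (-t)) / 2)
      (A * 2 - (wss s t - wss s (-t)) / 2) s := by
    intro s t
    have := (((hasDerivAt_id s).const_mul 2).const_mul A).sub
      (((hss s t).sub (hss s (-t))).div_const 2)
    refine this.congr_deriv ?_
    simp
  have hneg : ∀ (g g' : ℝ → ℝ) (_ : ∀ t, HasDerivAt g (g' t) t) (t : ℝ),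
      HasDerivAt (fun t => g (-t)) (-(g' (-t))) t := by
    intro g g' hg t
    have := (hg (-t)).comp t (hasDerivAt_neg t)
    refine this.congr_deriv ?_
    simp
  have h1t : ∀ s t, HasDerivAt (fun t => h s t)
      (A * (2 * d - 2 * t) + N / 2 * (d - 2 * t) - (wt s t + wt s (-t)) / 2) t := by
    intro s t
    have q1 := ((((hasDerivAt_id t).mul ((hasDerivAt_id t).const_sub (2 * d))).const_add
      (s ^ 2)).const_mul A)
    have q2 := ((hasDerivAt_id t).mul ((hasDerivAt_id t).const_sub d)).const_mul (N / 2)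
    have q3 := ((ht s t).sub (hneg _ _ (ht s) t)).div_const 2
    have := (q1.add q2).sub q3
    refine this.congr_deriv ?_
    simp
    ring
  have h2t : ∀ s t, HasDerivAt
      (fun t => A * (2 * d - 2 * t) + N / 2 * (d - 2 * t) - (wt s t + wt s (-t)) / 2)
      (- (2 * A) - N - (wtt s t - wtt s (-t)) / 2) t := by
    intro s t
    have q1 := (((hasDerivAt_id t).const_mul 2).const_sub (2 * d)).const_mul A
    have q2 := (((hasDerivAt_id t).const_mul 2).const_sub d).const_mul (N / 2)
    have q3 := ((htt s t).add (hneg _ _ (htt s) t)).div_const 2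
    have := (q1.add q2).sub q3
    refine this.congr_deriv ?_
    simp
    ring
  -- minimum on the rectangle
  have hK : IsCompact (Icc (-d) d ×ˢ Icc 0 d : Set (ℝ × ℝ)) := isCompact_Icc.prod isCompact_Icc
  obtain ⟨⟨s₀, t₀⟩, ⟨⟨hs1, hs2⟩, ⟨ht1, ht2⟩⟩, hmin⟩ := hK.exists_isMinOn
    ⟨(0, 0), by constructor <;> constructor <;> simp [hd.le]⟩ hhc.continuousOn
  simp only at hs1 hs2 ht1 ht2
  have hmin' : ∀ s t, -d ≤ s → s ≤ d → 0 ≤ t → t ≤ d → h s₀ t₀ ≤ h s t :=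
    fun s t a b c e => hmin (show (s, t) ∈ _ from ⟨⟨a, b⟩, ⟨c, e⟩⟩)
  have hpos : 0 ≤ h s₀ t₀ := by
    have b1 := abs_le.1 (hM s₀ t₀)
    have b2 := abs_le.1 (hM s₀ (-t₀))
    by_cases e1 : t₀ = 0
    · simp only [hh, e1]; simp; positivity
    have ht1' : 0 < t₀ := lt_of_le_of_ne ht1 (Ne.symm e1)
    have p1 : 0 ≤ N / 2 * (t₀ * (d - t₀)) :=
      mul_nonneg (by positivity) (mul_nonneg ht1 (by linarith))
    by_cases e2 : t₀ = d
    · simp only [hh]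
      have : M ≤ A * (s₀ ^ 2 + t₀ * (2 * d - t₀)) := by
        rw [← hAd, e2]; apply mul_le_mul_of_nonneg_left _ hA0; nlinarith [sq_nonneg s₀]
      linarith
    by_cases e3 : s₀ ^ 2 = d ^ 2
    · simp only [hh]
      have : M ≤ A * (s₀ ^ 2 + t₀ * (2 * d - t₀)) := by
        rw [← hAd, e3]; apply mul_le_mul_of_nonneg_left _ hA0; nlinarith
      linarith
    have ht2' : t₀ < d := lt_of_le_of_ne ht2 e2
    have hs2' : s₀ < d := lt_of_le_of_ne hs2 (fun e => e3 (by rw [e]))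
    have hs1' : -d < s₀ := lt_of_le_of_ne hs1 (fun e => e3 (by rw [← e]; ring))
    exfalso
    have m1 : IsLocalMin (fun s => h s t₀) s₀ := by
      filter_upwards [Ioo_mem_nhds hs1' hs2'] with s hs
      exact hmin' s t₀ hs.1.le hs.2.le ht1 ht2
    have m2 : IsLocalMin (fun t => h s₀ t) t₀ := by
      filter_upwards [Ioo_mem_nhds ht1' ht2'] with t ht
      exact hmin' s₀ t hs1 hs2 ht.1.le ht.2.le
    have k1 := secondDeriv_nonneg _ _ _ _ (fun s => h1s s t₀) (h2s s₀ t₀) m1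
    have k2 := secondDeriv_nonneg _ _ _ _ (fun t => h1t s₀ t) (h2t s₀ t₀) m2
    have n1 := abs_lt.1 (hN s₀ t₀)
    have n2 := abs_lt.1 (hN s₀ (-t₀))
    linarith
  -- compare derivatives at 0
  have hder := h1t 0 0
  have h00 : h 0 0 = 0 := by simp [hh]
  have hlim := hder.hasDerivWithinAt (s := Ioi 0)
  rw [hasDerivWithinAt_iff_tendsto_slope' (by simp)] at hlim
  have hge : 0 ≤ A * (2 * d - 2 * 0) + N / 2 * (d - 2 * 0) - (wt 0 0 + wt 0 (-0)) / 2 := by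
    apply ge_of_tendsto hlim
    filter_upwards [Ioo_mem_nhdsGT hd] with t ht
    have : 0 ≤ h 0 t := hpos.trans (hmin' 0 t (by linarith) hd.le ht.1.le ht.2.le)
    rw [slope_def_field, h00]
    exact div_nonneg (by linarith) (by linarith [ht.1])
  have hfin : A * d = M / d := by rw [hA]; field_simp
  simp only [neg_zero, mul_zero, sub_zero] at hge
  have : 2 * M / d = 2 * (M / d) := by ring
  rw [this, ← hfin]
  linarith

lemma diff_u (u : E2 → E2) (hu : ContDiff ℝ (⊤ : ℕ∞) u) : Differentiable ℝ u := hu.differentiable (by simp)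

lemma diff_du (u : E2 → E2) (hu : ContDiff ℝ (⊤ : ℕ∞) u) (v : E2) : Differentiable ℝ (fun y => fderiv ℝ u y v) :=
  ((hu.fderiv_right (m := (⊤ : ℕ∞)) (by simp)).differentiable (by simp)).clm_apply
    (differentiable_const v)

lemma line1 (u : E2 → E2) (hu : ContDiff ℝ (⊤ : ℕ∞) u) (x v : E2) (t : ℝ) :
    HasDerivAt (fun t : ℝ => u (x + t • v)) (fderiv ℝ u (x + t • v) v) t := by
  have h1 : HasDerivAt (fun t : ℝ => x + t • v) v t := by
    simpa using ((hasDerivAt_id t).smul_const v).const_add x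
  exact ((diff_u u hu) _).hasFDerivAt.comp_hasDerivAt t h1

lemma line2 (u : E2 → E2) (hu : ContDiff ℝ (⊤ : ℕ∞) u) (x v : E2) (t : ℝ) :
    HasDerivAt (fun t : ℝ => fderiv ℝ u (x + t • v) v)
      (fderiv ℝ (fun y => fderiv ℝ u y v) (x + t • v) v) t := by
  have h1 : HasDerivAt (fun t : ℝ => x + t • v) v t := by
    simpa using ((hasDerivAt_id t).smul_const v).const_add x
  exact ((diff_du u hu v) _).hasFDerivAt.comp_hasDerivAt t h1

/-- At a maximum of `‖u‖`, the inner product of `u` and its Laplacian is nonpositive. -/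
lemma inner_lap_nonpos (u : E2 → E2) (hu : ContDiff ℝ (⊤ : ℕ∞) u) (x : E2) (hx : ∀ y, ‖u y‖ ≤ ‖u x‖) : inner ℝ (u x) (lap u x) ≤ 0 := by
  rw [lap, inner_sum]
  apply Finset.sum_nonpos
  intro i _
  set v := e2basis i
  have k := secondDeriv_nonneg
    (fun t => - inner ℝ (u (x + t • v)) (u (x + t • v)))
    (fun t => - (2 * inner ℝ (u (x + t • v)) (fderiv ℝ u (x + t • v) v)))
    (- (2 * (inner ℝ (u (x + (0 : ℝ) • v)) (fderiv ℝ (fun y => fderiv ℝ u y v) (x + (0 : ℝ) • v) v)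
      + inner ℝ (fderiv ℝ u (x + (0 : ℝ) • v) v) (fderiv ℝ u (x + (0 : ℝ) • v) v)))) 0
    (fun t => by
      have := ((line1 u hu x v t).inner ℝ (line1 u hu x v t)).neg
      refine this.congr_deriv ?_
      rw [real_inner_comm (u (x + t • v)) (fderiv ℝ u (x + t • v) v)]
      ring)
    (by
      have := (((line1 u hu x v 0).inner ℝ (line2 u hu x v 0)).const_mul 2).neg
      exact this)
    (by
      apply Filter.Eventually.of_forall
      intro t
      simp only [real_inner_self_eq_norm_sq, zero_smul, add_zero]
      have := pow_le_pow_left₀ (norm_nonneg _) (hx (x + t • v)) 2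
      linarith)
  have p := real_inner_self_nonneg (x := fderiv ℝ u x v)
  simp only [zero_smul, add_zero] at k
  linarith

lemma grad_bound (u : E2 → E2) (hu : ContDiff ℝ (⊤ : ℕ∞) u) (x : E2) (M N d : ℝ) (hd : 0 < d) (hM : ∀ y, ‖u y‖ ≤ M)
    (hN : ∀ y, ‖lap u y‖ < N) (i j : Fin 2) (hl : ∀ y, lap u y =
      fderiv ℝ (fun y => fderiv ℝ u y (e2basis j)) y (e2basis j) +
      fderiv ℝ (fun y => fderiv ℝ u y (e2basis i)) y (e2basis i)) :
    ‖fderiv ℝ u x (e2basis i)‖ ≤ 2 * M / d + N * d / 2 := by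
  have hM0 : 0 ≤ M := (norm_nonneg _).trans (hM 0)
  have hN0 : 0 < N := (norm_nonneg _).trans_lt (hN 0)
  set c := fderiv ℝ u x (e2basis i) with hcdef
  set p := e2basis j
  set q := e2basis i
  by_cases hc0 : c = 0
  · rw [hc0, norm_zero]; positivity
  have hcpos : 0 < ‖c‖ := norm_pos_iff.2 hc0
  have hco : ∀ (g : ℝ → E2) (g' : E2) (t : ℝ), HasDerivAt g g' t →
      HasDerivAt (fun t => (inner ℝ c (g t) : ℝ)) (inner ℝ c g') t := by
    intro g g' t hg
    simpa using (hasDerivAt_const t c).inner ℝ hg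
  have hcomm : ∀ s t : ℝ, x + s • p + t • q = x + t • q + s • p := by intro s t; abel
  have key := grad_estimate
    (fun s t => inner ℝ c (u (x + s • p + t • q)))
    (fun s t => inner ℝ c (fderiv ℝ u (x + s • p + t • q) p))
    (fun s t => inner ℝ c (fderiv ℝ (fun y => fderiv ℝ u y p) (x + s • p + t • q) p))
    (fun s t => inner ℝ c (fderiv ℝ u (x + s • p + t • q) q))
    (fun s t => inner ℝ c (fderiv ℝ (fun y => fderiv ℝ u y q) (x + s • p + t • q) q))
    (‖c‖ * M) (‖c‖ * N) d hd
    (by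
      have := hu.continuous
      simp only [Function.uncurry_def]
      fun_prop)
    (fun s t => by
      simp only [hcomm]; exact hco _ _ _ (line1 u hu (x + t • q) p s))
    (fun s t => by
      simp only [hcomm]; exact hco _ _ _ (line2 u hu (x + t • q) p s))
    (fun s t => hco _ _ _ (line1 u hu (x + s • p) q t))
    (fun s t => hco _ _ _ (line2 u hu (x + s • p) q t))
    (fun s t => (abs_real_inner_le_norm _ _).trans
      (mul_le_mul_of_nonneg_left (hM _) hcpos.le))
    (fun s t => by
      rw [← inner_add_right, ← hl]
      exact (abs_real_inner_le_norm _ _).trans_lt (mul_lt_mul_of_pos_left (hN _) hcpos))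
  simp only [zero_smul, add_zero, ← hcdef, real_inner_self_eq_norm_sq] at key
  have e : 2 * (‖c‖ * M) / d + ‖c‖ * N * d / 2 = ‖c‖ * (2 * M / d + N * d / 2) := by ring
  rw [e, sq] at key
  exact le_of_mul_le_mul_left key hcpos

lemma opnorm_le (L : E2 →L[ℝ] E2) (B : ℝ) (hB : 0 ≤ B) (h : ∀ i, ‖L (e2basis i)‖ ≤ B) :
    ‖L‖ ≤ 2 * B := by
  apply L.opNorm_le_bound (by positivity)
  intro x
  have hx : x = x 0 • e2basis 0 + x 1 • e2basis 1 := by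
    ext k; fin_cases k <;> simp [e2basis]
  have b : ∀ k, ‖x k‖ ≤ ‖x‖ := fun k => PiLp.norm_apply_le x k
  calc ‖L x‖ = ‖x 0 • L (e2basis 0) + x 1 • L (e2basis 1)‖ := by
        conv_lhs => rw [hx]
        simp
    _ ≤ ‖x 0‖ * ‖L (e2basis 0)‖ + ‖x 1‖ * ‖L (e2basis 1)‖ := by
        refine (norm_add_le _ _).trans ?_
        rw [norm_smul, norm_smul]
    _ ≤ ‖x‖ * B + ‖x‖ * B := by
        gcongr
        exacts [b 0, h 0, b 1, h 1]
    _ = 2 * B * ‖x‖ := by ring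

theorem statement9
    (μ : E2 → ℝ) (μrad : ℝ → ℝ) (ρ : ℝ) (f : E2 → E2) (frad : ℝ → ℝ)
    (hμ : MuHyp μ μrad ρ) (hf : FHyp f frad) :
    ∀ C : ℝ, ∃ M : ℝ, ∀ (ε a : ℝ) (u : E2 → E2), 0 < ε → 0 ≤ a → ε * a ≤ C →
      IsSolution ε a μ f u → Tendsto u (Filter.cocompact E2) (𝓝 0) →
      ∀ x : E2, ‖u x‖ ≤ M ∧ ε * ‖fderiv ℝ u x‖ ≤ M := by
  intro C
  obtain ⟨Cμ, hCμ⟩ := hμ.bdd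
  obtain ⟨Cf, hCf⟩ := hf.bdd
  have hCμ0 : 0 ≤ Cμ := (abs_nonneg _).trans (hCμ 0)
  have hCf0 : 0 ≤ Cf := (norm_nonneg _).trans (hCf 0)
  set M : ℝ := 1 + Cμ + |C| * Cf with hM
  set K : ℝ := Cμ * M + M ^ 2 * M + |C| * Cf + 1 with hK
  have hM1 : 1 ≤ M := by
    have : 0 ≤ |C| * Cf := by positivity
    linarith
  have hK0 : 0 < K := by positivity
  refine ⟨M + 4 * M + K, ?_⟩
  intro ε a u hε ha hεa hsol hlim x
  obtain ⟨hu, heq⟩ := hsol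
  have hεa0 : 0 ≤ ε * a := by positivity
  have hεaC : ε * a ≤ |C| := hεa.trans (le_abs_self C)
  have hbd : ∀ y, ‖u y‖ ≤ M := by
    by_contra hcon
    push Not at hcon
    obtain ⟨x₀, hx₀⟩ := hcon
    have hev : ∀ᶠ y in cocompact E2, ‖u y‖ ≤ ‖u x₀‖ := by
      have h0 := hlim.norm
      rw [norm_zero] at h0
      filter_upwards [h0.eventually_lt_const (show 0 < ‖u x₀‖ by linarith)] with y hy using hy.le
    obtain ⟨z, hz⟩ := hu.continuous.norm.exists_forall_ge' x₀ hev
    have hin := inner_lap_nonpos u hu z hz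
    have e := congrArg (fun v => (inner ℝ (u z) v : ℝ)) (heq z)
    simp only [inner_add_right, inner_sub_right, inner_smul_right, inner_zero_right,
      real_inner_self_eq_norm_sq] at e
    have hm : M < ‖u z‖ := hx₀.trans_le (hz x₀)
    set m := ‖u z‖ with hmdef
    have e1 : ε ^ 2 * inner ℝ (u z) (lap u z) ≤ 0 :=
      mul_nonpos_of_nonneg_of_nonpos (by positivity) hin
    have e2 : μ z * m ^ 2 ≤ Cμ * m ^ 2 :=
      mul_le_mul_of_nonneg_right ((le_abs_self _).trans (hCμ z)) (by positivity)
    have e3 : (ε * a) * inner ℝ (u z) (f z) ≤ |C| * (m * Cf) := by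
      have i1 : (inner ℝ (u z) (f z) : ℝ) ≤ m * Cf :=
        (real_inner_le_norm _ _).trans (mul_le_mul_of_nonneg_left (hCf z) (norm_nonneg _))
      have hmm : 0 ≤ m * Cf := by positivity
      exact (mul_le_mul_of_nonneg_left i1 hεa0).trans (mul_le_mul_of_nonneg_right hεaC hmm)
    have e4 : m ^ 2 * m ^ 2 ≤ Cμ * m ^ 2 + |C| * (m * Cf) := by linarith
    have hm1 : 1 < m := by linarith
    have e5 : |C| * (m * Cf) ≤ |C| * Cf * m ^ 2 := by
      have : 0 ≤ |C| * Cf := by positivity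
      nlinarith [mul_nonneg this (show 0 ≤ m * (m - 1) by nlinarith)]
    have e6 : m ^ 2 * m ^ 2 ≤ m ^ 2 * (M - 1) := by rw [hM]; linarith
    have e7 := le_of_mul_le_mul_left e6 (by positivity)
    nlinarith
  have hlap : ∀ y, ‖lap u y‖ < K / ε ^ 2 := by
    intro y
    rw [lt_div_iff₀ (by positivity)]
    have e : ε ^ 2 • lap u y = ‖u y‖ ^ 2 • u y - μ y • u y - (ε * a) • f y := by
      rw [← sub_eq_zero, ← heq y]; abel
    have e' : ‖lap u y‖ * ε ^ 2 = ‖ε ^ 2 • lap u y‖ := by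
      rw [norm_smul, Real.norm_of_nonneg (by positivity), mul_comm]
    rw [e', e]
    have t1 : ‖‖u y‖ ^ 2 • u y‖ ≤ M ^ 2 * M := by
      rw [norm_smul, Real.norm_of_nonneg (by positivity)]
      gcongr <;> exact hbd y
    have t2 : ‖μ y • u y‖ ≤ Cμ * M := by
      rw [norm_smul]
      gcongr
      exacts [hCμ y, hbd y]
    have t3 : ‖(ε * a) • f y‖ ≤ |C| * Cf := by
      rw [norm_smul, Real.norm_of_nonneg hεa0]
      gcongr
      exact hCf y
    have := norm_sub_le (‖u y‖ ^ 2 • u y - μ y • u y) ((ε * a) • f y)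
    have := norm_sub_le (‖u y‖ ^ 2 • u y) (μ y • u y)
    linarith
  have hop : ‖fderiv ℝ u x‖ ≤ 2 * (2 * M / ε + K / ε ^ 2 * ε / 2) := by
    apply opnorm_le _ _ (by positivity)
    intro i
    fin_cases i
    · exact grad_bound u hu x M _ ε hε hbd hlap 0 1
        (fun y => by rw [lap, Fin.sum_univ_two, add_comm])
    · exact grad_bound u hu x M _ ε hε hbd hlap 1 0
        (fun y => by rw [lap, Fin.sum_univ_two])
  constructor
  · linarith [hbd x]
  · calc ε * ‖fderiv ℝ u x‖ ≤ ε * (2 * (2 * M / ε + K / ε ^ 2 * ε / 2)) := by gcongr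
      _ = 4 * M + K := by field_simp; ring
      _ ≤ _ := by linarith
end
end

section
/- Suppose a = a(ε) belongs to a bounded interval, and let u_{ε,a} be smooth solutions of ε²Δu + μ(x)u − |u|²u + εa f(x) = 0 on ℝ² with u(x) → 0 as |x| → ∞. Then there is a constant K > 0 such that for all sufficiently small ε > 0, |u_{ε,a}(x)| ≤ K(√(max(μ(x),0)) + ε^{1/3}) for all x ∈ ℝ². In particular, for each ξ = ρe^{iθ}, writing s = (s₁,s₂) in the basis (e^{iθ}, ie^{iθ}), the rescaled maps ũ_{ε,a}(s) = ε^{-1/3} u_{ε,a}(ξ + ε^{2/3}s) are, for each s₀ ∈ ℝ, uniformly bounded on the half-plane [s₀,∞) × ℝ. -/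
open MeasureTheory Filter Real Set
open scoped Topology ENNReal

noncomputable section

theorem sq_le_imp_le {a b : ℝ} (h : a ^ 2 ≤ b ^ 2) (hb : 0 ≤ b) : a ≤ b :=
  (le_abs_self a).trans (abs_le_of_sq_le_sq h hb)

/-- Necessary second order condition at a local maximum. -/
theorem second_deriv_nonpos_s10 {g g' : ℝ → ℝ} {c : ℝ} (h1 : ∀ t, HasDerivAt g (g' t) t)
    (h2 : HasDerivAt g' c 0) (hmax : IsLocalMax g 0) : c ≤ 0 := by
  by_contra! hc
  have hd : deriv g = g' := funext fun t => (h1 t).deriv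
  have hdd : deriv (deriv g) 0 = c := by rw [hd]; exact h2.deriv
  have hmin : IsLocalMin g 0 := by
    apply isLocalMin_of_deriv_deriv_pos
    · rw [hdd]; exact hc
    · exact hmax.deriv_eq_zero
    · exact (h1 0).continuousAt
  have heq : g =ᶠ[𝓝 0] fun _ => g 0 := by
    filter_upwards [hmax, hmin] with t a b
    exact le_antisymm a b
  have h3 : deriv g =ᶠ[𝓝 0] deriv (fun _ => g 0) := heq.deriv
  have h4 := h3.deriv_eq
  rw [hdd] at h4
  simp at h4
  linarith

theorem mu_bounds {μ : E2 → ℝ} {μrad : ℝ → ℝ} {ρ : ℝ} (hμ : MuHyp μ μrad ρ) :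
    ∃ m M : ℝ, 0 < m ∧ 0 < M ∧ (∀ x : E2, μ x ≤ M * max (ρ ^ 2 - ‖x‖ ^ 2) 0) ∧
      (∀ x : E2, m * max (ρ ^ 2 - ‖x‖ ^ 2) 0 ≤ max (μ x) 0) := by
  have hρ := hμ.rho_pos
  have hdiff : Differentiable ℝ μrad := hμ.smooth_rad.differentiable (by simp)
  have hanti : StrictAntiOn μrad (Ici 0) := by
    apply strictAntiOn_of_deriv_neg (convex_Ici 0) hdiff.continuous.continuousOn
    intro x hx
    rw [interior_Ici] at hx
    exact hμ.deriv_neg x hx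
  have hq : ContinuousOn (fun r => -dslope μrad ρ r) (Icc 0 ρ) := by
    apply Continuous.continuousOn
    apply Continuous.neg
    rw [← continuousOn_univ, continuousOn_dslope univ_mem]
    exact ⟨hdiff.continuous.continuousOn, hdiff ρ⟩
  have hform : ∀ r, μrad r = (-dslope μrad ρ r) * (ρ - r) := by
    intro r
    have := sub_smul_dslope μrad ρ r
    rw [hμ.rho_root, smul_eq_mul] at this
    linarith
  have hpos : ∀ r ∈ Icc 0 ρ, 0 < -dslope μrad ρ r := by
    intro r hr
    rcases eq_or_lt_of_le hr.2 with h | h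
    · subst h
      rw [dslope_same]
      linarith [hμ.deriv_neg r hρ]
    · have h1 := hanti (show r ∈ Ici 0 from hr.1) (show ρ ∈ Ici 0 from hρ.le) h
      rw [hμ.rho_root, hform r] at h1
      exact pos_of_mul_pos_left h1 (by linarith)
  obtain ⟨r1, hr1, hmin⟩ := isCompact_Icc.exists_isMinOn (nonempty_Icc.2 hρ.le) hq
  obtain ⟨r2, hr2, hmax⟩ := isCompact_Icc.exists_isMaxOn (nonempty_Icc.2 hρ.le) hq
  have hm := hpos r1 hr1
  have hM := hpos r2 hr2
  have hmin' : ∀ r ∈ Icc 0 ρ, -dslope μrad ρ r1 ≤ -dslope μrad ρ r := fun r hr => hmin hr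
  have hmax' : ∀ r ∈ Icc 0 ρ, -dslope μrad ρ r ≤ -dslope μrad ρ r2 := fun r hr => hmax hr
  generalize -dslope μrad ρ r1 = m at *
  generalize -dslope μrad ρ r2 = M at *
  refine ⟨m / (2 * ρ), M / ρ, by positivity, by positivity, ?_, ?_⟩
  · intro x
    rw [hμ.radial]
    generalize hr : ‖x‖ = r
    have hr0 : 0 ≤ r := hr ▸ norm_nonneg x
    rcases le_total r ρ with h | h
    · have h1 := hmax' r ⟨hr0, h⟩
      have h2 := hform r
      have h3 : μrad r ≤ M * (ρ - r) := by
        rw [h2]; exact mul_le_mul_of_nonneg_right h1 (by linarith)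
      have h4 : M * (ρ - r) ≤ M / ρ * (ρ ^ 2 - r ^ 2) := by
        rw [div_mul_eq_mul_div, le_div_iff₀ hρ, mul_assoc]
        apply mul_le_mul_of_nonneg_left _ hM.le
        nlinarith
      exact h3.trans (h4.trans (mul_le_mul_of_nonneg_left (le_max_left _ _) (by positivity)))
    · have h1 := hanti.antitoneOn (show ρ ∈ Ici 0 from hρ.le) (show r ∈ Ici 0 from hr0) h
      rw [hμ.rho_root] at h1
      exact h1.trans (by positivity)
  · intro x
    rw [hμ.radial]
    generalize hr : ‖x‖ = r
    have hr0 : 0 ≤ r := hr ▸ norm_nonneg x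
    rcases le_total r ρ with h | h
    · have h1 := hmin' r ⟨hr0, h⟩
      have h2 := hform r
      have h3 : m * (ρ - r) ≤ μrad r := by
        rw [h2]; exact mul_le_mul_of_nonneg_right h1 (by linarith)
      have h4 : m / (2 * ρ) * (ρ ^ 2 - r ^ 2) ≤ m * (ρ - r) := by
        rw [div_mul_eq_mul_div, div_le_iff₀ (by positivity), mul_assoc]
        apply mul_le_mul_of_nonneg_left _ hm.le
        nlinarith
      rw [max_eq_left (by nlinarith : 0 ≤ ρ ^ 2 - r ^ 2)]
      exact h4.trans (h3.trans (le_max_left _ _))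
    · rw [max_eq_right (by nlinarith : ρ ^ 2 - r ^ 2 ≤ 0), mul_zero]
      exact le_max_right _ _

/-- The polynomial barrier. -/
def barrier (A ρ s δ : ℝ) (x : E2) : ℝ := A * ((ρ ^ 2 - ‖x‖ ^ 2 + s) ^ 2 / (2 * s) + δ)

theorem norm_e2basis (i : Fin 2) : ‖e2basis i‖ = 1 := by simp [e2basis]

theorem inner_e2basis (x : E2) (i : Fin 2) : (inner ℝ x (e2basis i) : ℝ) = x i := by
  simp [e2basis, EuclideanSpace.inner_single_right]

/-- One-dimensional second order condition along a coordinate direction. -/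
theorem direction_ineq {u : E2 → E2} (hu : ContDiff ℝ (⊤ : ℕ∞) u) {A ρ s δ : ℝ} (hs : 0 < s)
    {x : E2} (hx : ∀ y, ‖u y‖ ^ 2 - barrier A ρ s δ y ≤ ‖u x‖ ^ 2 - barrier A ρ s δ x)
    (i : Fin 2) :
    2 * (inner ℝ (u x) (fderiv ℝ (fun y => fderiv ℝ u y (e2basis i)) x (e2basis i)) : ℝ)
      ≤ A * ((4 * (x i) ^ 2 - 2 * (ρ ^ 2 - ‖x‖ ^ 2 + s)) / s) := by
  set e := e2basis i with he
  have hline : ∀ t : ℝ, HasDerivAt (fun t : ℝ => x + t • e) e t := by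
    intro t
    simpa using ((hasDerivAt_id t).smul_const e).const_add x
  have hdu : Differentiable ℝ u := hu.differentiable (by simp)
  have hdu2 : Differentiable ℝ (fun y => fderiv ℝ u y e) := by
    have : ContDiff ℝ 1 (fderiv ℝ u) := hu.fderiv_right (by norm_cast)
    exact (this.differentiable (by simp)).clm_apply (differentiable_const e)
  have h1 : ∀ t : ℝ, HasDerivAt (fun t : ℝ => u (x + t • e)) (fderiv ℝ u (x + t • e) e) t :=
    fun t => (hdu (x + t • e)).hasFDerivAt.comp_hasDerivAt t (hline t)
  have h2 : HasDerivAt (fun t : ℝ => fderiv ℝ u (x + t • e) e)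
      (fderiv ℝ (fun y => fderiv ℝ u y e) x e) 0 := by
    have := (hdu2 (x + (0:ℝ) • e)).hasFDerivAt.comp_hasDerivAt 0 (hline 0)
    simp only [zero_smul, add_zero] at this
    exact this
  have hp : ∀ t : ℝ, ‖x + t • e‖ ^ 2 = ‖x‖ ^ 2 + 2 * t * x i + t ^ 2 := by
    intro t
    rw [norm_add_sq_real, norm_smul, inner_smul_right, he, inner_e2basis, norm_e2basis]
    simp
    ring
  let G : ℝ → ℝ := fun t => (inner ℝ (u (x + t • e)) (u (x + t • e)) : ℝ) -
    A * ((ρ ^ 2 - (‖x‖ ^ 2 + 2 * t * x i + t ^ 2) + s) ^ 2 / (2 * s) + δ)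
  let G' : ℝ → ℝ := fun t => 2 * (inner ℝ (u (x + t • e)) (fderiv ℝ u (x + t • e) e) : ℝ) -
    A * ((ρ ^ 2 - (‖x‖ ^ 2 + 2 * t * x i + t ^ 2) + s) * (-2 * x i - 2 * t) / s)
  have hq : ∀ t : ℝ, HasDerivAt (fun t : ℝ => ρ ^ 2 - (‖x‖ ^ 2 + 2 * t * x i + t ^ 2) + s)
      (-2 * x i - 2 * t) t := by
    intro t
    have a1 := (((hasDerivAt_id t).const_mul 2).mul_const (x i)).const_add (‖x‖ ^ 2)
    have a2 := (((a1.add ((hasDerivAt_id t).pow 2)).const_sub (ρ ^ 2))).add_const s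
    convert! a2 using 1
    simp
    ring
  have hG : ∀ t, HasDerivAt G (G' t) t := by
    intro t
    have b1 := (h1 t).inner ℝ (h1 t)
    have b2 := ((((hq t).pow 2).div_const (2 * s)).add_const δ).const_mul A
    convert! b1.sub b2 using 1
    simp only [G']
    rw [real_inner_comm (fderiv ℝ u (x + t • e) e)]
    field_simp
    ring
  have hG2 : HasDerivAt G' (2 * ((inner ℝ (u x) (fderiv ℝ (fun y => fderiv ℝ u y e) x e) : ℝ) +
      ‖fderiv ℝ u x e‖ ^ 2) - A * ((4 * (x i) ^ 2 - 2 * (ρ ^ 2 - ‖x‖ ^ 2 + s)) / s)) 0 := by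
    have b1 := ((h1 0).inner ℝ h2).const_mul 2
    have l : HasDerivAt (fun t : ℝ => -2 * x i - 2 * t) (-2) 0 := by
      simpa using ((hasDerivAt_id (0:ℝ)).const_mul 2).const_sub (-2 * x i)
    have b2 := (((hq 0).mul l).div_const s).const_mul A
    convert! b1.sub b2 using 1
    simp
    left
    ring
  have hmax : IsLocalMax G 0 := by
    refine Filter.Eventually.of_forall fun t => ?_
    have := hx (x + t • e)
    simp only [G, real_inner_self_eq_norm_sq]
    simp only [barrier, hp] at this
    simpa using this
  have := second_deriv_nonpos_s10 hG hG2 hmax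
  nlinarith [sq_nonneg ‖fderiv ℝ u x e‖]

/-- Maximum principle at a maximum of `|u|² - barrier`. -/
theorem lap_ineq {u : E2 → E2} (hu : ContDiff ℝ (⊤ : ℕ∞) u) {A ρ s δ : ℝ} (hs : 0 < s)
    {x : E2} (hx : ∀ y, ‖u y‖ ^ 2 - barrier A ρ s δ y ≤ ‖u x‖ ^ 2 - barrier A ρ s δ x) :
    2 * (inner ℝ (u x) (lap u x) : ℝ)
      ≤ A * ((4 * ‖x‖ ^ 2 - 4 * (ρ ^ 2 - ‖x‖ ^ 2 + s)) / s) := by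
  have h0 := direction_ineq hu hs hx 0
  have h1 := direction_ineq hu hs hx 1
  have hn : ‖x‖ ^ 2 = (x 0) ^ 2 + (x 1) ^ 2 := by
    rw [EuclideanSpace.norm_sq_eq]; simp
  rw [lap, Fin.sum_univ_two, inner_add_right]
  have : A * ((4 * ‖x‖ ^ 2 - 4 * (ρ ^ 2 - ‖x‖ ^ 2 + s)) / s) =
     A * ((4 * (x 0) ^ 2 - 2 * (ρ ^ 2 - ‖x‖ ^ 2 + s)) / s) +
     A * ((4 * (x 1) ^ 2 - 2 * (ρ ^ 2 - ‖x‖ ^ 2 + s)) / s) := by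
    rw [← mul_add, ← add_div]; congr 2; rw [hn]; ring
  linarith

set_option maxHeartbeats 2000000 in
/-- The algebraic core: the barrier is a strict supersolution. -/
theorem algebra_core {A ρ s d G M p v L m k : ℝ} (hd : 0 < d) (hd1 : d ≤ 1) (hs : d ^ 2 ≤ s)
    (hG : 0 ≤ G) (hM : 0 ≤ M) (hA : A = 17 + 4 * ρ ^ 2 + 4 * G + 4 * M) (hv : 0 ≤ v)
    (hgt : A * ((p + s) ^ 2 / (2 * s) + d ^ 2) < v ^ 2)
    (hm : m ≤ M * max p 0) (hk : k ≤ G * v)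
    (heq : d ^ 6 * L = v ^ 4 - m * v ^ 2 - d ^ 3 * k)
    (hL : 2 * L ≤ A * ((4 * (ρ ^ 2 - p) - 4 * (p + s)) / s)) : False := by
  have hs0 : 0 < s := lt_of_lt_of_le (by positivity) hs
  have hA0 : 17 ≤ A := by nlinarith [sq_nonneg ρ]
  set δ := d ^ 2 with hδ
  have hδ0 : 0 < δ := by positivity
  have hδ1 : δ ≤ 1 := by nlinarith
  set ψ := (p + s) ^ 2 / (2 * s) + δ with hψ
  have hψδ : δ ≤ ψ := by
    have : 0 ≤ (p + s) ^ 2 / (2 * s) := by positivity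
    linarith
  have hψ0 : 0 < ψ := by linarith
  have hψp : max p 0 ≤ ψ := by
    apply max_le _ hψ0.le
    have : p ≤ (p + s) ^ 2 / (2 * s) := by
      rw [le_div_iff₀ (by positivity)]; nlinarith [sq_nonneg p, sq_nonneg s]
    linarith
  have hmv : 4 * m ≤ v ^ 2 := by
    have : M * max p 0 ≤ M * ψ := mul_le_mul_of_nonneg_left hψp hM
    nlinarith [mul_nonneg hG hψ0.le, mul_nonneg (sq_nonneg ρ) hψ0.le]
  have hdv : d ≤ v := by
    apply sq_le_imp_le _ hv
    nlinarith
  have hkv : 4 * (d ^ 3 * k) ≤ v ^ 4 := by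
    have e1 : d ^ 3 * k ≤ d ^ 3 * (G * v) := mul_le_mul_of_nonneg_left hk (by positivity)
    have e2 : d ^ 3 * (G * v) ≤ G * δ * v ^ 2 := by
      have : d ^ 3 * (G * v) = (G * δ * v) * d := by rw [hδ]; ring
      rw [this]
      have : G * δ * v ^ 2 = (G * δ * v) * v := by ring
      rw [this]
      exact mul_le_mul_of_nonneg_left hdv (by positivity)
    have e3 : 4 * (G * δ) ≤ v ^ 2 := by
      have : A * δ ≤ A * ψ := mul_le_mul_of_nonneg_left hψδ (by linarith)
      have : 4 * G * δ ≤ A * δ := mul_le_mul_of_nonneg_right (by nlinarith [sq_nonneg ρ]) hδ0.le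
      nlinarith
    nlinarith [sq_nonneg v]
  have hLv : v ^ 4 ≤ 2 * (d ^ 6 * L) := by nlinarith [sq_nonneg v]
  have hd6 : d ^ 6 = δ ^ 3 := by rw [hδ]; ring
  have hAψ : A ^ 2 * ψ ^ 2 < v ^ 4 := by
    have : (A * ψ) ^ 2 < (v ^ 2) ^ 2 := by
      apply pow_lt_pow_left₀ hgt (by positivity) (by norm_num)
    nlinarith
  -- bound of the Laplacian of the barrier
  have hlap : (4 * (ρ ^ 2 - p) - 4 * (p + s)) / s ≤ 4 + (4 * ρ ^ 2 + 4) / s + 8 * ψ := by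
    have : 8 * ψ = 4 * (p + s) ^ 2 / s + 8 * δ := by rw [hψ]; field_simp; ring
    have h2 : (4 * (ρ ^ 2 - p) - 4 * (p + s)) / s ≤
        4 + (4 * ρ ^ 2 + 4) / s + 4 * (p + s) ^ 2 / s := by
      have : 4 + (4 * ρ ^ 2 + 4) / s + 4 * (p + s) ^ 2 / s =
        (4 * s + (4 * ρ ^ 2 + 4) + 4 * (p + s) ^ 2) / s := by field_simp
      rw [this]
      apply div_le_div_of_nonneg_right _ hs0.le
      nlinarith [sq_nonneg (p + s + 1)]
    linarith
  have hinv : δ / s ≤ 1 := by rw [div_le_one hs0]; exact hs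
  have hδψ : δ ^ 2 ≤ ψ ^ 2 := pow_le_pow_left₀ hδ0.le hψδ 2
  have hfin : δ ^ 3 * ((4 * (ρ ^ 2 - p) - 4 * (p + s)) / s) ≤ (16 + 4 * ρ ^ 2) * ψ ^ 2 := by
    calc δ ^ 3 * ((4 * (ρ ^ 2 - p) - 4 * (p + s)) / s)
        ≤ δ ^ 3 * (4 + (4 * ρ ^ 2 + 4) / s + 8 * ψ) :=
          mul_le_mul_of_nonneg_left hlap (by positivity)
      _ = 4 * (δ * δ ^ 2) + (4 * ρ ^ 2 + 4) * ((δ / s) * δ ^ 2) + 8 * (δ * δ * (δ * ψ)) := by ring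
      _ ≤ 4 * ψ ^ 2 + (4 * ρ ^ 2 + 4) * ψ ^ 2 + 8 * ψ ^ 2 := by
          have f1 : δ * δ ^ 2 ≤ ψ ^ 2 := by nlinarith [sq_nonneg δ]
          have f2 : (δ / s) * δ ^ 2 ≤ ψ ^ 2 := by nlinarith [sq_nonneg δ]
          have f3 : δ * ψ ≤ ψ ^ 2 := by nlinarith
          have f4 : δ * δ ≤ 1 := by nlinarith
          have f5 : δ * δ * (δ * ψ) ≤ ψ ^ 2 := by
            nlinarith [mul_nonneg hδ0.le hψ0.le]
          have f6 := mul_le_mul_of_nonneg_left f2 (show 0 ≤ 4 * ρ ^ 2 + 4 by positivity)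
          linarith
      _ = _ := by ring
  have h3 : 2 * (δ ^ 3 * L) ≤ A * ((16 + 4 * ρ ^ 2) * ψ ^ 2) := by
    have g1 := mul_le_mul_of_nonneg_left hL (show 0 ≤ δ ^ 3 by positivity)
    have g2 := mul_le_mul_of_nonneg_left hfin (show 0 ≤ A by linarith)
    linarith
  have h4 : A * ((16 + 4 * ρ ^ 2) * ψ ^ 2) ≤ A * (A * ψ ^ 2) := by
    apply mul_le_mul_of_nonneg_left _ (by linarith)
    apply mul_le_mul_of_nonneg_right _ (sq_nonneg ψ)
    linarith
  rw [hd6] at hLv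
  have h5 : A * (A * ψ ^ 2) = A ^ 2 * ψ ^ 2 := by ring
  linarith

/-- The barrier bounds `|u|²` everywhere. -/
theorem barrier_bound {μ : E2 → ℝ} {f u : E2 → E2} {ε a d s A ρ F C M : ℝ}
    (hd : 0 < d) (hd1 : d ≤ 1) (hs : d ^ 2 ≤ s) (hεd : ε = d ^ 3)
    (hF : ∀ x, ‖f x‖ ≤ F) (hM : 0 ≤ M) (ha : 0 ≤ a) (haC : a ≤ C)
    (hA : A = 17 + 4 * ρ ^ 2 + 4 * (C * F) + 4 * M)
    (hμ : ∀ x : E2, μ x ≤ M * max (ρ ^ 2 - ‖x‖ ^ 2) 0)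
    (hu : IsSolution ε a μ f u) (hlim : Tendsto u (Filter.cocompact E2) (𝓝 0)) (y : E2) :
    ‖u y‖ ^ 2 ≤ barrier A ρ s (d ^ 2) y := by
  by_contra! hy
  have hF0 : 0 ≤ F := (norm_nonneg _).trans (hF 0)
  have hC0 : 0 ≤ C := ha.trans haC
  have hs0 : 0 < s := lt_of_lt_of_le (by positivity) hs
  have hA0 : 0 < A := by rw [hA]; positivity
  have hcont : Continuous fun z => ‖u z‖ ^ 2 - barrier A ρ s (d ^ 2) z := by
    have := hu.1.continuous
    unfold barrier
    fun_prop
  have hev : ∀ᶠ z in cocompact E2, ‖u z‖ ^ 2 - barrier A ρ s (d ^ 2) z ≤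
      ‖u y‖ ^ 2 - barrier A ρ s (d ^ 2) y := by
    have h1 : Tendsto (fun z => ‖u z‖ ^ 2) (cocompact E2) (𝓝 0) := by
      simpa using (hlim.norm.pow 2)
    have h2 : 0 < A * d ^ 2 := by positivity
    filter_upwards [h1.eventually_lt_const h2] with z hz
    have : A * d ^ 2 ≤ barrier A ρ s (d ^ 2) z := by
      unfold barrier
      apply mul_le_mul_of_nonneg_left _ hA0.le
      have : 0 ≤ (ρ ^ 2 - ‖z‖ ^ 2 + s) ^ 2 / (2 * s) := by positivity
      linarith
    linarith
  obtain ⟨x, hx⟩ := hcont.exists_forall_ge' y hev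
  have hxy := hx y
  have hlap := lap_ineq hu.1 hs0 hx
  have hsol := congrArg (fun w => (inner ℝ (u x) w : ℝ)) (hu.2 x)
  simp only [inner_add_right, inner_sub_right, inner_smul_right, inner_zero_right,
    real_inner_self_eq_norm_sq] at hsol
  refine algebra_core (p := ρ ^ 2 - ‖x‖ ^ 2) (v := ‖u x‖) (L := inner ℝ (u x) (lap u x))
    (m := μ x) (k := a * inner ℝ (u x) (f x)) (ρ := ρ) (A := A) (s := s) hd hd1 hs
    (mul_nonneg hC0 hF0) hM hA (norm_nonneg _) ?_ (hμ x) ?_ ?_ ?_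
  · have : barrier A ρ s (d ^ 2) x < ‖u x‖ ^ 2 := by linarith
    exact this
  · have h1 : (inner ℝ (u x) (f x) : ℝ) ≤ ‖u x‖ * F :=
      (real_inner_le_norm _ _).trans (mul_le_mul_of_nonneg_left (hF x) (norm_nonneg _))
    calc a * (inner ℝ (u x) (f x) : ℝ) ≤ a * (‖u x‖ * F) := mul_le_mul_of_nonneg_left h1 ha
      _ ≤ C * (‖u x‖ * F) := mul_le_mul_of_nonneg_right haC (by positivity)
      _ = _ := by ring
  · rw [hεd] at hsol
    linear_combination hsol
  · convert hlap using 4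
    ring

/-- Optimising the barrier in `s`. -/
theorem main_bound {μ : E2 → ℝ} {f u : E2 → E2} {ε a d A ρ F C M : ℝ}
    (hd : 0 < d) (hd1 : d ≤ 1) (hεd : ε = d ^ 3)
    (hF : ∀ x, ‖f x‖ ≤ F) (hM : 0 ≤ M) (ha : 0 ≤ a) (haC : a ≤ C)
    (hA : A = 17 + 4 * ρ ^ 2 + 4 * (C * F) + 4 * M)
    (hμ : ∀ x : E2, μ x ≤ M * max (ρ ^ 2 - ‖x‖ ^ 2) 0)
    (hu : IsSolution ε a μ f u) (hlim : Tendsto u (Filter.cocompact E2) (𝓝 0)) (y : E2) :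
    ‖u y‖ ^ 2 ≤ A * (2 * max (ρ ^ 2 - ‖y‖ ^ 2) 0 + 3 * d ^ 2) := by
  have hF0 : 0 ≤ F := (norm_nonneg _).trans (hF 0)
  have hC0 : 0 ≤ C := ha.trans haC
  have hA0 : 0 < A := by rw [hA]; positivity
  have hδ : 0 < d ^ 2 := by positivity
  refine (barrier_bound (s := |ρ ^ 2 - ‖y‖ ^ 2| + d ^ 2) hd hd1 (by simp) hεd hF hM
    ha haC hA hμ hu hlim y).trans ?_
  unfold barrier
  apply mul_le_mul_of_nonneg_left _ hA0.le
  generalize ρ ^ 2 - ‖y‖ ^ 2 = p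
  generalize d ^ 2 = δ at *
  have : (p + (|p| + δ)) ^ 2 / (2 * (|p| + δ)) ≤ 2 * max p 0 + 2 * δ := by
    rw [div_le_iff₀ (by positivity)]
    rcases le_total 0 p with h | h
    · rw [abs_of_nonneg h, max_eq_left h]; nlinarith
    · rw [abs_of_nonpos h, max_eq_right h]; nlinarith
  linarith

/-- for bounded `a` and small `ε`, decaying smooth solutions satisfy
`|u_{ε,a}(x)| ≤ K(√(max(μ(x),0)) + ε^{1/3})`; consequently the rescaled maps
`ũ_{ε,a}(s) = ε^{-1/3}u_{ε,a}(ξ + ε^{2/3}s)`, `ξ = ρe^{iθ}`, `s` in the basis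
`(e^{iθ}, ie^{iθ})`, are uniformly bounded on each half-plane `[s₀,∞) × ℝ`. -/
theorem statement10
    (μ : E2 → ℝ) (μrad : ℝ → ℝ) (ρ : ℝ) (f : E2 → E2) (frad : ℝ → ℝ)
    (hμ : MuHyp μ μrad ρ) (hf : FHyp f frad) (C : ℝ) :
    ∃ K : ℝ, 0 < K ∧ ∃ ε₀ : ℝ, 0 < ε₀ ∧
      (∀ (ε a : ℝ) (u : E2 → E2), 0 < ε → ε < ε₀ → 0 ≤ a → a ≤ C →
        IsSolution ε a μ f u → Tendsto u (Filter.cocompact E2) (𝓝 0) →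
        ∀ x : E2, ‖u x‖ ≤ K * (Real.sqrt (max (μ x) 0) + ε^((1:ℝ)/3))) ∧
      (∀ s₀ : ℝ, ∃ K' : ℝ, ∀ (ε a : ℝ) (u : E2 → E2), 0 < ε → ε < ε₀ → 0 ≤ a → a ≤ C →
        IsSolution ε a μ f u → Tendsto u (Filter.cocompact E2) (𝓝 0) →
        ∀ e : E2, ‖e‖ = 1 → ∀ s : E2, s₀ ≤ s 0 →
          ‖u (ρ • e + ε^((2:ℝ)/3) • (s 0 • e + s 1 • perp e))‖ / ε^((1:ℝ)/3) ≤ K') := by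
  obtain ⟨m, M, hm, hM, hup, hlow⟩ := mu_bounds hμ
  obtain ⟨F, hF⟩ := hf.bdd
  have hF0 : 0 ≤ F := (norm_nonneg _).trans (hF 0)
  obtain ⟨A, hA⟩ : ∃ A, A = 17 + 4 * ρ ^ 2 + 4 * (|C| * F) + 4 * M := ⟨_, rfl⟩
  have hA0 : 0 < A := by rw [hA]; positivity
  have key : ∀ (ε a : ℝ) (u : E2 → E2), 0 < ε → ε < 1 → 0 ≤ a → a ≤ C →
        IsSolution ε a μ f u → Tendsto u (Filter.cocompact E2) (𝓝 0) → ∀ x : E2,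
        ‖u x‖ ^ 2 ≤ A * (2 * max (ρ ^ 2 - ‖x‖ ^ 2) 0 + 3 * (ε ^ ((1:ℝ)/3)) ^ 2) := by
    intro ε a u hε hε1 ha haC hu hlim x
    refine main_bound (by positivity) (Real.rpow_le_one hε.le hε1.le (by norm_num)) ?_ hF hM.le ha
      (haC.trans (le_abs_self C)) hA hup hu hlim x
    rw [← Real.rpow_natCast, ← Real.rpow_mul hε.le]
    norm_num
  refine ⟨Real.sqrt (A * (2 / m + 3)), by positivity, 1, one_pos, ?_, ?_⟩
  · intro ε a u hε hε1 ha haC hu hlim x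
    have h1 := key ε a u hε hε1 ha haC hu hlim x
    have hd : 0 < ε ^ ((1:ℝ)/3) := by positivity
    generalize ε ^ ((1:ℝ)/3) = d at *
    have h2 := hlow x
    have h0 : 0 ≤ max (μ x) 0 := le_max_right _ _
    generalize max (μ x) 0 = w at *
    have h3 : max (ρ ^ 2 - ‖x‖ ^ 2) 0 ≤ w / m := by
      rw [le_div_iff₀ hm]; linarith
    apply sq_le_imp_le _ (by positivity)
    rw [mul_pow, Real.sq_sqrt (by positivity), mul_assoc]
    refine h1.trans (mul_le_mul_of_nonneg_left ?_ hA0.le)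
    have h4 : w + d ^ 2 ≤ (Real.sqrt w + d) ^ 2 := by
      have := Real.sq_sqrt h0
      nlinarith [mul_nonneg (Real.sqrt_nonneg w) hd.le]
    have h5 : 2 * (w / m) + 3 * d ^ 2 ≤ (2 / m + 3) * (w + d ^ 2) := by
      have : (2 / m + 3) * (w + d ^ 2) = 2 * (w / m) + 3 * d ^ 2 + (3 * w + 2 / m * d ^ 2) := by
        ring
      have : 0 ≤ 3 * w + 2 / m * d ^ 2 := by positivity
      linarith
    have h6 := mul_le_mul_of_nonneg_left h4 (show 0 ≤ 2 / m + 3 by positivity)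
    linarith
  · intro s₀
    refine ⟨Real.sqrt (A * (4 * ρ * |s₀| + 3)), ?_⟩
    intro ε a u hε hε1 ha haC hu hlim e he s hs
    have hρ := hμ.rho_pos
    have h23 : ε ^ ((2:ℝ)/3) = (ε ^ ((1:ℝ)/3)) ^ 2 := by
      rw [← Real.rpow_natCast, ← Real.rpow_mul hε.le]
      norm_num
    rw [h23]
    have hd : 0 < ε ^ ((1:ℝ)/3) := by positivity
    have h1 := key ε a u hε hε1 ha haC hu hlim
      (ρ • e + (ε ^ ((1:ℝ)/3)) ^ 2 • (s 0 • e + s 1 • perp e))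
    generalize ε ^ ((1:ℝ)/3) = d at *
    have hn : e 0 ^ 2 + e 1 ^ 2 = 1 := by
      have := EuclideanSpace.norm_sq_eq e
      rw [he] at this
      simpa using this.symm
    have hx : ‖ρ • e + d ^ 2 • (s 0 • e + s 1 • perp e)‖ ^ 2 =
        (ρ + d ^ 2 * s 0) ^ 2 + (d ^ 2 * s 1) ^ 2 := by
      rw [EuclideanSpace.norm_sq_eq]
      simp [perp]
      linear_combination ((ρ + d ^ 2 * s 0) ^ 2 + (d ^ 2 * s 1) ^ 2) * hn
    have h2 : max (ρ ^ 2 - ‖ρ • e + d ^ 2 • (s 0 • e + s 1 • perp e)‖ ^ 2) 0 ≤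
        2 * ρ * |s₀| * d ^ 2 := by
      apply max_le _ (by positivity)
      rw [hx]
      have : -s 0 ≤ |s₀| := by linarith [neg_abs_le s₀]
      have := mul_le_mul_of_nonneg_left this (show 0 ≤ 2 * ρ * d ^ 2 by positivity)
      nlinarith [sq_nonneg (d ^ 2 * s 0), sq_nonneg (d ^ 2 * s 1)]
    rw [div_le_iff₀ hd]
    apply sq_le_imp_le _ (by positivity)
    rw [mul_pow, Real.sq_sqrt (by positivity), mul_assoc]
    refine h1.trans (mul_le_mul_of_nonneg_left ?_ hA0.le)
    nlinarith
end
end
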